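/- Let d ≥ 2, p ∈ (1,2], m > 2, and let A : ℝ^d → ℝ be locally Hölder continuous and positive with A(x) ≥ C(1+|x|)^m for all x and some C > 0. Let α, β : ℝ^d → ℝ be locally Hölder continuous with 0 < α, sup_{x∈ℝ^d} α(x) < ∞, and 0 ≤ β bounded from above. Then there exists a function u : ℝ^d × [0,∞) → ℝ, not identically zero, that is continuous, nonnegative, twice continuously differentiable in x and once in t on ℝ^d × (0,∞), satisfies ∂u/∂t = A(x)Δu + β(x)u − α(x)u^p on ℝ^d × (0,∞), and satisfies u(x,0) = 0 for all x ∈ ℝ^d. -/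

import Mathlib

open Set

/-- The `i`-th partial derivative of a function on `ℝ^d`. -/
noncomputable def pd {d : ℕ} (i : Fin d) (f : EuclideanSpace ℝ (Fin d) → ℝ)
    (x : EuclideanSpace ℝ (Fin d)) : ℝ :=
  fderiv ℝ f x (EuclideanSpace.single i 1)

/-- `f` is locally Hölder continuous. -/
def LocHolder {d : ℕ} (f : EuclideanSpace ℝ (Fin d) → ℝ) : Prop :=
  ∀ K : Set (EuclideanSpace ℝ (Fin d)), IsCompact K →
    ∃ κ C : ℝ, 0 < κ ∧ κ ≤ 1 ∧ 0 ≤ C ∧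
      ∀ x ∈ K, ∀ y ∈ K, |f x - f y| ≤ C * ‖x - y‖ ^ κ

set_option linter.unusedSectionVars false
set_option maxSynthPendingDepth 3

section Gauss
open MeasureTheory Filter Topology

variable {E : Type*} [NormedAddCommGroup E] [InnerProductSpace ℝ E] [FiniteDimensional ℝ E]
  [MeasurableSpace E] [BorelSpace E]
  {F : Type*} [NormedAddCommGroup F] [NormedSpace ℝ F]

/-- Gaussian decay. -/
def GaussDecay (Φ : E → F) : Prop :=
  ∃ C b : ℝ, 0 ≤ C ∧ 0 < b ∧ ∀ z, ‖Φ z‖ ≤ C * Real.exp (-b * ‖z‖ ^ 2)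

/-- At most linear growth. -/
def LinGrowth (h : E → ℝ) : Prop := ∃ C : ℝ, 0 ≤ C ∧ ∀ y, |h y| ≤ C * (1 + ‖y‖)

theorem integrable_exp_neg_mul_norm_sq {b : ℝ} (hb : 0 < b) :
    Integrable (fun z : E => Real.exp (-b * ‖z‖ ^ 2)) := by
  have h := GaussianFourier.integrable_cexp_neg_mul_sq_norm_add (V := E) (b := (b : ℂ))
    (by simpa using hb) 0 0
  have h2 := h.re
  refine h2.congr (Eventually.of_forall fun z => ?_)
  simp only [zero_mul, add_zero]
  have : (-(b:ℂ) * (‖z‖:ℂ)^2) = ((-b * ‖z‖^2 : ℝ) : ℂ) := by push_cast; ring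
  rw [this]
  exact Complex.exp_ofReal_re _

theorem one_add_sq_mul_exp_le {b : ℝ} (hb : 0 < b) (r : ℝ) :
    (1 + r) ^ 2 * Real.exp (-b * r ^ 2) ≤ (2 + 4 / b) * Real.exp (-(b / 2) * r ^ 2) := by
  have h1 : Real.exp (-b * r ^ 2) = Real.exp (-(b / 2) * r ^ 2) * Real.exp (-(b / 2) * r ^ 2) := by
    rw [← Real.exp_add]; ring_nf
  have h2 : (1 + r) ^ 2 * Real.exp (-(b / 2) * r ^ 2) ≤ 2 + 4 / b := by
    have h3 := Real.add_one_le_exp ((b / 2) * r ^ 2)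
    have h4 : Real.exp (-(b / 2) * r ^ 2) = (Real.exp ((b / 2) * r ^ 2))⁻¹ := by
      rw [← Real.exp_neg]; ring_nf
    rw [h4, mul_inv_le_iff₀ (Real.exp_pos _)]
    have h5 : (1 + r) ^ 2 ≤ (2 + 4 / b) * (b / 2 * r ^ 2 + 1) := by
      have : (2 + 4 / b) * (b / 2 * r ^ 2 + 1) = b * r ^ 2 + 2 + 2 * r ^ 2 + 4 / b := by
        field_simp; ring
      rw [this]
      have : 0 < 4 / b := by positivity
      nlinarith [sq_nonneg (1 - r), mul_nonneg hb.le (sq_nonneg r)]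
    exact h5.trans (by gcongr)
  rw [h1, ← mul_assoc]
  gcongr

theorem integrable_one_add_sq_mul_exp {b : ℝ} (hb : 0 < b) :
    Integrable (fun z : E => (1 + ‖z‖) ^ 2 * Real.exp (-b * ‖z‖ ^ 2)) := by
  refine ((integrable_exp_neg_mul_norm_sq (E := E) (half_pos hb)).const_mul (2 + 4 / b)).mono'
    (by fun_prop) (Eventually.of_forall fun z => ?_)
  rw [Real.norm_of_nonneg (by positivity)]
  exact one_add_sq_mul_exp_le hb _

theorem GaussDecay.integrable_mul {Φ : E → F} (hΦ : GaussDecay Φ) (hc : Continuous Φ) :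
    Integrable (fun z : E => (1 + ‖z‖) ^ 2 * ‖Φ z‖) := by
  obtain ⟨C, b, hC, hb, h⟩ := hΦ
  refine ((integrable_one_add_sq_mul_exp (E := E) hb).const_mul C).mono'
    (by fun_prop) (Eventually.of_forall fun z => ?_)
  rw [Real.norm_of_nonneg (by positivity)]
  calc _ ≤ (1 + ‖z‖) ^ 2 * (C * Real.exp (-b * ‖z‖ ^ 2)) := by gcongr; exact h z
    _ = _ := by ring

theorem GaussDecay.integrable_mul_one {Φ : E → F} (hΦ : GaussDecay Φ) (hc : Continuous Φ) :
    Integrable (fun z : E => (1 + ‖z‖) * ‖Φ z‖) := by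
  refine (hΦ.integrable_mul hc).mono' (by fun_prop) (Eventually.of_forall fun z => ?_)
  rw [Real.norm_of_nonneg (by positivity)]
  have : 0 ≤ ‖z‖ := norm_nonneg z
  gcongr
  nlinarith

theorem GaussDecay.integrable {Φ : E → F} (hΦ : GaussDecay Φ) (hc : Continuous Φ) :
    Integrable Φ := by
  refine (hΦ.integrable_mul hc).mono' (hc.aestronglyMeasurable) (Eventually.of_forall fun z => ?_)
  have : 0 ≤ ‖z‖ := norm_nonneg z
  exact le_mul_of_one_le_left (norm_nonneg _) (by nlinarith)

/-- Gaussian-type average of `h` at scale `σ` about `x` with kernel `Φ`. -/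
noncomputable def avg (Φ : E → F) (h : E → ℝ) (σ : ℝ) (x : E) : F := ∫ z, h (x + σ • z) • Φ z

theorem avg_bound {h : E → ℝ} {C : ℝ} (hC : 0 ≤ C) (hb : ∀ y, |h y| ≤ C * (1 + ‖y‖))
    (Φ : E → F) {σ s : ℝ} {x : E} {r : ℝ} (hx : ‖x‖ ≤ r) (hs : |σ| ≤ s) (z : E) :
    ‖h (x + σ • z) • Φ z‖ ≤ (C * (1 + r + s)) * ((1 + ‖z‖) * ‖Φ z‖) := by
  rw [norm_smul, Real.norm_eq_abs, ← mul_assoc]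
  gcongr
  refine (hb _).trans ?_
  rw [mul_assoc]
  gcongr
  have h1 : ‖x + σ • z‖ ≤ r + s * ‖z‖ := by
    refine (norm_add_le _ _).trans ?_
    rw [norm_smul, Real.norm_eq_abs]
    gcongr
  have : 0 ≤ ‖z‖ := norm_nonneg z
  have : 0 ≤ r := (norm_nonneg x).trans hx
  have : 0 ≤ s := (abs_nonneg _).trans hs
  nlinarith [mul_nonneg ‹0 ≤ r› ‹0 ≤ ‖z‖›]

theorem avg_integrable {h : E → ℝ} (hh : Continuous h) (hg : LinGrowth h)
    {Φ : E → F} (hΦ : GaussDecay Φ) (hc : Continuous Φ) (σ : ℝ) (x : E) :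
    Integrable (fun z => h (x + σ • z) • Φ z) := by
  obtain ⟨C, hC, hb⟩ := hg
  refine ((hΦ.integrable_mul_one hc).const_mul (C * (1 + ‖x‖ + |σ|))).mono'
    (Continuous.aestronglyMeasurable (by fun_prop)) (Eventually.of_forall fun z => ?_)
  exact avg_bound hC hb Φ le_rfl le_rfl z

theorem avg_norm_le {h : E → ℝ} {C : ℝ} (hC : 0 ≤ C) (hb : ∀ y, |h y| ≤ C * (1 + ‖y‖))
    {Φ : E → F} (hΦ : GaussDecay Φ) (hc : Continuous Φ) (σ : ℝ) (x : E) :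
    ‖avg Φ h σ x‖ ≤ (C * (1 + ‖x‖ + |σ|)) * ∫ z, (1 + ‖z‖) * ‖Φ z‖ := by
  rw [← integral_const_mul]
  exact norm_integral_le_of_norm_le ((hΦ.integrable_mul_one hc).const_mul _)
    (Eventually.of_forall fun z => avg_bound hC hb Φ le_rfl le_rfl z)

theorem avg_norm_le_of_bounded {h : E → ℝ} {M : ℝ} (hb : ∀ y, |h y| ≤ M)
    {Φ : E → F} (hΦ : GaussDecay Φ) (hc : Continuous Φ) (σ : ℝ) (x : E) :
    ‖avg Φ h σ x‖ ≤ M * ∫ z, ‖Φ z‖ := by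
  rw [← integral_const_mul]
  refine norm_integral_le_of_norm_le ((hΦ.integrable hc).norm.const_mul _)
    (Eventually.of_forall fun z => ?_)
  rw [norm_smul]
  gcongr
  exact hb _

theorem avg_continuous {h : E → ℝ} (hh : Continuous h) (hg : LinGrowth h)
    {Φ : E → F} (hΦ : GaussDecay Φ) (hc : Continuous Φ) :
    Continuous (fun q : ℝ × E => avg Φ h q.1 q.2) := by
  rw [continuous_iff_continuousAt]
  rintro ⟨σ, x⟩
  obtain ⟨C, hC, hb⟩ := hg
  refine continuousAt_of_dominated (bound := fun z => (C * (1 + (‖x‖ + 1) + (|σ| + 1))) *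
    ((1 + ‖z‖) * ‖Φ z‖)) ?_ ?_ ((hΦ.integrable_mul_one hc).const_mul _) ?_
  · exact Eventually.of_forall fun q => Continuous.aestronglyMeasurable (by fun_prop)
  · have h1 : ∀ᶠ q : ℝ × E in 𝓝 (σ, x), ‖q.2‖ < ‖x‖ + 1 :=
      (continuous_snd.norm.continuousAt (x := (σ, x))).eventually_lt continuousAt_const (by simp)
    have h2 : ∀ᶠ q : ℝ × E in 𝓝 (σ, x), |q.1| < |σ| + 1 :=
      (continuous_fst.abs.continuousAt (x := (σ, x))).eventually_lt continuousAt_const (by simp)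
    filter_upwards [h1, h2] with q hq1 hq2
    exact Eventually.of_forall fun z => avg_bound hC hb Φ hq1.le hq2.le z
  · exact Eventually.of_forall fun z => Continuous.continuousAt (by fun_prop)

end Gauss

section Gauss2
open MeasureTheory Filter Topology Module

variable {E : Type*} [NormedAddCommGroup E] [InnerProductSpace ℝ E] [FiniteDimensional ℝ E]
  [MeasurableSpace E] [BorelSpace E]
  {F : Type*} [NormedAddCommGroup F] [NormedSpace ℝ F]

theorem avg_eq_conv (Φ : E → F) (h : E → ℝ) {σ : ℝ} (hσ : 0 < σ) (x : E) :
    avg Φ h σ x = (σ ^ finrank ℝ E)⁻¹ • ∫ y, h y • Φ (σ⁻¹ • (y - x)) := by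
  have h1 := Measure.integral_comp_smul (volume : Measure E)
    (fun y => h (x + y) • Φ (σ⁻¹ • y)) σ
  have h2 : ∫ y, h (x + y) • Φ (σ⁻¹ • y) = ∫ y, h y • Φ (σ⁻¹ • (y - x)) := by
    have := integral_add_left_eq_self (μ := (volume : Measure E))
      (fun y => h y • Φ (σ⁻¹ • (y - x))) x
    simpa using this
  rw [← h2, ← abs_of_nonneg (show 0 ≤ (σ ^ finrank ℝ E)⁻¹ by positivity), ← h1]
  simp [avg, smul_smul, inv_mul_cancel₀ hσ.ne']

theorem conv_dominated {h : E → ℝ} {C : ℝ} (hC : 0 ≤ C) (hb : ∀ y, |h y| ≤ C * (1 + ‖y‖))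
    {G : Type*} [NormedAddCommGroup G] {Φ : E → G} {K b : ℝ} (hK : 0 ≤ K) (hb0 : 0 < b)
    (hΦ : ∀ z, ‖Φ z‖ ≤ K * Real.exp (-b * ‖z‖ ^ 2))
    {σ : ℝ} {x x₀ : E} (hx : ‖x - x₀‖ ≤ 1) (y : E) :
    |h y| * ‖Φ (σ⁻¹ • (y - x))‖ ≤ (C * (1 + ‖x₀‖) * K * Real.exp (b * σ⁻¹ ^ 2)) *
      ((1 + ‖y - x₀‖) ^ 2 * Real.exp (-(b * σ⁻¹ ^ 2 / 2) * ‖y - x₀‖ ^ 2)) := by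
  have h1 : |h y| ≤ C * (1 + ‖x₀‖) * (1 + ‖y - x₀‖) ^ 2 := by
    refine (hb y).trans ?_
    have : ‖y‖ ≤ ‖x₀‖ + ‖y - x₀‖ := by
      simpa using norm_add_le x₀ (y - x₀)
    rw [mul_assoc]
    gcongr
    nlinarith [norm_nonneg x₀, norm_nonneg (y - x₀), mul_nonneg (norm_nonneg x₀) (norm_nonneg (y - x₀)), mul_nonneg (norm_nonneg x₀) (sq_nonneg ‖y - x₀‖)]
  have h2 : ‖Φ (σ⁻¹ • (y - x))‖ ≤ K * (Real.exp (b * σ⁻¹ ^ 2) *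
      Real.exp (-(b * σ⁻¹ ^ 2 / 2) * ‖y - x₀‖ ^ 2)) := by
    refine (hΦ _).trans ?_
    rw [← Real.exp_add, norm_smul, mul_pow, Real.norm_eq_abs, sq_abs]
    gcongr
    have h3 : ‖y - x₀‖ ^ 2 ≤ 2 * ‖y - x‖ ^ 2 + 2 := by
      have : ‖y - x₀‖ ≤ ‖y - x‖ + ‖x - x₀‖ := norm_sub_le_norm_sub_add_norm_sub _ _ _
      have h4 : ‖y - x₀‖ ≤ ‖y - x‖ + 1 := by linarith
      nlinarith [norm_nonneg (y - x₀), sq_nonneg (‖y - x‖ - 1)]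
    have : 0 ≤ b * σ⁻¹ ^ 2 := by positivity
    nlinarith
  calc _ ≤ (C * (1 + ‖x₀‖) * (1 + ‖y - x₀‖) ^ 2) * (K * (Real.exp (b * σ⁻¹ ^ 2) *
      Real.exp (-(b * σ⁻¹ ^ 2 / 2) * ‖y - x₀‖ ^ 2))) := by gcongr
    _ = _ := by ring

theorem conv_dominated_integrable (c : ℝ) {b : ℝ} (hb : 0 < b) (x₀ : E) :
    Integrable (fun y : E => c * ((1 + ‖y - x₀‖) ^ 2 * Real.exp (-b * ‖y - x₀‖ ^ 2))) :=
  ((integrable_one_add_sq_mul_exp (E := E) hb).comp_sub_right x₀).const_mul c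

theorem avg_hasFDerivAt {h : E → ℝ} (hh : Continuous h) (hg : LinGrowth h)
    {Φ : E → F} {Φ' : E → E →L[ℝ] F} (hΦ : GaussDecay Φ) (hΦ' : GaussDecay Φ')
    (hd : ∀ z, HasFDerivAt Φ (Φ' z) z) (hc' : Continuous Φ') {σ : ℝ} (hσ : 0 < σ) (x : E) :
    HasFDerivAt (avg Φ h σ) (-σ⁻¹ • avg Φ' h σ x) x := by
  have hc : Continuous Φ := continuous_iff_continuousAt.2 fun z => (hd z).continuousAt
  obtain ⟨C, hC, hb⟩ := hg
  obtain ⟨K, b, hK, hb0, hK1⟩ := hΦ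
  obtain ⟨K', b', hK', hb0', hK1'⟩ := hΦ'
  have e1 : avg Φ h σ = fun x => (σ ^ finrank ℝ E)⁻¹ • ∫ y, h y • Φ (σ⁻¹ • (y - x)) :=
    funext fun x => avg_eq_conv Φ h hσ x
  have e2 : (-σ⁻¹ • avg Φ' h σ x) = (σ ^ finrank ℝ E)⁻¹ •
      ∫ y, h y • (-σ⁻¹ • Φ' (σ⁻¹ • (y - x))) := by
    rw [avg_eq_conv Φ' h hσ, smul_comm, ← integral_smul]
    simp_rw [smul_comm (-σ⁻¹)]
  rw [e1, e2]
  refine HasFDerivAt.const_smul ?_ _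
  have hpos : 0 < b * σ⁻¹ ^ 2 / 2 := by positivity
  have hpos' : 0 < b' * σ⁻¹ ^ 2 / 2 := by positivity
  have hcc : ∀ x : E, Continuous fun y => h y • Φ (σ⁻¹ • (y - x)) := fun x => by fun_prop
  refine hasFDerivAt_integral_of_dominated_of_fderiv_le
    (F' := fun x y => h y • (-σ⁻¹ • Φ' (σ⁻¹ • (y - x))))
    (Metric.ball_mem_nhds x one_pos) (Eventually.of_forall fun x => (hcc x).aestronglyMeasurable)
    ?_ (Continuous.aestronglyMeasurable (by fun_prop))
    (bound := fun y => σ⁻¹ * ((C * (1 + ‖x‖) * K' * Real.exp (b' * σ⁻¹ ^ 2)) *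
      ((1 + ‖y - x‖) ^ 2 * Real.exp (-(b' * σ⁻¹ ^ 2 / 2) * ‖y - x‖ ^ 2)))) ?_ ?_ ?_
  · refine (conv_dominated_integrable (C * (1 + ‖x‖) * K * Real.exp (b * σ⁻¹ ^ 2)) hpos x).mono'
      (hcc x).aestronglyMeasurable (Eventually.of_forall fun y => ?_)
    rw [norm_smul]
    exact conv_dominated hC hb hK hb0 hK1 (by simp) y
  · refine Eventually.of_forall fun y x' hx' => ?_
    rw [norm_smul, norm_smul, norm_neg, Real.norm_of_nonneg (inv_nonneg.2 hσ.le), mul_left_comm]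
    exact mul_le_mul_of_nonneg_left (conv_dominated hC hb hK' hb0' hK1'
      (by rw [← dist_eq_norm]; exact (Metric.mem_ball.1 hx').le) y) (inv_nonneg.2 hσ.le)
  · exact (conv_dominated_integrable _ hpos' x).const_mul _
  · refine Eventually.of_forall fun y x' _ => HasFDerivAt.const_smul ?_ _
    have h1 : HasFDerivAt (fun x : E => σ⁻¹ • (y - x)) (σ⁻¹ • (-ContinuousLinearMap.id ℝ E)) x' :=
      ((hasFDerivAt_id x').const_sub y).const_smul _
    have h2 := (hd (σ⁻¹ • (y - x'))).comp x' h1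
    exact h2.congr_fderiv (ContinuousLinearMap.ext fun v => by simp)

theorem avg_hasDerivAt {h : E → ℝ} (hh : Continuous h) (hg : LinGrowth h)
    {Φ : E → F} {Φ' : E → E →L[ℝ] F} (hΦ : GaussDecay Φ) (hΦ' : GaussDecay Φ')
    (hd : ∀ z, HasFDerivAt Φ (Φ' z) z) (hc' : Continuous Φ') {σ : ℝ} (hσ : 0 < σ) (x : E) :
    HasDerivAt (fun s => avg Φ h s x)
      (-σ⁻¹ • ((finrank ℝ E : ℝ) • avg Φ h σ x + avg (fun z => Φ' z z) h σ x)) σ := by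
  have hc : Continuous Φ := continuous_iff_continuousAt.2 fun z => (hd z).continuousAt
  obtain ⟨C, hC, hb⟩ := hg
  obtain ⟨K, b, hK, hb0, hK1⟩ := hΦ
  obtain ⟨K', b', hK', hb0', hK1'⟩ := hΦ'
  set n := finrank ℝ E with hn
  set J : ℝ → F := fun s => ∫ y, h y • Φ (s⁻¹ • (y - x)) with hJ
  have key : HasDerivAt J (∫ y, h y • (-σ⁻¹ • Φ' (σ⁻¹ • (y - x)) (σ⁻¹ • (y - x)))) σ := by
    have hpos : 0 < b * σ⁻¹ ^ 2 / 2 := by positivity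
    have hpos' : 0 < b' * ((2 * σ)⁻¹) ^ 2 := by positivity
    have hcc : ∀ s : ℝ, Continuous fun y => h y • Φ (s⁻¹ • (y - x)) := fun s => by fun_prop
    refine (hasDerivAt_integral_of_dominated_loc_of_deriv_le
      (F' := fun s y => h y • (-s⁻¹ • Φ' (s⁻¹ • (y - x)) (s⁻¹ • (y - x))))
      (Ioo_mem_nhds (show σ / 2 < σ by linarith) (show σ < 2 * σ by linarith))
      (Eventually.of_forall fun s => (hcc s).aestronglyMeasurable)
      ?_ (Continuous.aestronglyMeasurable (by fun_prop))
      (bound := fun y => ((C * (1 + ‖x‖)) * (2 * σ⁻¹) ^ 2 * K') *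
        ((1 + ‖y - x‖) ^ 2 * Real.exp (-(b' * ((2 * σ)⁻¹) ^ 2) * ‖y - x‖ ^ 2))) ?_ ?_ ?_).2
    · refine (conv_dominated_integrable (C * (1 + ‖x‖) * K * Real.exp (b * σ⁻¹ ^ 2)) hpos x).mono'
        (hcc σ).aestronglyMeasurable (Eventually.of_forall fun y => ?_)
      rw [norm_smul]
      exact conv_dominated hC hb hK hb0 hK1 (by simp) y
    · refine Eventually.of_forall fun y s hs => ?_
      have hs0 : 0 < s := by have := hs.1; linarith
      have h1 : |h y| ≤ C * (1 + ‖x‖) * (1 + ‖y - x‖) := by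
        refine (hb y).trans ?_
        have : ‖y‖ ≤ ‖x‖ + ‖y - x‖ := by
          simpa using norm_add_le x (y - x)
        rw [mul_assoc]
        gcongr
        nlinarith [norm_nonneg x, norm_nonneg (y - x), mul_nonneg (norm_nonneg x) (norm_nonneg (y - x))]
      have hs1 : s⁻¹ ≤ 2 * σ⁻¹ := by
        rw [inv_le_comm₀ hs0 (by positivity)]
        rw [mul_inv, inv_inv]
        have := hs.1; linarith
      have hs2 : (2 * σ)⁻¹ ≤ s⁻¹ := by
        gcongr; exact hs.2.le
      have h2 : ‖Φ' (s⁻¹ • (y - x))‖ ≤ K' * Real.exp (-(b' * ((2 * σ)⁻¹) ^ 2) * ‖y - x‖ ^ 2) := by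
        refine (hK1' _).trans ?_
        rw [norm_smul, mul_pow, Real.norm_eq_abs, sq_abs]
        refine mul_le_mul_of_nonneg_left (Real.exp_le_exp.2 ?_) hK'
        have : ((2 * σ)⁻¹) ^ 2 ≤ s⁻¹ ^ 2 := by gcongr
        have h3 : b' * (((2 * σ)⁻¹) ^ 2 * ‖y - x‖ ^ 2) ≤ b' * (s⁻¹ ^ 2 * ‖y - x‖ ^ 2) := by gcongr
        linarith
      rw [norm_smul, norm_smul, norm_neg, Real.norm_of_nonneg (inv_nonneg.2 hs0.le)]
      calc |h y| * (s⁻¹ * ‖Φ' (s⁻¹ • (y - x)) (s⁻¹ • (y - x))‖)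
          ≤ (C * (1 + ‖x‖) * (1 + ‖y - x‖)) * (s⁻¹ * (‖Φ' (s⁻¹ • (y - x))‖ * (s⁻¹ * ‖y - x‖))) := by
            gcongr
            refine (ContinuousLinearMap.le_opNorm _ _).trans (le_of_eq ?_)
            rw [norm_smul, Real.norm_of_nonneg (inv_nonneg.2 hs0.le)]
        _ ≤ (C * (1 + ‖x‖) * (1 + ‖y - x‖)) * ((2 * σ⁻¹) * ((K' * Real.exp (-(b' * ((2 * σ)⁻¹) ^ 2) * ‖y - x‖ ^ 2)) * ((2 * σ⁻¹) * (1 + ‖y - x‖)))) := by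
            gcongr
            linarith
        _ = _ := by ring
    · exact conv_dominated_integrable _ hpos' x
    · refine Eventually.of_forall fun y s hs => HasDerivAt.const_smul _ ?_
      have hs0 : 0 < s := by have := hs.1; linarith
      have h1 : HasDerivAt (fun s : ℝ => s⁻¹ • (y - x)) ((-(s ^ 2)⁻¹) • (y - x)) s :=
        (hasDerivAt_inv hs0.ne').smul_const _
      have h2 := (hd (s⁻¹ • (y - x))).comp_hasDerivAt s h1
      refine h2.congr_deriv ?_
      rw [map_smul, map_smul, smul_smul]
      congr 1
      field_simp
  have hpow : HasDerivAt (fun s : ℝ => (s ^ n)⁻¹) (-(n : ℝ) * σ⁻¹ * (σ ^ n)⁻¹) σ := by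
    have := (hasDerivAt_pow n σ).inv (pow_ne_zero n hσ.ne')
    refine this.congr_deriv ?_
    clear_value n
    rcases n with _ | k
    · simp
    · rw [Nat.add_sub_cancel]
      field_simp
      ring
  have h3 := hpow.smul key
  have h4 : (fun s => avg Φ h s x) =ᶠ[𝓝 σ] ((fun s : ℝ => (s ^ n)⁻¹) • J) := by
    filter_upwards [lt_mem_nhds hσ] with s hs
    exact avg_eq_conv Φ h hs x
  refine (h3.congr_of_eventuallyEq h4).congr_deriv ?_
  rw [avg_eq_conv Φ h hσ, avg_eq_conv (fun z => Φ' z z) h hσ]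
  simp_rw [smul_comm (h _) (-σ⁻¹), integral_smul, smul_add, smul_smul]
  rw [add_comm]
  congr 2
  · ring
  · ring

end Gauss2

section Kernels
open MeasureTheory Filter Topology Module

variable {E : Type*} [NormedAddCommGroup E] [InnerProductSpace ℝ E] [FiniteDimensional ℝ E]
  [MeasurableSpace E] [BorelSpace E]

/-- The inner product as a bilinear map. -/
noncomputable def innerB (E : Type*) [NormedAddCommGroup E] [InnerProductSpace ℝ E] :
    E →L[ℝ] E →L[ℝ] ℝ := innerSL ℝ

theorem innerB_apply (x y : E) : innerB E x y = inner ℝ x y := rfl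

theorem norm_innerB_apply (x : E) : ‖innerB E x‖ = ‖x‖ := innerSL_apply_norm ℝ x

theorem norm_innerB_le : ‖innerB E‖ ≤ 1 :=
  ContinuousLinearMap.opNorm_le_bound _ zero_le_one fun x => by rw [norm_innerB_apply, one_mul]

/-- The unnormalised standard Gaussian. -/
noncomputable def gk (z : E) : ℝ := Real.exp (-(1 / 2) * ‖z‖ ^ 2)

/-- Minus the derivative of `gk`. -/
noncomputable def gk1 (z : E) : E →L[ℝ] ℝ := gk z • innerB E z

/-- The derivative of `gk1`. -/
noncomputable def gk2 (z : E) : E →L[ℝ] E →L[ℝ] ℝ :=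
  gk z • (innerB E - (innerB E z).smulRight (innerB E z))

theorem gk_pos (z : E) : 0 < gk z := Real.exp_pos _

theorem gk_continuous : Continuous (gk : E → ℝ) := by unfold gk; fun_prop

theorem gk1_continuous : Continuous (gk1 : E → E →L[ℝ] ℝ) := by
  unfold gk1
  exact gk_continuous.smul (innerB E).continuous

theorem gk2_eq (z : E) : gk2 z = gk z • (innerB E -
    ContinuousLinearMap.smulRightL ℝ E (E →L[ℝ] ℝ) (innerB E z) (innerB E z)) := rfl

theorem gk2_continuous : Continuous (gk2 : E → E →L[ℝ] E →L[ℝ] ℝ) := by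
  have : (gk2 : E → E →L[ℝ] E →L[ℝ] ℝ) = _ := funext gk2_eq
  rw [this]
  refine gk_continuous.smul (continuous_const.sub ?_)
  have h1 : Continuous fun z : E => ContinuousLinearMap.smulRightL ℝ E (E →L[ℝ] ℝ) (innerB E z) :=
    (ContinuousLinearMap.continuous _).comp (innerB E).continuous
  exact h1.clm_apply (innerB E).continuous

theorem gk_hasFDerivAt (z : E) : HasFDerivAt gk (-gk1 z) z := by
  have h1 : HasFDerivAt (fun z : E => -(1 / 2) * ‖z‖ ^ 2) (-(innerB E z)) z := by
    have := ((hasFDerivAt_id z).norm_sq).const_mul (-(1 / 2) : ℝ)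
    refine this.congr_fderiv (ContinuousLinearMap.ext fun v => ?_)
    simp [innerB_apply]
  refine h1.exp.congr_fderiv ?_
  simp [gk1, gk]

theorem gk1_hasFDerivAt (z : E) : HasFDerivAt gk1 (gk2 z) z := by
  have := (gk_hasFDerivAt z).smul (innerB E).hasFDerivAt
  refine this.congr_fderiv (ContinuousLinearMap.ext fun v => ContinuousLinearMap.ext fun u => ?_)
  simp [gk1, gk2]
  ring

theorem gaussDecay_of_le {F : Type*} [NormedAddCommGroup F] {Φ : E → F}
    (h : ∀ z, ‖Φ z‖ ≤ (1 + ‖z‖) ^ 2 * gk z) : GaussDecay Φ :=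
  ⟨_, (1 / 2) / 2, by norm_num, by norm_num, fun z => (h z).trans
    (one_add_sq_mul_exp_le (b := 1 / 2) (by norm_num) ‖z‖)⟩

theorem gk_decay : GaussDecay (gk : E → ℝ) := gaussDecay_of_le fun z => by
  rw [Real.norm_of_nonneg (gk_pos z).le]
  have := norm_nonneg z
  exact le_mul_of_one_le_left (gk_pos z).le (by nlinarith)

theorem gk1_decay : GaussDecay (gk1 : E → E →L[ℝ] ℝ) := gaussDecay_of_le fun z => by
  rw [gk1, norm_smul, Real.norm_of_nonneg (gk_pos z).le, norm_innerB_apply, mul_comm]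
  have := norm_nonneg z
  exact mul_le_mul_of_nonneg_right (by nlinarith) (gk_pos z).le

theorem gk2_decay : GaussDecay (gk2 : E → E →L[ℝ] E →L[ℝ] ℝ) := gaussDecay_of_le fun z => by
  rw [gk2, norm_smul, Real.norm_of_nonneg (gk_pos z).le, mul_comm]
  have := norm_nonneg z
  refine mul_le_mul_of_nonneg_right ?_ (gk_pos z).le
  refine (norm_sub_le _ _).trans ?_
  rw [ContinuousLinearMap.norm_smulRight_apply, norm_innerB_apply]
  have := norm_innerB_le (E := E)
  nlinarith

theorem neg_gk1_decay : GaussDecay (fun z : E => -gk1 z) := by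
  obtain ⟨C, b, h1, h2, h3⟩ := gk1_decay (E := E)
  exact ⟨C, b, h1, h2, fun z => by rw [norm_neg]; exact h3 z⟩

theorem avg_neg {F : Type*} [NormedAddCommGroup F] [NormedSpace ℝ F] (Φ : E → F) (h : E → ℝ)
    (σ : ℝ) (x : E) : avg (fun z => -Φ z) h σ x = -avg Φ h σ x := by
  simp [avg, integral_neg]

theorem avg_gk_hasFDerivAt {h : E → ℝ} (hh : Continuous h) (hg : LinGrowth h)
    {σ : ℝ} (hσ : 0 < σ) (x : E) :
    HasFDerivAt (avg gk h σ) (σ⁻¹ • avg gk1 h σ x) x := by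
  refine (avg_hasFDerivAt hh hg gk_decay neg_gk1_decay gk_hasFDerivAt gk1_continuous.neg
    hσ x).congr_fderiv ?_
  rw [avg_neg]; simp

theorem avg_gk1_hasFDerivAt {h : E → ℝ} (hh : Continuous h) (hg : LinGrowth h)
    {σ : ℝ} (hσ : 0 < σ) (x : E) :
    HasFDerivAt (avg gk1 h σ) (-σ⁻¹ • avg gk2 h σ x) x :=
  avg_hasFDerivAt hh hg gk1_decay gk2_decay gk1_hasFDerivAt gk2_continuous hσ x

theorem linGrowth_const (c : ℝ) : LinGrowth (fun _ : E => c) :=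
  ⟨|c|, abs_nonneg c, fun y => le_mul_of_one_le_right (abs_nonneg c) (by linarith [norm_nonneg y])⟩

theorem integral_gk2 : ∫ z : E, gk2 z = 0 := by
  have h1 : ∀ x : E, avg gk1 (fun _ => (1 : ℝ)) 1 x = ∫ z : E, gk1 z := fun x => by simp [avg]
  have h2 := avg_gk1_hasFDerivAt (E := E) continuous_const (linGrowth_const 1) one_pos 0
  have h3 : HasFDerivAt (avg gk1 (fun _ : E => (1 : ℝ)) 1) (0 : E →L[ℝ] E →L[ℝ] ℝ) 0 := by
    rw [show avg gk1 (fun _ : E => (1 : ℝ)) 1 = fun _ => ∫ z : E, gk1 z from funext h1]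
    exact hasFDerivAt_const _ _
  have h4 := h2.unique h3
  have h5 : -(∫ z : E, gk2 z) = 0 := by simpa [avg] using h4
  exact neg_eq_zero.1 h5

/-- A quantitative continuity condition at `x`, uniform over all increments. -/
def Incr (h : E → ℝ) (x : E) (κ C : ℝ) : Prop :=
  ∀ y, |h y - h x| ≤ C * (‖y - x‖ ^ κ + ‖y - x‖)

theorem avg_gk2_norm_le {h : E → ℝ} (hh : Continuous h) (hg : LinGrowth h) {x : E} {κ C : ℝ}
    (hκ : 0 < κ) (hκ1 : κ ≤ 1) (hC : 0 ≤ C) (hi : Incr h x κ C) {σ : ℝ} (hσ : 0 < σ) :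
    ‖avg gk2 h σ x‖ ≤ (C * (σ ^ κ + σ)) * ∫ z : E, (1 + ‖z‖) * ‖gk2 z‖ := by
  have h1 : avg gk2 h σ x = ∫ z, (h (x + σ • z) - h x) • gk2 z := by
    simp_rw [sub_smul]
    rw [integral_sub (avg_integrable hh hg gk2_decay gk2_continuous σ x)
      ((gk2_decay.integrable gk2_continuous).fun_smul _), integral_smul, integral_gk2, smul_zero,
      sub_zero, avg]
  rw [h1, ← integral_const_mul]
  refine norm_integral_le_of_norm_le ((gk2_decay.integrable_mul_one gk2_continuous).const_mul _)
    (Eventually.of_forall fun z => ?_)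
  rw [norm_smul, ← mul_assoc]
  refine mul_le_mul_of_nonneg_right ?_ (norm_nonneg _)
  refine (hi _).trans ?_
  rw [add_sub_cancel_left, norm_smul, Real.norm_of_nonneg hσ.le,
    Real.mul_rpow hσ.le (norm_nonneg z), mul_assoc]
  have h2 : ‖z‖ ^ κ ≤ 1 + ‖z‖ := by
    rcases le_total ‖z‖ 1 with h | h
    · exact (Real.rpow_le_one (norm_nonneg z) h hκ.le).trans (by linarith [norm_nonneg z])
    · exact (Real.rpow_le_rpow_of_exponent_le h hκ1).trans (by simp)
  have h3 : 0 ≤ σ ^ κ := Real.rpow_nonneg hσ.le _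
  rw [add_mul]
  gcongr
  linarith

theorem sum_gk2 (z : E) {ι : Type*} [Fintype ι] (b : OrthonormalBasis ι ℝ E) :
    ∑ i, gk2 z (b i) (b i) = (finrank ℝ E : ℝ) * gk z + (-gk1 z) z := by
  have h1 : ∀ i, gk2 z (b i) (b i) = gk z * (1 - inner ℝ z (b i) ^ 2) := fun i => by
    simp [gk2, innerB_apply, sq]
  simp_rw [h1]
  rw [← Finset.mul_sum, Finset.sum_sub_distrib]
  have h2 : ∑ i, inner ℝ z (b i) ^ 2 = ‖z‖ ^ 2 := by
    rw [← b.sum_sq_norm_inner_left z]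
    simp
  rw [h2]
  simp [gk1, innerB_apply, finrank_eq_card_basis b.toBasis]
  ring

theorem avg_gk_hasDerivAt {h : E → ℝ} (hh : Continuous h) (hg : LinGrowth h)
    {σ : ℝ} (hσ : 0 < σ) (x : E) {ι : Type*} [Fintype ι] (b : OrthonormalBasis ι ℝ E) :
    HasDerivAt (fun s => avg gk h s x) (-σ⁻¹ * ∑ i, avg gk2 h σ x (b i) (b i)) σ := by
  refine (avg_hasDerivAt hh hg gk_decay neg_gk1_decay gk_hasFDerivAt gk1_continuous.neg
    hσ x).congr_deriv ?_
  rw [smul_eq_mul]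
  congr 1
  have hi2 := avg_integrable hh hg gk2_decay gk2_continuous σ x
  have h1 : ∀ i, avg gk2 h σ x (b i) (b i) = ∫ z, h (x + σ • z) * (gk2 z (b i) (b i)) := fun i => by
    rw [avg, ContinuousLinearMap.integral_apply hi2,
      ContinuousLinearMap.integral_apply (hi2.apply_continuousLinearMap _)]
    rfl
  have h2 : ∀ i, Integrable fun z => h (x + σ • z) * (gk2 z (b i) (b i)) := fun i =>
    (hi2.apply_continuousLinearMap (b i)).apply_continuousLinearMap (b i)
  simp_rw [h1]
  rw [← integral_finsetSum _ fun i _ => h2 i]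
  have hi0 := avg_integrable hh hg gk_decay gk_continuous σ x
  have hi1 : Integrable fun z => h (x + σ • z) • ((-gk1 z) z) := by
    refine ((integrable_finsetSum Finset.univ fun i _ => h2 i).sub (hi0.const_mul (finrank ℝ E : ℝ))).congr
      (Eventually.of_forall fun z => ?_)
    simp only [Pi.sub_apply, smul_eq_mul]
    rw [← Finset.mul_sum, sum_gk2]
    ring
  rw [avg, avg, smul_eq_mul, ← integral_const_mul, ← integral_add (hi0.const_mul _) hi1]
  congr 1
  ext z
  rw [← Finset.mul_sum, sum_gk2]
  simp only [smul_eq_mul]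
  ring

end Kernels

section Resolvent
open MeasureTheory Filter Topology Module

variable {E : Type*} [NormedAddCommGroup E] [InnerProductSpace ℝ E] [FiniteDimensional ℝ E]
  [MeasurableSpace E] [BorelSpace E]

/-- A Gaussian weight on scales. -/
noncomputable def eta (l σ : ℝ) : ℝ := l * Real.exp (-(l / 2) * σ ^ 2)

theorem eta_pos {l : ℝ} (hl : 0 < l) (σ : ℝ) : 0 < eta l σ := by unfold eta; positivity

theorem eta_continuous (l : ℝ) : Continuous (eta l) := by unfold eta; fun_prop

theorem rpow_mul_eta_integrableOn {l : ℝ} (hl : 0 < l) {s : ℝ} (hs : -1 < s) :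
    IntegrableOn (fun σ => σ ^ s * eta l σ) (Ioi 0) := by
  have := (integrableOn_rpow_mul_exp_neg_mul_sq (half_pos hl) hs).const_mul l
  refine this.congr (Eventually.of_forall fun σ => ?_)
  simp only [eta]; ring

theorem eta_integrableOn {l : ℝ} (hl : 0 < l) : IntegrableOn (eta l) (Ioi 0) := by
  simpa using rpow_mul_eta_integrableOn hl (s := 0) (by norm_num)

theorem mul_eta_integrableOn {l : ℝ} (hl : 0 < l) :
    IntegrableOn (fun σ => σ * eta l σ) (Ioi 0) := by
  simpa using rpow_mul_eta_integrableOn hl (s := 1) (by norm_num)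

theorem sq_mul_eta_integrableOn {l : ℝ} (hl : 0 < l) :
    IntegrableOn (fun σ => σ ^ 2 * eta l σ) (Ioi 0) := by
  have := rpow_mul_eta_integrableOn hl (s := 2) (by norm_num)
  simpa using this

theorem eta_hasDerivAt (l σ : ℝ) : HasDerivAt (eta l) (-(l * (σ * eta l σ))) σ := by
  unfold eta
  have h1 : HasDerivAt (fun σ : ℝ => -(l / 2) * σ ^ 2) (-(l * σ)) σ := by
    refine ((hasDerivAt_pow 2 σ).const_mul (-(l / 2))).congr_deriv ?_
    simp; ring
  refine (h1.exp.const_mul l).congr_deriv ?_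
  ring

theorem sq_mul_eta_le (l σ : ℝ) : σ ^ 2 * eta l σ ≤ 2 := by
  unfold eta
  have h1 : (l / 2) * σ ^ 2 * Real.exp (-(l / 2) * σ ^ 2) ≤ 1 := by
    rw [neg_mul, Real.exp_neg, mul_inv_le_iff₀ (Real.exp_pos _), one_mul]
    linarith [Real.add_one_le_exp ((l / 2) * σ ^ 2)]
  linarith

theorem tendsto_eta_mul {l : ℝ} (hl : 0 < l) (c : ℝ) :
    Tendsto (fun σ => eta l σ * (c * (1 + σ))) atTop (𝓝 0) := by
  have h1 : Tendsto (fun σ : ℝ => |c| * 2 * (1 + σ) / σ ^ 2) atTop (𝓝 0) := by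
    have h2 : Tendsto (fun σ : ℝ => |c| * 2 * ((σ⁻¹) ^ 2 + σ⁻¹)) atTop (𝓝 (|c| * 2 * (0 ^ 2 + 0))) :=
      ((tendsto_inv_atTop_zero.pow 2).add tendsto_inv_atTop_zero).const_mul _
    simp only [ne_eq, OfNat.ofNat_ne_zero, not_false_eq_true, zero_pow, add_zero, mul_zero] at h2
    refine h2.congr' ?_
    filter_upwards [eventually_gt_atTop 0] with σ hσ
    field_simp
  refine squeeze_zero_norm' ?_ h1
  filter_upwards [eventually_gt_atTop 0] with σ hσ
  rw [norm_mul, norm_mul, Real.norm_of_nonneg (eta_pos hl σ).le, Real.norm_eq_abs,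
    Real.norm_of_nonneg (by linarith : (0:ℝ) ≤ 1 + σ), le_div_iff₀ (by positivity)]
  have := sq_mul_eta_le l σ
  calc _ = |c| * (1 + σ) * (σ ^ 2 * eta l σ) := by ring
    _ ≤ |c| * (1 + σ) * 2 := by gcongr
    _ = _ := by ring

theorem integral_mul_eta {l : ℝ} (hl : 0 < l) : ∫ σ in Ioi 0, σ * eta l σ = 1 := by
  have h1 : ∫ σ in Ioi 0, -(l * (σ * eta l σ)) = 0 - eta l 0 :=
    integral_Ioi_of_hasDerivAt_of_tendsto (eta_continuous l).continuousWithinAt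
      (fun σ _ => eta_hasDerivAt l σ) (((mul_eta_integrableOn hl).const_mul l).neg) (by
        have h2 := tendsto_eta_mul hl 1
        refine squeeze_zero' (Eventually.of_forall fun σ => (eta_pos hl σ).le) ?_ h2
        filter_upwards [eventually_gt_atTop 0] with σ hσ
        exact le_mul_of_one_le_right (eta_pos hl σ).le (by linarith))
  rw [integral_neg, integral_const_mul] at h1
  have h3 : eta l 0 = l := by simp [eta]
  rw [h3] at h1
  have h4 : l * (∫ σ in Ioi 0, σ * eta l σ) = l * 1 := by linarith
  exact mul_left_cancel₀ (ne_of_gt hl) h4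

/-- The Gaussian normalisation. -/
noncomputable def gc (E : Type*) [NormedAddCommGroup E] [InnerProductSpace ℝ E]
    [FiniteDimensional ℝ E] [MeasurableSpace E] [BorelSpace E] : ℝ := ∫ z : E, gk z

theorem gc_pos : 0 < gc E := by
  unfold gc
  rw [integral_pos_iff_support_of_nonneg (fun z => (gk_pos z).le)
    (gk_decay.integrable gk_continuous)]
  have : Function.support (gk : E → ℝ) = univ := by
    ext z; simp [(gk_pos z).ne']
  rw [this]
  exact isOpen_univ.measure_pos _ univ_nonempty

/-- The resolvent `l (l - Δ)⁻¹`, as a Gaussian average. -/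
noncomputable def res (l : ℝ) (h : E → ℝ) (x : E) : ℝ :=
  (gc E)⁻¹ * ∫ σ in Ioi 0, (σ * eta l σ) * avg gk h σ x

theorem avg_scale_continuous {h : E → ℝ} (hh : Continuous h) (hg : LinGrowth h)
    {F : Type*} [NormedAddCommGroup F] [NormedSpace ℝ F]
    {Φ : E → F} (hΦ : GaussDecay Φ) (hc : Continuous Φ) (x : E) :
    Continuous (fun σ => avg Φ h σ x) :=
  (avg_continuous hh hg hΦ hc).comp (f := fun σ : ℝ => (σ, x)) (by fun_prop)

theorem avg_point_continuous {h : E → ℝ} (hh : Continuous h) (hg : LinGrowth h)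
    {F : Type*} [NormedAddCommGroup F] [NormedSpace ℝ F]
    {Φ : E → F} (hΦ : GaussDecay Φ) (hc : Continuous Φ) (σ : ℝ) :
    Continuous (avg Φ h σ) :=
  (avg_continuous hh hg hΦ hc).comp (f := fun x : E => (σ, x)) (by fun_prop)

theorem eta_smul_avg_integrableOn {l : ℝ} (hl : 0 < l) {h : E → ℝ} (hh : Continuous h)
    (hg : LinGrowth h) {F : Type*} [NormedAddCommGroup F] [NormedSpace ℝ F]
    {Φ : E → F} (hΦ : GaussDecay Φ) (hc : Continuous Φ) (x : E) :
    IntegrableOn (fun σ => eta l σ • avg Φ h σ x) (Ioi 0) := by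
  obtain ⟨C, hC, hb⟩ := id hg
  have h1 : IntegrableOn (fun σ => (C * (1 + ‖x‖) * ∫ z, (1 + ‖z‖) * ‖Φ z‖) * eta l σ +
      (C * ∫ z, (1 + ‖z‖) * ‖Φ z‖) * (σ * eta l σ)) (Ioi 0) :=
    ((eta_integrableOn hl).const_mul _).add ((mul_eta_integrableOn hl).const_mul _)
  refine h1.mono' (Continuous.aestronglyMeasurable
    ((eta_continuous l).smul (avg_scale_continuous hh hg hΦ hc x))) ?_
  refine (ae_restrict_iff' measurableSet_Ioi).2 (Eventually.of_forall fun σ hσ => ?_)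
  have h2 := avg_norm_le hC hb hΦ hc σ x
  rw [abs_of_pos hσ] at h2
  rw [norm_smul, Real.norm_of_nonneg (eta_pos hl σ).le]
  calc _ ≤ eta l σ * ((C * (1 + ‖x‖ + σ)) * ∫ z, (1 + ‖z‖) * ‖Φ z‖) := by
        have := (eta_pos hl σ).le
        gcongr
    _ = _ := by ring

theorem res_integrableOn {l : ℝ} (hl : 0 < l) {h : E → ℝ} (hh : Continuous h)
    (hg : LinGrowth h) (x : E) :
    IntegrableOn (fun σ => (σ * eta l σ) * avg gk h σ x) (Ioi 0) := by
  obtain ⟨C, hC, hb⟩ := id hg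
  have h1 : IntegrableOn (fun σ => (C * (1 + ‖x‖) * ∫ z : E, (1 + ‖z‖) * ‖gk z‖) * (σ * eta l σ) +
      (C * ∫ z : E, (1 + ‖z‖) * ‖gk z‖) * (σ ^ 2 * eta l σ)) (Ioi 0) :=
    ((mul_eta_integrableOn hl).const_mul _).add ((sq_mul_eta_integrableOn hl).const_mul _)
  refine h1.mono' (Continuous.aestronglyMeasurable
    ((continuous_id.mul (eta_continuous l)).mul
      (avg_scale_continuous hh hg gk_decay gk_continuous x))) ?_
  refine (ae_restrict_iff' measurableSet_Ioi).2 (Eventually.of_forall fun σ (hσ : 0 < σ) => ?_)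
  have h2 := avg_norm_le hC hb gk_decay gk_continuous σ x
  rw [abs_of_pos hσ] at h2
  have h3 : 0 ≤ σ * eta l σ := mul_nonneg hσ.le (eta_pos hl σ).le
  rw [norm_mul, Real.norm_of_nonneg h3]
  calc _ ≤ (σ * eta l σ) * ((C * (1 + ‖x‖ + σ)) * ∫ z : E, (1 + ‖z‖) * ‖gk z‖) := by
        gcongr
    _ = _ := by ring

/-- The derivative of the resolvent. -/
noncomputable def res1 (l : ℝ) (h : E → ℝ) (x : E) : E →L[ℝ] ℝ :=
  (gc E)⁻¹ • ∫ σ in Ioi 0, eta l σ • avg gk1 h σ x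

/-- The second derivative of the resolvent. -/
noncomputable def res2 (l : ℝ) (h : E → ℝ) (x : E) : E →L[ℝ] E →L[ℝ] ℝ :=
  (gc E)⁻¹ • ∫ σ in Ioi 0, eta l σ • (-σ⁻¹ • avg gk2 h σ x)

theorem res_hasFDerivAt {l : ℝ} (hl : 0 < l) {h : E → ℝ} (hh : Continuous h)
    (hg : LinGrowth h) (x : E) : HasFDerivAt (res l h) (res1 l h x) x := by
  obtain ⟨C, hC, hb⟩ := id hg
  have key : HasFDerivAt (fun x => ∫ σ in Ioi 0, (σ * eta l σ) * avg gk h σ x)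
      (∫ σ in Ioi 0, eta l σ • avg gk1 h σ x) x := by
    refine hasFDerivAt_integral_of_dominated_of_fderiv_le
      (F' := fun x σ => eta l σ • avg gk1 h σ x)
      (bound := fun σ => (C * (2 + ‖x‖) * ∫ z : E, (1 + ‖z‖) * ‖gk1 z‖) * eta l σ +
      (C * ∫ z : E, (1 + ‖z‖) * ‖gk1 z‖) * (σ * eta l σ))
      (Metric.ball_mem_nhds x one_pos)
      (Eventually.of_forall fun x => (res_integrableOn hl hh hg x).aestronglyMeasurable)
      (res_integrableOn hl hh hg x)
      (eta_smul_avg_integrableOn hl hh hg gk1_decay gk1_continuous x).aestronglyMeasurable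
      ?_ (((eta_integrableOn hl).const_mul _).add ((mul_eta_integrableOn hl).const_mul _)) ?_
    · refine (ae_restrict_iff' measurableSet_Ioi).2
        (Eventually.of_forall fun σ (hσ : 0 < σ) y hy => ?_)
      have h2 := avg_norm_le hC hb gk1_decay gk1_continuous σ y
      rw [abs_of_pos hσ] at h2
      have h4 : ‖y‖ ≤ 1 + ‖x‖ := by
        have h5 : ‖y - x‖ < 1 := by rw [← dist_eq_norm]; exact hy
        have : ‖y‖ ≤ ‖y - x‖ + ‖x‖ := by simpa using norm_add_le (y - x) x
        linarith
      rw [norm_smul, Real.norm_of_nonneg (eta_pos hl σ).le]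
      have h6 : 0 ≤ ∫ z : E, (1 + ‖z‖) * ‖gk1 z‖ := integral_nonneg fun z => by positivity
      calc _ ≤ eta l σ * ((C * (1 + (1 + ‖x‖) + σ)) * ∫ z : E, (1 + ‖z‖) * ‖gk1 z‖) := by
            have := (eta_pos hl σ).le
            refine mul_le_mul_of_nonneg_left (h2.trans ?_) this
            gcongr
        _ = _ := by ring
    · refine (ae_restrict_iff' measurableSet_Ioi).2
        (Eventually.of_forall fun σ (hσ : 0 < σ) y hy => ?_)
      refine ((avg_gk_hasFDerivAt hh hg hσ y).const_mul (σ * eta l σ)).congr_fderiv ?_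
      rw [smul_smul]
      congr 1
      field_simp
  exact (key.const_smul (gc E)⁻¹)

theorem res_second_bound {l : ℝ} (hl : 0 < l) {h : E → ℝ} (hh : Continuous h)
    (hg : LinGrowth h) {y : E} {κ C : ℝ} (hκ : 0 < κ) (hκ1 : κ ≤ 1) (hC : 0 ≤ C)
    (hi : Incr h y κ C) {σ : ℝ} (hσ : 0 < σ) :
    ‖eta l σ • (-σ⁻¹ • avg gk2 h σ y)‖ ≤ (C * ∫ z : E, (1 + ‖z‖) * ‖gk2 z‖) * (σ ^ (κ - 1) * eta l σ) +
      (C * ∫ z : E, (1 + ‖z‖) * ‖gk2 z‖) * eta l σ := by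
  have h2 := avg_gk2_norm_le hh hg hκ hκ1 hC hi hσ
  rw [norm_smul, norm_smul, Real.norm_of_nonneg (eta_pos hl σ).le, norm_neg,
    Real.norm_of_nonneg (inv_nonneg.2 hσ.le)]
  calc _ ≤ eta l σ * (σ⁻¹ * ((C * (σ ^ κ + σ)) * ∫ z : E, (1 + ‖z‖) * ‖gk2 z‖)) := by
        have := (eta_pos hl σ).le
        gcongr
    _ = _ := by
        rw [Real.rpow_sub_one hσ.ne']
        field_simp

theorem res_second_integrableOn {l : ℝ} (hl : 0 < l) {κ : ℝ} (hκ : 0 < κ) (c : ℝ) :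
    IntegrableOn (fun σ => c * (σ ^ (κ - 1) * eta l σ) + c * eta l σ) (Ioi 0) :=
  ((rpow_mul_eta_integrableOn hl (by linarith)).const_mul _).add ((eta_integrableOn hl).const_mul _)

theorem res_second_measurable {l : ℝ} {h : E → ℝ} (hh : Continuous h)
    (hg : LinGrowth h) (y : E) : AEStronglyMeasurable
      (fun σ => eta l σ • (-σ⁻¹ • avg gk2 h σ y)) (volume.restrict (Ioi 0)) := by
  have h1 : AEStronglyMeasurable (fun σ : ℝ => -σ⁻¹) (volume.restrict (Ioi 0)) :=
    (measurable_inv.neg).aestronglyMeasurable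
  exact (eta_continuous l).aestronglyMeasurable.fun_smul (h1.fun_smul
    (avg_scale_continuous hh hg gk2_decay gk2_continuous y).aestronglyMeasurable)

/-- Local Hölder condition, with global increments. -/
def LocIncr (h : E → ℝ) : Prop := ∀ x : E, ∃ κ C : ℝ, 0 < κ ∧ κ ≤ 1 ∧ 0 ≤ C ∧
  ∀ y ∈ Metric.ball x 1, Incr h y κ C

theorem res1_hasFDerivAt {l : ℝ} (hl : 0 < l) {h : E → ℝ} (hh : Continuous h)
    (hg : LinGrowth h) (hi : LocIncr h) (x : E) : HasFDerivAt (res1 l h) (res2 l h x) x := by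
  obtain ⟨κ, C, hκ, hκ1, hC, hinc⟩ := hi x
  have hm : ∀ y, IntegrableOn (fun σ => eta l σ • avg gk1 h σ y) (Ioi 0) :=
    eta_smul_avg_integrableOn hl hh hg gk1_decay gk1_continuous
  have key : HasFDerivAt (fun x => ∫ σ in Ioi 0, eta l σ • avg gk1 h σ x)
      (∫ σ in Ioi 0, eta l σ • (-σ⁻¹ • avg gk2 h σ x)) x := by
    refine hasFDerivAt_integral_of_dominated_of_fderiv_le
      (F' := fun x σ => eta l σ • (-σ⁻¹ • avg gk2 h σ x))
      (Metric.ball_mem_nhds x one_pos)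
      (Eventually.of_forall fun x => (hm x).aestronglyMeasurable)
      (hm x) (res_second_measurable hh hg x) ?_
      (res_second_integrableOn hl hκ (C * ∫ z : E, (1 + ‖z‖) * ‖gk2 z‖)) ?_
    · exact (ae_restrict_iff' measurableSet_Ioi).2
        (Eventually.of_forall fun σ (hσ : 0 < σ) y hy =>
          res_second_bound hl hh hg hκ hκ1 hC (hinc y hy) hσ)
    · refine (ae_restrict_iff' measurableSet_Ioi).2
        (Eventually.of_forall fun σ (hσ : 0 < σ) y hy => ?_)
      exact (avg_gk1_hasFDerivAt hh hg hσ y).const_smul (eta l σ)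
  exact (key.const_smul (gc E)⁻¹)

theorem res2_continuous {l : ℝ} (hl : 0 < l) {h : E → ℝ} (hh : Continuous h)
    (hg : LinGrowth h) (hi : LocIncr h) : Continuous (res2 l h) := by
  unfold res2
  refine Continuous.const_smul (continuous_iff_continuousAt.2 fun x => ?_) (gc E)⁻¹
  obtain ⟨κ, C, hκ, hκ1, hC, hinc⟩ := hi x
  refine continuousAt_of_dominated (Eventually.of_forall fun y => res_second_measurable hh hg y)
    ?_ (res_second_integrableOn hl hκ (C * ∫ z : E, (1 + ‖z‖) * ‖gk2 z‖)) ?_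
  · filter_upwards [Metric.ball_mem_nhds x one_pos] with y hy
    exact (ae_restrict_iff' measurableSet_Ioi).2
        (Eventually.of_forall fun σ (hσ : 0 < σ) =>
          res_second_bound hl hh hg hκ hκ1 hC (hinc y hy) hσ)
  · refine Eventually.of_forall fun σ => Continuous.continuousAt ?_
    exact ((avg_point_continuous hh hg gk2_decay gk2_continuous σ).const_smul (-σ⁻¹)).const_smul
      (eta l σ)

theorem res_contDiff {l : ℝ} (hl : 0 < l) {h : E → ℝ} (hh : Continuous h)
    (hg : LinGrowth h) (hi : LocIncr h) : ContDiff ℝ 2 (res l h) := by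
  have h1 : ContDiff ℝ (0 + 1) (res1 l h) := by
    refine contDiff_succ_iff_hasFDerivAt (n := 0) |>.2 ⟨res2 l h, ?_, res1_hasFDerivAt hl hh hg hi⟩
    exact contDiff_zero.2 (res2_continuous hl hh hg hi)
  have h2 : ContDiff ℝ ((1 : ℕ) + 1) (res l h) := by
    refine contDiff_succ_iff_hasFDerivAt (n := 1) |>.2 ⟨res1 l h, ?_, res_hasFDerivAt hl hh hg⟩
    simpa using h1
  exact_mod_cast h2

theorem res2_trace {l : ℝ} (hl : 0 < l) {h : E → ℝ} (hh : Continuous h)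
    (hg : LinGrowth h) (hi : LocIncr h) (x : E) {ι : Type*} [Fintype ι]
    (b : OrthonormalBasis ι ℝ E) :
    ∑ i, res2 l h x (b i) (b i) = l * (res l h x - h x) := by
  obtain ⟨κ, C, hκ, hκ1, hC, hinc⟩ := hi x
  have hi2 : IntegrableOn (fun σ => eta l σ • (-σ⁻¹ • avg gk2 h σ x)) (Ioi 0) :=
    (res_second_integrableOn hl hκ (C * ∫ z : E, (1 + ‖z‖) * ‖gk2 z‖)).mono'
      (res_second_measurable hh hg x) ((ae_restrict_iff' measurableSet_Ioi).2
        (Eventually.of_forall fun σ (hσ : 0 < σ) =>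
          res_second_bound hl hh hg hκ hκ1 hC (hinc x (Metric.mem_ball_self one_pos)) hσ))
  have h1 : ∀ i, res2 l h x (b i) (b i) = (gc E)⁻¹ *
      ∫ σ in Ioi 0, eta l σ * (-σ⁻¹ * avg gk2 h σ x (b i) (b i)) := fun i => by
    rw [res2, _root_.smul_apply, _root_.smul_apply,
      ContinuousLinearMap.integral_apply hi2,
      ContinuousLinearMap.integral_apply (hi2.apply_continuousLinearMap _)]
    rfl
  have h2 : ∀ i, IntegrableOn (fun σ => eta l σ * (-σ⁻¹ * avg gk2 h σ x (b i) (b i))) (Ioi 0) :=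
    fun i => (hi2.apply_continuousLinearMap (b i)).apply_continuousLinearMap (b i)
  simp_rw [h1]
  rw [← Finset.mul_sum, ← integral_finsetSum Finset.univ fun i _ => h2 i]
  have h3 : ∀ σ, ∑ i, eta l σ * (-σ⁻¹ * avg gk2 h σ x (b i) (b i)) =
      eta l σ * (-σ⁻¹ * ∑ i, avg gk2 h σ x (b i) (b i)) := fun σ => by
    rw [Finset.mul_sum, Finset.mul_sum]
  have h4 := integrable_finsetSum Finset.univ fun i _ => h2 i
  simp_rw [h3] at h4 ⊢
  have hr := res_integrableOn hl hh hg x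
  have hcont : Continuous fun σ => eta l σ * avg gk h σ x :=
    (eta_continuous l).mul (avg_scale_continuous hh hg gk_decay gk_continuous x)
  have h5 : ∫ σ in Ioi 0, ((eta l σ * (-σ⁻¹ * ∑ i, avg gk2 h σ x (b i) (b i))) -
      l * ((σ * eta l σ) * avg gk h σ x)) = 0 - eta l 0 * avg gk h 0 x := by
    refine integral_Ioi_of_hasDerivAt_of_tendsto (f := fun σ => eta l σ * avg gk h σ x)
      hcont.continuousWithinAt (fun σ (hσ : 0 < σ) => ?_) (h4.sub (hr.const_mul l)) ?_
    · refine ((eta_hasDerivAt l σ).mul (avg_gk_hasDerivAt hh hg hσ x b)).congr_deriv ?_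
      ring
    · obtain ⟨C, hC, hb⟩ := id hg
      have h6 : 0 ≤ ∫ z : E, (1 + ‖z‖) * ‖gk z‖ := integral_nonneg fun z => by positivity
      refine squeeze_zero_norm' ?_ (tendsto_eta_mul hl
        ((C * (1 + ‖x‖)) * ∫ z : E, (1 + ‖z‖) * ‖gk z‖))
      filter_upwards [eventually_gt_atTop 0] with σ hσ
      rw [norm_mul, Real.norm_of_nonneg (eta_pos hl σ).le]
      refine mul_le_mul_of_nonneg_left ?_ (eta_pos hl σ).le
      refine (avg_norm_le hC hb gk_decay gk_continuous σ x).trans ?_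
      rw [abs_of_pos hσ, mul_right_comm (C * (1 + ‖x‖))]
      refine mul_le_mul_of_nonneg_right ?_ h6
      rw [mul_assoc]
      refine mul_le_mul_of_nonneg_left ?_ hC
      nlinarith [norm_nonneg x]
  rw [integral_sub h4 (hr.const_mul l), integral_const_mul] at h5
  have h7 : avg gk h 0 x = h x * gc E := by
    simp [avg, gc, integral_const_mul]
  have h8 : eta l 0 = l := by simp [eta]
  rw [h7, h8] at h5
  have h9 := (gc_pos (E := E)).ne'
  rw [sub_eq_iff_eq_add.1 h5, res]
  field_simp
  ring

end Resolvent

section ResolventProps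
open MeasureTheory Filter Topology Module

variable {E : Type*} [NormedAddCommGroup E] [InnerProductSpace ℝ E] [FiniteDimensional ℝ E]
  [MeasurableSpace E] [BorelSpace E]

theorem linGrowth_of_bounded {h : E → ℝ} {M : ℝ} (hb : ∀ y, |h y| ≤ M) : LinGrowth h :=
  ⟨M, (abs_nonneg _).trans (hb 0), fun y => (hb y).trans
    (le_mul_of_one_le_right ((abs_nonneg _).trans (hb 0)) (by linarith [norm_nonneg y]))⟩

theorem LinGrowth.add {f g : E → ℝ} (hf : LinGrowth f) (hg : LinGrowth g) :
    LinGrowth (fun x => f x + g x) := by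
  obtain ⟨C, hC, h1⟩ := hf
  obtain ⟨D, hD, h2⟩ := hg
  exact ⟨C + D, add_nonneg hC hD, fun y => by
    rw [add_mul]; exact (abs_add_le _ _).trans (add_le_add (h1 y) (h2 y))⟩

theorem LinGrowth.const_mul {f : E → ℝ} (hf : LinGrowth f) (c : ℝ) :
    LinGrowth (fun x => c * f x) := by
  obtain ⟨C, hC, h1⟩ := hf
  exact ⟨|c| * C, by positivity, fun y => by
    rw [abs_mul, mul_assoc]; exact mul_le_mul_of_nonneg_left (h1 y) (abs_nonneg c)⟩

theorem res_add {l : ℝ} (hl : 0 < l) {f g : E → ℝ} (hf : Continuous f) (hf' : LinGrowth f)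
    (hg : Continuous g) (hg' : LinGrowth g) (x : E) :
    res l (fun x => f x + g x) x = res l f x + res l g x := by
  have h1 : ∀ σ, avg gk (fun x => f x + g x) σ x = avg gk f σ x + avg gk g σ x := fun σ => by
    simp only [avg, add_smul]
    exact integral_add (avg_integrable hf hf' gk_decay gk_continuous σ x)
      (avg_integrable hg hg' gk_decay gk_continuous σ x)
  simp only [res, h1, mul_add]
  rw [integral_add (res_integrableOn hl hf hf' x) (res_integrableOn hl hg hg' x), mul_add]

theorem res_const_mul (l c : ℝ) (f : E → ℝ) (x : E) :
    res l (fun x => c * f x) x = c * res l f x := by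
  have h1 : ∀ σ, avg gk (fun x => c * f x) σ x = c * avg gk f σ x := fun σ => by
    simp only [avg, smul_eq_mul, mul_assoc, integral_const_mul]
  simp only [res, h1, mul_left_comm _ c, integral_const_mul]

theorem res_sub {l : ℝ} (hl : 0 < l) {f g : E → ℝ} (hf : Continuous f) (hf' : LinGrowth f)
    (hg : Continuous g) (hg' : LinGrowth g) (x : E) :
    res l (fun x => f x - g x) x = res l f x - res l g x := by
  have := res_add hl hf hf' (hg.const_mul (-1)) (hg'.const_mul (-1)) x
  rw [res_const_mul] at this
  simpa [sub_eq_add_neg] using this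

theorem res_const {l : ℝ} (hl : 0 < l) (c : ℝ) (x : E) : res l (fun _ => c) x = c := by
  have h1 : ∀ σ, avg gk (fun _ => c) σ x = c * gc E := fun σ => by
    simp only [avg, smul_eq_mul, integral_const_mul, gc]
  simp only [res, h1]
  rw [integral_mul_const, integral_mul_eta hl]
  have := (gc_pos (E := E)).ne'
  field_simp

theorem res_mono {l : ℝ} (hl : 0 < l) {f g : E → ℝ} (hf : Continuous f) (hf' : LinGrowth f)
    (hg : Continuous g) (hg' : LinGrowth g) (hfg : ∀ x, f x ≤ g x) (x : E) :
    res l f x ≤ res l g x := by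
  refine mul_le_mul_of_nonneg_left ?_ (inv_nonneg.2 gc_pos.le)
  refine setIntegral_mono_on (res_integrableOn hl hf hf' x) (res_integrableOn hl hg hg' x)
    measurableSet_Ioi fun σ (hσ : 0 < σ) => ?_
  refine mul_le_mul_of_nonneg_left ?_ (mul_nonneg hσ.le (eta_pos hl σ).le)
  exact integral_mono (avg_integrable hf hf' gk_decay gk_continuous σ x)
    (avg_integrable hg hg' gk_decay gk_continuous σ x)
    fun z => mul_le_mul_of_nonneg_right (hfg _) (gk_pos z).le

theorem abs_res_le {l : ℝ} (hl : 0 < l) {f g : E → ℝ} (hf : Continuous f) (hf' : LinGrowth f)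
    (hg : Continuous g) (hg' : LinGrowth g) (hfg : ∀ x, |f x| ≤ g x) (x : E) :
    |res l f x| ≤ res l g x := by
  refine abs_le.2 ⟨?_, res_mono hl hf hf' hg hg' (fun x => (le_abs_self _).trans (hfg x)) x⟩
  have h1 := res_mono hl (hg.const_mul (-1)) (hg'.const_mul (-1)) hf hf'
    (fun x => by linarith [neg_abs_le (f x), hfg x]) x
  rw [res_const_mul] at h1
  linarith

theorem abs_res_le_const {l : ℝ} (hl : 0 < l) {f : E → ℝ} {M : ℝ} (hf : Continuous f)
    (hM : ∀ x, |f x| ≤ M) (x : E) : |res l f x| ≤ M := by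
  have := abs_res_le hl hf (linGrowth_of_bounded hM) continuous_const (linGrowth_const M) hM x
  rwa [res_const hl] at this

theorem res_tendsto {l : ℝ} (hl : 0 < l) {f : ℕ → E → ℝ} {g : E → ℝ} {M : ℝ}
    (hf : ∀ n, Continuous (f n)) (hM : ∀ n x, |f n x| ≤ M)
    (hlim : ∀ x, Tendsto (fun n => f n x) atTop (𝓝 (g x))) (x : E) :
    Tendsto (fun n => res l (f n) x) atTop (𝓝 (res l g x)) := by
  refine Tendsto.const_mul _ ?_
  refine tendsto_integral_of_dominated_convergence
    (fun σ => (M * ∫ z : E, ‖gk z‖) * (σ * eta l σ))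
    (fun n => (res_integrableOn hl (hf n) (linGrowth_of_bounded (hM n)) x).aestronglyMeasurable)
    ((mul_eta_integrableOn hl).const_mul _) (fun n => ?_) ?_
  · refine (ae_restrict_iff' measurableSet_Ioi).2
      (Eventually.of_forall fun σ (hσ : 0 < σ) => ?_)
    have h3 : 0 ≤ σ * eta l σ := mul_nonneg hσ.le (eta_pos hl σ).le
    rw [norm_mul, Real.norm_of_nonneg h3, mul_comm]
    exact mul_le_mul_of_nonneg_right
      (avg_norm_le_of_bounded (hM n) gk_decay gk_continuous σ x) h3
  · refine Eventually.of_forall fun σ => Tendsto.const_mul _ ?_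
    refine tendsto_integral_of_dominated_convergence (fun z => M * ‖gk z‖)
      (fun n => (avg_integrable (hf n) (linGrowth_of_bounded (hM n)) gk_decay gk_continuous
        σ x).aestronglyMeasurable)
      ((gk_decay.integrable gk_continuous).norm.const_mul _)
      (fun n => Eventually.of_forall fun z => ?_)
      (Eventually.of_forall fun z => (hlim _).smul_const _)
    rw [norm_smul]
    exact mul_le_mul_of_nonneg_right (hM n _) (norm_nonneg _)

theorem res_lipschitz {l : ℝ} (hl : 0 < l) : ∃ L : ℝ, 0 ≤ L ∧ ∀ (f : E → ℝ) (M : ℝ),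
    Continuous f → (∀ x, |f x| ≤ M) → ∀ x y, |res l f x - res l f y| ≤ L * M * ‖x - y‖ := by
  refine ⟨(gc E)⁻¹ * ((∫ σ in Ioi 0, eta l σ) * ∫ z : E, ‖gk1 z‖), ?_, fun f M hf hM x y => ?_⟩
  · exact mul_nonneg (inv_nonneg.2 gc_pos.le) (mul_nonneg
      (setIntegral_nonneg measurableSet_Ioi fun σ _ => (eta_pos hl σ).le)
      (integral_nonneg fun z => norm_nonneg _))
  · have h1 : ∀ x, ‖res1 l f x‖ ≤ (gc E)⁻¹ * ((∫ σ in Ioi 0, eta l σ) * ∫ z : E, ‖gk1 z‖) * M := by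
      intro x
      rw [res1, norm_smul, Real.norm_of_nonneg (inv_nonneg.2 gc_pos.le), mul_assoc]
      refine mul_le_mul_of_nonneg_left ?_ (inv_nonneg.2 gc_pos.le)
      rw [mul_assoc, ← integral_mul_const]
      refine norm_integral_le_of_norm_le ((eta_integrableOn hl).mul_const _)
        (Eventually.of_forall fun σ => ?_)
      rw [norm_smul, Real.norm_of_nonneg (eta_pos hl σ).le, mul_comm _ M]
      exact mul_le_mul_of_nonneg_left
        (avg_norm_le_of_bounded hM gk1_decay gk1_continuous σ x) (eta_pos hl σ).le
    have := convex_univ.norm_image_sub_le_of_norm_hasFDerivWithin_le (f := res l f)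
      (f' := res1 l f) (fun x _ => (res_hasFDerivAt hl hf (linGrowth_of_bounded hM) x).hasFDerivWithinAt)
      (fun x _ => h1 x) (mem_univ y) (mem_univ x)
    exact this

end ResolventProps

section HolderCalculus
open Filter Topology

variable {d : ℕ}

theorem locHolder_of_balls {f : EuclideanSpace ℝ (Fin d) → ℝ}
    (h : ∀ r : ℝ, 0 < r → ∃ κ C : ℝ, 0 < κ ∧ κ ≤ 1 ∧ 0 ≤ C ∧
      ∀ x ∈ Metric.closedBall 0 r, ∀ y ∈ Metric.closedBall 0 r, |f x - f y| ≤ C * ‖x - y‖ ^ κ) :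
    LocHolder f := by
  intro K hK
  obtain ⟨r, hr, hKr⟩ := hK.isBounded.subset_closedBall_lt 0 0
  obtain ⟨κ, C, h1, h2, h3, h4⟩ := h r hr
  exact ⟨κ, C, h1, h2, h3, fun x hx y hy => h4 x (hKr hx) y (hKr hy)⟩

theorem rpow_le_of_exponent {t r κ κ' : ℝ} (ht : 0 ≤ t) (htr : t ≤ r) (hκ : 0 < κ)
    (h : κ ≤ κ') (hκ' : κ' ≤ 1) : t ^ κ' ≤ (1 + r) * t ^ κ := by
  have h1 : t ^ κ' = t ^ (κ' - κ) * t ^ κ := by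
    rw [← Real.rpow_add_of_nonneg ht (by linarith) hκ.le]; simp
  rw [h1]
  refine mul_le_mul_of_nonneg_right ?_ (Real.rpow_nonneg ht _)
  calc t ^ (κ' - κ) ≤ (1 + r) ^ (κ' - κ) := Real.rpow_le_rpow ht (by linarith) (by linarith)
    _ ≤ (1 + r) ^ (1 : ℝ) := Real.rpow_le_rpow_of_exponent_le (by linarith) (by linarith)
    _ = _ := by simp

theorem LocHolder.continuous {f : EuclideanSpace ℝ (Fin d) → ℝ} (hf : LocHolder f) :
    Continuous f := by
  rw [continuous_iff_continuousAt]
  intro x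
  obtain ⟨κ, C, h1, h2, h3, h4⟩ := hf (Metric.closedBall x 1) (isCompact_closedBall x 1)
  have h5 : Tendsto (fun y => C * ‖y - x‖ ^ κ) (𝓝 x) (𝓝 0) := by
    have : Continuous fun y => C * ‖y - x‖ ^ κ :=
      continuous_const.mul ((continuous_id.sub continuous_const).norm.rpow_const
        fun _ => Or.inr h1.le)
    have h6 := this.tendsto x
    simpa [Real.zero_rpow h1.ne'] using h6
  rw [ContinuousAt, tendsto_iff_norm_sub_tendsto_zero]
  refine squeeze_zero' (Eventually.of_forall fun y => norm_nonneg _) ?_ h5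
  filter_upwards [Metric.closedBall_mem_nhds x one_pos] with y hy
  exact h4 y hy x (Metric.mem_closedBall_self zero_le_one)

theorem LocHolder.const (c : ℝ) : LocHolder (fun _ : EuclideanSpace ℝ (Fin d) => c) :=
  fun _ _ => ⟨1, 0, one_pos, le_rfl, le_rfl, fun _ _ _ _ => by simp⟩

/-- Two locally Hölder functions share a modulus and a bound on each ball. -/
theorem LocHolder.common {f g : EuclideanSpace ℝ (Fin d) → ℝ} (hf : LocHolder f)
    (hg : LocHolder g) {r : ℝ} (hr : 0 < r) : ∃ κ C : ℝ, 0 < κ ∧ κ ≤ 1 ∧ 0 ≤ C ∧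
      (∀ x ∈ Metric.closedBall 0 r, |f x| ≤ C ∧ |g x| ≤ C) ∧
      ∀ x ∈ Metric.closedBall 0 r, ∀ y ∈ Metric.closedBall 0 r,
        |f x - f y| ≤ C * ‖x - y‖ ^ κ ∧ |g x - g y| ≤ C * ‖x - y‖ ^ κ := by
  have hK := isCompact_closedBall (0 : EuclideanSpace ℝ (Fin d)) r
  obtain ⟨κ, C, h1, h2, h3, h4⟩ := hf _ hK
  obtain ⟨κ', C', h1', h2', h3', h4'⟩ := hg _ hK
  obtain ⟨M, hM⟩ := hK.exists_bound_of_continuousOn hf.continuous.continuousOn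
  obtain ⟨M', hM'⟩ := hK.exists_bound_of_continuousOn hg.continuous.continuousOn
  have hr0 : 0 ≤ 1 + 2 * r := by linarith
  set D := |M| + |M'| + C * (1 + 2 * r) + C' * (1 + 2 * r) with hD
  have a1 : 0 ≤ C * (1 + 2 * r) := mul_nonneg h3 hr0
  have a2 : 0 ≤ C' * (1 + 2 * r) := mul_nonneg h3' hr0
  have hb : ∀ x ∈ Metric.closedBall (0 : EuclideanSpace ℝ (Fin d)) r,
      ∀ y ∈ Metric.closedBall 0 r, ‖x - y‖ ≤ 2 * r := fun x hx y hy => by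
    rw [mem_closedBall_zero_iff] at hx hy
    linarith [norm_sub_le x y]
  refine ⟨min κ κ', D, lt_min h1 h1', (min_le_left _ _).trans h2, by positivity,
    fun x hx => ⟨(hM x hx).trans ?_, (hM' x hx).trans ?_⟩, fun x hx y hy => ⟨?_, ?_⟩⟩
  · linarith [le_abs_self M, abs_nonneg M']
  · linarith [le_abs_self M', abs_nonneg M]
  · refine (h4 x hx y hy).trans ?_
    refine (mul_le_mul_of_nonneg_left (rpow_le_of_exponent (norm_nonneg _) (hb x hx y hy)
      (lt_min h1 h1') (min_le_left _ _) h2) h3).trans ?_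
    rw [← mul_assoc]
    exact mul_le_mul_of_nonneg_right (by linarith [abs_nonneg M, abs_nonneg M'])
      (Real.rpow_nonneg (norm_nonneg _) _)
  · refine (h4' x hx y hy).trans ?_
    refine (mul_le_mul_of_nonneg_left (rpow_le_of_exponent (norm_nonneg _) (hb x hx y hy)
      (lt_min h1 h1') (min_le_right _ _) h2') h3').trans ?_
    rw [← mul_assoc]
    exact mul_le_mul_of_nonneg_right (by linarith [abs_nonneg M, abs_nonneg M'])
      (Real.rpow_nonneg (norm_nonneg _) _)

theorem LocHolder.add {f g : EuclideanSpace ℝ (Fin d) → ℝ} (hf : LocHolder f)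
    (hg : LocHolder g) : LocHolder (fun x => f x + g x) := by
  refine locHolder_of_balls fun r hr => ?_
  obtain ⟨κ, C, h1, h2, h3, -, h4⟩ := hf.common hg hr
  refine ⟨κ, 2 * C, h1, h2, by positivity, fun x hx y hy => ?_⟩
  obtain ⟨h5, h6⟩ := h4 x hx y hy
  calc |f x + g x - (f y + g y)| = |(f x - f y) + (g x - g y)| := by ring_nf
    _ ≤ _ := abs_add_le _ _
    _ ≤ _ := by linarith

theorem LocHolder.mul {f g : EuclideanSpace ℝ (Fin d) → ℝ} (hf : LocHolder f)
    (hg : LocHolder g) : LocHolder (fun x => f x * g x) := by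
  refine locHolder_of_balls fun r hr => ?_
  obtain ⟨κ, C, h1, h2, h3, h7, h4⟩ := hf.common hg hr
  refine ⟨κ, 2 * C ^ 2, h1, h2, by positivity, fun x hx y hy => ?_⟩
  obtain ⟨h5, h6⟩ := h4 x hx y hy
  calc |f x * g x - f y * g y| = |f x * (g x - g y) + (f x - f y) * g y| := by ring_nf
    _ ≤ |f x| * |g x - g y| + |f x - f y| * |g y| := by
      rw [← abs_mul, ← abs_mul]; exact abs_add_le _ _
    _ ≤ C * (C * ‖x - y‖ ^ κ) + (C * ‖x - y‖ ^ κ) * C := by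
      gcongr
      · exact (h7 x hx).1
      · exact (h7 y hy).2
    _ = _ := by ring

theorem LocHolder.const_mul {f : EuclideanSpace ℝ (Fin d) → ℝ} (hf : LocHolder f) (c : ℝ) :
    LocHolder (fun x => c * f x) := (LocHolder.const c).mul hf

theorem LocHolder.sub {f g : EuclideanSpace ℝ (Fin d) → ℝ} (hf : LocHolder f)
    (hg : LocHolder g) : LocHolder (fun x => f x - g x) := by
  have := hf.add (hg.const_mul (-1))
  simpa [sub_eq_add_neg] using this

theorem LocHolder.comp {f : EuclideanSpace ℝ (Fin d) → ℝ} (hf : LocHolder f) {F : ℝ → ℝ}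
    {S : Set ℝ} (hS : ∀ x, f x ∈ S)
    (hF : ∀ M : ℝ, 0 ≤ M → ∃ L : ℝ, 0 ≤ L ∧ ∀ a ∈ S, ∀ b ∈ S, |a| ≤ M → |b| ≤ M →
      |F a - F b| ≤ L * |a - b|) : LocHolder (fun x => F (f x)) := by
  refine locHolder_of_balls fun r hr => ?_
  obtain ⟨κ, C, h1, h2, h3, h7, h4⟩ := hf.common hf hr
  obtain ⟨L, hL, h8⟩ := hF C h3
  refine ⟨κ, L * C, h1, h2, by positivity, fun x hx y hy => ?_⟩
  refine (h8 _ (hS x) _ (hS y) (h7 x hx).1 (h7 y hy).1).trans ?_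
  rw [mul_assoc]
  exact mul_le_mul_of_nonneg_left (h4 x hx y hy).1 hL

theorem LocHolder.inv {f : EuclideanSpace ℝ (Fin d) → ℝ} (hf : LocHolder f) {c : ℝ}
    (hc : 0 < c) (hcf : ∀ x, c ≤ f x) : LocHolder (fun x => (f x)⁻¹) := by
  refine hf.comp (F := fun a => a⁻¹) (S := Ici c) hcf fun M _ =>
    ⟨c⁻¹ * c⁻¹, by positivity, fun a (ha : c ≤ a) b (hb : c ≤ b) _ _ => ?_⟩
  have ha' : 0 < a := hc.trans_le ha
  have hb' : 0 < b := hc.trans_le hb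
  rw [inv_sub_inv ha'.ne' hb'.ne', abs_div, abs_sub_comm, abs_of_pos (mul_pos ha' hb'),
    div_eq_mul_inv, mul_comm, mul_inv]
  gcongr

theorem abs_rpow_sub_le {p M a b : ℝ} (hp : 1 ≤ p) (ha : 0 ≤ a) (hb : 0 ≤ b) (haM : a ≤ M)
    (hbM : b ≤ M) : |a ^ p - b ^ p| ≤ p * M ^ (p - 1) * |a - b| := by
  have := (convex_Icc 0 M).norm_image_sub_le_of_norm_hasDerivWithin_le (f := fun x : ℝ => x ^ p)
    (f' := fun x => p * x ^ (p - 1)) (C := p * M ^ (p - 1))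
    (fun x _ => (Real.hasDerivAt_rpow_const (Or.inr hp)).hasDerivWithinAt)
    (fun x hx => by
      rw [Real.norm_of_nonneg (mul_nonneg (by linarith) (Real.rpow_nonneg hx.1 _))]
      exact mul_le_mul_of_nonneg_left (Real.rpow_le_rpow hx.1 hx.2 (by linarith)) (by linarith))
    ⟨hb, hbM⟩ ⟨ha, haM⟩
  exact this

theorem LocHolder.rpow {f : EuclideanSpace ℝ (Fin d) → ℝ} (hf : LocHolder f) {p : ℝ}
    (hp : 1 ≤ p) (h0 : ∀ x, 0 ≤ f x) : LocHolder (fun x => f x ^ p) := by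
  refine hf.comp (F := fun a => a ^ p) (S := Ici 0) h0 fun M hM =>
    ⟨p * M ^ (p - 1), mul_nonneg (by linarith) (Real.rpow_nonneg hM _),
      fun a (ha : 0 ≤ a) b (hb : 0 ≤ b) haM hbM => ?_⟩
  exact abs_rpow_sub_le hp ha hb ((le_abs_self _).trans haM) ((le_abs_self _).trans hbM)

theorem locHolder_of_contDiff {f : EuclideanSpace ℝ (Fin d) → ℝ} (hf : ContDiff ℝ 1 f) :
    LocHolder f := by
  refine locHolder_of_balls fun r hr => ?_
  obtain ⟨M, hM⟩ := (isCompact_closedBall (0 : EuclideanSpace ℝ (Fin d)) r).exists_bound_of_continuousOn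
    (hf.continuous_fderiv one_ne_zero).continuousOn
  refine ⟨1, |M|, one_pos, le_rfl, abs_nonneg _, fun x hx y hy => ?_⟩
  rw [Real.rpow_one]
  exact (convex_closedBall 0 r).norm_image_sub_le_of_norm_fderiv_le
    (fun z _ => (hf.differentiable one_ne_zero) z)
    (fun z hz => (hM z hz).trans (le_abs_self M)) hy hx

theorem LocHolder.locIncr {f : EuclideanSpace ℝ (Fin d) → ℝ} (hf : LocHolder f)
    (hg : LinGrowth f) : LocIncr f := by
  intro x₀
  obtain ⟨κ, C, h1, h2, h3, h4⟩ := hf (Metric.closedBall x₀ 2) (isCompact_closedBall x₀ 2)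
  obtain ⟨D, hD, h5⟩ := hg
  refine ⟨κ, C + D * (2 * ‖x₀‖ + 5), h1, h2, by positivity, fun x hx y => ?_⟩
  have hk : 0 ≤ ‖y - x‖ ^ κ := Real.rpow_nonneg (norm_nonneg _) _
  have hD' : 0 ≤ D * (2 * ‖x₀‖ + 5) := by positivity
  have hxd : dist x x₀ < 1 := hx
  by_cases hy : dist y x₀ ≤ 2
  · have := h4 y hy x (Metric.mem_closedBall.2 (by linarith))
    refine this.trans ?_
    exact mul_le_mul (by linarith) (by linarith [norm_nonneg (y - x)]) hk (by positivity)
  · push Not at hy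
    have hyx : 1 ≤ ‖y - x‖ := by
      rw [← dist_eq_norm]
      linarith [dist_triangle y x x₀]
    have hxn : ‖x‖ ≤ ‖x₀‖ + 1 := by
      have : ‖x‖ ≤ ‖x₀‖ + ‖x - x₀‖ := by simpa using norm_add_le x₀ (x - x₀)
      rw [dist_eq_norm] at hxd
      linarith
    have hyn : ‖y‖ ≤ ‖x‖ + ‖y - x‖ := by simpa using norm_add_le x (y - x)
    have h6 : |f y - f x| ≤ D * (1 + ‖y‖) + D * (1 + ‖x‖) :=
      (abs_sub _ _).trans (add_le_add (h5 y) (h5 x))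
    calc |f y - f x| ≤ D * (2 + (1 + ‖y‖) + (1 + ‖x‖) - 2) := by linarith
      _ ≤ D * ((2 * ‖x₀‖ + 5) * ‖y - x‖) := by
        refine mul_le_mul_of_nonneg_left ?_ hD
        nlinarith [norm_nonneg x₀]
      _ ≤ _ := by
        nlinarith [norm_nonneg (y - x), mul_nonneg hD' hk, mul_nonneg h3 hk, mul_nonneg h3 (norm_nonneg (y - x))]

end HolderCalculus

section Laplacian
open Filter Topology

variable {d : ℕ}

/-- The Laplacian on `ℝ^d`. -/
noncomputable def lap (f : EuclideanSpace ℝ (Fin d) → ℝ) (x : EuclideanSpace ℝ (Fin d)) : ℝ :=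
  ∑ i, pd i (pd i f) x

theorem pd_pd_eq {f : EuclideanSpace ℝ (Fin d) → ℝ} {f1 : EuclideanSpace ℝ (Fin d) → EuclideanSpace ℝ (Fin d) →L[ℝ] ℝ}
    {f2 : EuclideanSpace ℝ (Fin d) →L[ℝ] EuclideanSpace ℝ (Fin d) →L[ℝ] ℝ}
    {x : EuclideanSpace ℝ (Fin d)}
    (h1 : ∀ x, HasFDerivAt f (f1 x) x) (h2 : HasFDerivAt f1 f2 x) (i : Fin d) :
    pd i (pd i f) x = f2 (EuclideanSpace.single i 1) (EuclideanSpace.single i 1) := by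
  have h3 : pd i f = fun x => f1 x (EuclideanSpace.single i 1) :=
    funext fun x => by rw [pd, (h1 x).fderiv]
  rw [h3, pd]
  have h4 := h2.clm_apply (hasFDerivAt_const (EuclideanSpace.single i (1 : ℝ)) x)
  rw [h4.fderiv]
  simp

theorem contDiff_two_derivs {f : EuclideanSpace ℝ (Fin d) → ℝ} (hf : ContDiff ℝ 2 f) :
    (∀ x, HasFDerivAt f (fderiv ℝ f x) x) ∧
      ∀ x, HasFDerivAt (fderiv ℝ f) (fderiv ℝ (fderiv ℝ f) x) x := by
  have h1 : ContDiff ℝ 1 (fderiv ℝ f) := hf.fderiv_right (m := 1) (by norm_num)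
  exact ⟨fun x => (hf.differentiable two_ne_zero x).hasFDerivAt,
    fun x => (h1.differentiable one_ne_zero x).hasFDerivAt⟩

theorem lap_eq {f : EuclideanSpace ℝ (Fin d) → ℝ} (hf : ContDiff ℝ 2 f)
    (x : EuclideanSpace ℝ (Fin d)) : lap f x = ∑ i, fderiv ℝ (fderiv ℝ f) x
      (EuclideanSpace.single i 1) (EuclideanSpace.single i 1) :=
  Finset.sum_congr rfl fun i _ =>
    pd_pd_eq (contDiff_two_derivs hf).1 ((contDiff_two_derivs hf).2 x) i

theorem lap_add {f g : EuclideanSpace ℝ (Fin d) → ℝ} (hf : ContDiff ℝ 2 f) (hg : ContDiff ℝ 2 g)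
    (x : EuclideanSpace ℝ (Fin d)) : lap (fun x => f x + g x) x = lap f x + lap g x := by
  rw [lap_eq hf, lap_eq hg, ← Finset.sum_add_distrib]
  refine Finset.sum_congr rfl fun i _ => ?_
  obtain ⟨f1, f2⟩ := contDiff_two_derivs hf
  obtain ⟨g1, g2⟩ := contDiff_two_derivs hg
  exact pd_pd_eq (f1 := fun x => fderiv ℝ f x + fderiv ℝ g x)
    (fun x => (f1 x).fun_add (g1 x)) ((f2 x).fun_add (g2 x)) i

theorem lap_const_mul {f : EuclideanSpace ℝ (Fin d) → ℝ} (hf : ContDiff ℝ 2 f) (c : ℝ)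
    (x : EuclideanSpace ℝ (Fin d)) : lap (fun x => c * f x) x = c * lap f x := by
  rw [lap_eq hf, Finset.mul_sum]
  refine Finset.sum_congr rfl fun i _ => ?_
  obtain ⟨f1, f2⟩ := contDiff_two_derivs hf
  exact pd_pd_eq (f1 := fun x => c • fderiv ℝ f x)
    (fun x => (f1 x).const_mul c) ((f2 x).const_smul c) i

theorem lap_sub {f g : EuclideanSpace ℝ (Fin d) → ℝ} (hf : ContDiff ℝ 2 f) (hg : ContDiff ℝ 2 g)
    (x : EuclideanSpace ℝ (Fin d)) : lap (fun x => f x - g x) x = lap f x - lap g x := by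
  have := lap_add hf (hg.const_smul (-1 : ℝ)) x
  simp only [smul_eq_mul] at this
  have h2 := lap_const_mul hg (-1) x
  simp only [sub_eq_add_neg]
  rw [← neg_one_mul (lap g x), ← h2, ← this]
  congr 1
  ext y; ring

theorem res_lap {l : ℝ} (hl : 0 < l) {h : EuclideanSpace ℝ (Fin d) → ℝ} (hh : LocHolder h)
    (hg : LinGrowth h) (x : EuclideanSpace ℝ (Fin d)) :
    lap (res l h) x = l * (res l h x - h x) := by
  rw [← res2_trace hl hh.continuous hg (hh.locIncr hg) x (EuclideanSpace.basisFun (Fin d) ℝ)]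
  refine Finset.sum_congr rfl fun i _ => ?_
  rw [EuclideanSpace.basisFun_apply]
  exact pd_pd_eq (res_hasFDerivAt hl hh.continuous hg)
    (res1_hasFDerivAt hl hh.continuous hg (hh.locIncr hg) x) i

theorem lap_radial {f f' f'' : ℝ → ℝ} (h1 : ∀ s, 0 ≤ s → HasDerivAt f (f' s) s)
    (h2 : ∀ s, 0 ≤ s → HasDerivAt f' (f'' s) s) (x : EuclideanSpace ℝ (Fin d)) :
    lap (fun x => f (‖x‖ ^ 2)) x = 4 * ‖x‖ ^ 2 * f'' (‖x‖ ^ 2) + 2 * d * f' (‖x‖ ^ 2) := by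
  have hn : ∀ x : EuclideanSpace ℝ (Fin d), HasFDerivAt (fun x => ‖x‖ ^ 2)
      ((2 : ℝ) • innerB (EuclideanSpace ℝ (Fin d)) x) x := fun x => by
    refine ((hasFDerivAt_id x).norm_sq).congr_fderiv (ContinuousLinearMap.ext fun v => ?_)
    simp [innerB_apply]
  have a1 : ∀ x, HasFDerivAt (fun x : EuclideanSpace ℝ (Fin d) => f (‖x‖ ^ 2))
      (f' (‖x‖ ^ 2) • ((2 : ℝ) • innerB (EuclideanSpace ℝ (Fin d)) x)) x := fun x =>
    (h1 _ (sq_nonneg _)).comp_hasFDerivAt x (hn x)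
  have a2 := ((h2 _ (sq_nonneg _)).comp_hasFDerivAt x (hn x)).smul
    ((innerB (EuclideanSpace ℝ (Fin d))).hasFDerivAt (x := x).const_smul (2 : ℝ))
  have a3 : ∀ i, pd i (pd i (fun x : EuclideanSpace ℝ (Fin d) => f (‖x‖ ^ 2))) x =
      4 * f'' (‖x‖ ^ 2) * x i ^ 2 + 2 * f' (‖x‖ ^ 2) := fun i => by
    rw [pd_pd_eq a1 a2 i]
    simp [innerB_apply, EuclideanSpace.inner_single_right]
    ring
  rw [lap, Finset.sum_congr rfl fun i _ => a3 i, Finset.sum_add_distrib, ← Finset.mul_sum,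
    EuclideanSpace.real_norm_sq_eq]
  simp
  ring

theorem pd_pd_nonpos_of_isMax {f : EuclideanSpace ℝ (Fin d) → ℝ} (hf : ContDiff ℝ 2 f)
    {x : EuclideanSpace ℝ (Fin d)} (hx : ∀ y, f y ≤ f x) (i : Fin d) : pd i (pd i f) x ≤ 0 := by
  by_contra! hpos
  obtain ⟨f1, f2⟩ := contDiff_two_derivs hf
  rw [pd_pd_eq f1 (f2 x) i] at hpos
  set e : EuclideanSpace ℝ (Fin d) := EuclideanSpace.single i 1
  have hline : ∀ t : ℝ, HasDerivAt (fun t : ℝ => x + t • e) e t := fun t => by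
    simpa using ((hasDerivAt_id t).smul_const e).const_add x
  have g1 : ∀ t, HasDerivAt (fun t : ℝ => f (x + t • e)) (fderiv ℝ f (x + t • e) e) t := fun t =>
    (f1 _).comp_hasDerivAt t (hline t)
  have g2 : HasDerivAt (fun t : ℝ => fderiv ℝ f (x + t • e) e) (fderiv ℝ (fderiv ℝ f) x e e) 0 := by
    have a := (f2 (x + (0 : ℝ) • e)).comp_hasDerivAt 0 (hline 0)
    have b := a.clm_apply (hasDerivAt_const (0 : ℝ) e)
    simpa using b
  have gd : deriv (fun t : ℝ => f (x + t • e)) = fun t => fderiv ℝ f (x + t • e) e :=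
    funext fun t => (g1 t).deriv
  have hmax : ∀ t : ℝ, f (x + t • e) ≤ f (x + (0 : ℝ) • e) := fun t => by simpa using hx _
  have hmin : IsLocalMin (fun t : ℝ => f (x + t • e)) 0 := by
    refine isLocalMin_of_deriv_deriv_pos ?_ ?_ (g1 0).continuousAt
    · rw [gd, g2.deriv]; exact hpos
    · exact IsLocalMax.deriv_eq_zero (Eventually.of_forall hmax)
  have heq : (fun t : ℝ => f (x + t • e)) =ᶠ[𝓝 0] fun _ => f (x + (0 : ℝ) • e) := by
    filter_upwards [hmin] with t ht
    exact le_antisymm (hmax t) ht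
  have h3 := heq.deriv
  rw [gd] at h3
  have h4 := h3.deriv_eq
  rw [g2.deriv] at h4
  simp at h4
  linarith

theorem nonpos_of_lap_eq {l : ℝ} (hl : 0 < l) {D : EuclideanSpace ℝ (Fin d) → ℝ}
    (hD : ContDiff ℝ 2 D) (hg : LinGrowth D) (heq : ∀ x, lap D x = l * D x)
    (x : EuclideanSpace ℝ (Fin d)) : D x ≤ 0 := by
  obtain ⟨C, hC, hb⟩ := hg
  have hsq : ContDiff ℝ 2 (fun x : EuclideanSpace ℝ (Fin d) => ‖x‖ ^ 2) := contDiff_norm_sq ℝ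
  have hlsq : ∀ x : EuclideanSpace ℝ (Fin d), lap (fun x : EuclideanSpace ℝ (Fin d) => ‖x‖ ^ 2) x
      = 2 * d := fun x => by
    have := lap_radial (d := d) (f := fun s => s) (f' := fun _ => 1) (f'' := fun _ => 0)
      (fun s _ => hasDerivAt_id s) (fun s _ => hasDerivAt_const s 1) x
    simpa using this
  have key : ∀ η : ℝ, 0 < η → D x ≤ η * (2 * d / l + ‖x‖ ^ 2) := by
    intro η hη
    have hF : ContDiff ℝ 2 (fun x => D x - η * ‖x‖ ^ 2) := hD.sub (contDiff_const.mul hsq)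
    have htend : Tendsto (fun x => D x - η * ‖x‖ ^ 2) (cocompact _) atBot := by
      have h1 : Tendsto (fun r : ℝ => C * (1 + r) - η * r ^ 2) atTop atBot := by
        have : ∀ r : ℝ, C * (1 + r) - η * r ^ 2 = C + r * (C - η * r) := fun r => by ring
        simp_rw [this]
        refine tendsto_atBot_add_const_left _ _ (tendsto_id.atTop_mul_atBot₀ ?_)
        have h2 : Tendsto (fun r : ℝ => η * r) atTop atTop := tendsto_id.const_mul_atTop hη
        simpa [sub_eq_add_neg] using tendsto_atBot_add_const_left _ C (tendsto_neg_atTop_atBot.comp h2)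
      refine tendsto_atBot_mono (fun y => ?_) (h1.comp (tendsto_norm_cocompact_atTop))
      have := (le_abs_self _).trans (hb y)
      simp only [Function.comp]
      linarith
    obtain ⟨z, hz⟩ := hF.continuous.exists_forall_ge htend
    have h3 : lap (fun x => D x - η * ‖x‖ ^ 2) z ≤ 0 :=
      Finset.sum_nonpos fun i _ => pd_pd_nonpos_of_isMax hF hz i
    rw [lap_sub hD (contDiff_const.mul hsq), lap_const_mul hsq, hlsq, heq] at h3
    have h4 := hz x
    have h5 : D z ≤ η * (2 * d / l) := by
      rw [← mul_div_assoc, le_div_iff₀ hl]; linarith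
    have h6 : 0 ≤ η * ‖z‖ ^ 2 := by positivity
    linarith
  have h7 : Tendsto (fun η : ℝ => η * (2 * d / l + ‖x‖ ^ 2)) (𝓝[>] 0) (𝓝 (0 * (2 * d / l + ‖x‖ ^ 2))) :=
    ((tendsto_id.mul_const _).mono_left nhdsWithin_le_nhds)
  rw [zero_mul] at h7
  exact ge_of_tendsto h7 (eventually_nhdsWithin_of_forall fun η hη => key η hη)

theorem eq_zero_of_lap_eq {l : ℝ} (hl : 0 < l) {D : EuclideanSpace ℝ (Fin d) → ℝ}
    (hD : ContDiff ℝ 2 D) (hg : LinGrowth D) (heq : ∀ x, lap D x = l * D x)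
    (x : EuclideanSpace ℝ (Fin d)) : D x = 0 := by
  refine le_antisymm (nonpos_of_lap_eq hl hD hg heq x) ?_
  have := nonpos_of_lap_eq hl (contDiff_const.mul hD) (hg.const_mul (-1)) (fun x => by
    rw [lap_const_mul hD, heq]; ring) x
  linarith

theorem LinGrowth.res {l : ℝ} (hl : 0 < l) {h : EuclideanSpace ℝ (Fin d) → ℝ}
    (hg : LinGrowth h) : LinGrowth (res l h) := by
  obtain ⟨C, hC, hb⟩ := hg
  set M := ∫ z : EuclideanSpace ℝ (Fin d), (1 + ‖z‖) * ‖gk z‖ with hM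
  have hM0 : 0 ≤ M := MeasureTheory.integral_nonneg fun z => by positivity
  set J := ∫ σ in Ioi 0, σ * eta l σ * (1 + σ) with hJ
  have hi0 : MeasureTheory.IntegrableOn (fun σ => σ * eta l σ * (1 + σ)) (Ioi 0) := by
    refine ((mul_eta_integrableOn hl).add (sq_mul_eta_integrableOn hl)).congr
      (Eventually.of_forall fun σ => ?_)
    simp only [Pi.add_apply]; ring
  have hJ0 : 0 ≤ J := MeasureTheory.setIntegral_nonneg measurableSet_Ioi
    fun σ (hσ : 0 < σ) => by have := (eta_pos hl σ).le; positivity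
  have hgc := (gc_pos (E := EuclideanSpace ℝ (Fin d))).le
  refine ⟨(gc (EuclideanSpace ℝ (Fin d)))⁻¹ * (C * M * J), by positivity, fun x => ?_⟩
  rw [_root_.res, abs_mul, abs_of_nonneg (inv_nonneg.2 hgc), mul_assoc]
  refine mul_le_mul_of_nonneg_left ?_ (inv_nonneg.2 hgc)
  have h1 : C * M * J * (1 + ‖x‖) = ∫ σ in Ioi 0, (C * M * (1 + ‖x‖)) * (σ * eta l σ * (1 + σ)) := by
    rw [MeasureTheory.integral_const_mul]; ring
  rw [h1, ← Real.norm_eq_abs]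
  refine MeasureTheory.norm_integral_le_of_norm_le (MeasureTheory.Integrable.const_mul hi0 _)
    ((MeasureTheory.ae_restrict_iff' measurableSet_Ioi).2
      (Eventually.of_forall fun σ (hσ : 0 < σ) => ?_))
  have h3 : 0 ≤ σ * eta l σ := mul_nonneg hσ.le (eta_pos hl σ).le
  rw [norm_mul, Real.norm_of_nonneg h3]
  have h4 := avg_norm_le hC hb gk_decay gk_continuous σ x
  rw [abs_of_pos hσ] at h4
  calc _ ≤ σ * eta l σ * (C * (1 + ‖x‖ + σ) * M) := mul_le_mul_of_nonneg_left h4 h3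
    _ ≤ σ * eta l σ * (C * ((1 + ‖x‖) * (1 + σ)) * M) := by
      gcongr
      nlinarith [norm_nonneg x]
    _ = _ := by ring

theorem res_sub_lap {l : ℝ} (hl : 0 < l) {φ : EuclideanSpace ℝ (Fin d) → ℝ}
    (hφ : ContDiff ℝ 2 φ) (hg : LinGrowth φ) (hh : LocHolder (fun x => φ x - l⁻¹ * lap φ x))
    (hh' : LinGrowth (fun x => φ x - l⁻¹ * lap φ x)) (x : EuclideanSpace ℝ (Fin d)) :
    res l (fun x => φ x - l⁻¹ * lap φ x) x = φ x := by
  set f := fun x => φ x - l⁻¹ * lap φ x with hf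
  have hw : ContDiff ℝ 2 (res l f) := res_contDiff hl hh.continuous hh' (hh.locIncr hh')
  have hgr : LinGrowth (fun x => res l f x - φ x) := by
    have := (LinGrowth.res hl hh').add (hg.const_mul (-1))
    simpa [sub_eq_add_neg] using this
  have := eq_zero_of_lap_eq hl (hw.sub hφ) hgr (fun y => by
    rw [lap_sub hw hφ, res_lap hl hh hh']
    simp only [hf]
    field_simp
    ring) x
  linarith

end Laplacian

section Barriers
open Filter Topology

variable {d : ℕ}

/-- Weight functions controlling the approximation scheme at infinity. -/
structure Barrier (A ψ ω : EuclideanSpace ℝ (Fin d) → ℝ) (p c D L : ℝ) : Prop where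
  contDiff_ψ : ContDiff ℝ 3 ψ
  contDiff_ω : ContDiff ℝ 3 ω
  linGrowth_ψ : LinGrowth ψ
  linGrowth_ω : LinGrowth ω
  abs_lap_ψ : ∀ x, |lap ψ x| ≤ D
  abs_lap_ω : ∀ x, |lap ω x| ≤ D
  one_le : ∀ ε ∈ Icc (0 : ℝ) 1, ∀ x, 1 ≤ ψ x - ε * lap ψ x
  mul_lap_le : ∀ x, A x * lap ψ x ≤ c
  ω_pos : ∀ ε ∈ Icc (0 : ℝ) 1, ∀ x, 0 < ω x - ε * lap ω x
  ω_le : ∀ ε ∈ Icc (0 : ℝ) 1, ∀ x, ω x - ε * lap ω x ≤ D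
  source_le : ∀ ε ∈ Icc (0 : ℝ) 1, ∀ x b, 0 ≤ b → b ≤ A x →
    b * ((ψ x - ε * lap ψ x) ^ p / A x + |lap ψ x|) ≤ L * (ω x - ε * lap ω x) - b * lap ω x
  rpow_le : ∀ ε ∈ Icc (0 : ℝ) 1, ∀ x, (ψ x - ε * lap ψ x) ^ p ≤ D * A x
  small : ∀ η, 0 < η → ∃ x, ω x ≤ η * ψ x
  c_nonneg : 0 ≤ c
  L_nonneg : 0 ≤ L

theorem contDiff_pd {n : ℕ} {f : EuclideanSpace ℝ (Fin d) → ℝ} (hf : ContDiff ℝ (n + 1) f)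
    (i : Fin d) : ContDiff ℝ n (pd i f) :=
  (hf.fderiv_right (m := n) le_rfl).clm_apply contDiff_const

theorem contDiff_lap {f : EuclideanSpace ℝ (Fin d) → ℝ} (hf : ContDiff ℝ 3 f) :
    ContDiff ℝ 1 (lap f) := by
  refine ContDiff.sum fun i _ => ?_
  exact_mod_cast contDiff_pd (n := 1) (by
    exact_mod_cast contDiff_pd (n := 2) (by norm_num; exact hf) i) i

theorem contDiff_one_add_sq_rpow (δ : ℝ) : ContDiff ℝ 3
    (fun x : EuclideanSpace ℝ (Fin d) => (1 + ‖x‖ ^ 2) ^ (-δ)) :=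
  (contDiff_const.add (contDiff_norm_sq ℝ)).rpow_const_of_ne fun x => by positivity

theorem contDiff_log_one_add_sq : ContDiff ℝ 3
    (fun x : EuclideanSpace ℝ (Fin d) => Real.log (1 + ‖x‖ ^ 2)) :=
  (contDiff_const.add (contDiff_norm_sq ℝ)).log fun x => by positivity

theorem lap_one_add_sq_rpow (δ : ℝ) (x : EuclideanSpace ℝ (Fin d)) :
    lap (fun x : EuclideanSpace ℝ (Fin d) => (1 + ‖x‖ ^ 2) ^ (-δ)) x =
      δ * (1 + ‖x‖ ^ 2) ^ (-δ - 1) *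
        ((4 * (δ + 1) - 2 * d) - 4 * (δ + 1) / (1 + ‖x‖ ^ 2)) := by
  have hb : ∀ s : ℝ, 0 ≤ s → HasDerivAt (fun s : ℝ => 1 + s) 1 s := fun s _ =>
    (hasDerivAt_id s).const_add 1
  have := lap_radial (d := d) (f := fun s => (1 + s) ^ (-δ))
    (f' := fun s => -δ * (1 + s) ^ (-δ - 1)) (f'' := fun s => δ * (δ + 1) * (1 + s) ^ (-δ - 1 - 1))
    (fun s hs => by
      refine ((hb s hs).rpow_const (p := -δ) (Or.inl (by positivity))).congr_deriv ?_
      ring)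
    (fun s hs => by
      refine (((hb s hs).rpow_const (p := -δ - 1) (Or.inl (by positivity))).const_mul (-δ)).congr_deriv ?_
      ring) x
  rw [this, Real.rpow_sub_one (by positivity) (-δ - 1)]
  have : (1 + ‖x‖ ^ 2) ≠ 0 := by positivity
  field_simp
  ring

theorem lap_log_one_add_sq (x : EuclideanSpace ℝ (Fin d)) :
    lap (fun x : EuclideanSpace ℝ (Fin d) => Real.log (1 + ‖x‖ ^ 2)) x =
      (2 * d - 4) / (1 + ‖x‖ ^ 2) + 4 / (1 + ‖x‖ ^ 2) ^ 2 := by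
  have hb : ∀ s : ℝ, 0 ≤ s → HasDerivAt (fun s : ℝ => 1 + s) 1 s := fun s _ =>
    (hasDerivAt_id s).const_add 1
  have := lap_radial (d := d) (f := fun s => Real.log (1 + s))
    (f' := fun s => (1 + s)⁻¹) (f'' := fun s => -((1 + s) ^ 2)⁻¹)
    (fun s hs => by
      refine ((hb s hs).log (by positivity)).congr_deriv ?_
      ring)
    (fun s hs => by
      refine ((hb s hs).inv (by positivity)).congr_deriv ?_
      rw [neg_div, one_div]) x
  rw [this]
  have : (1 + ‖x‖ ^ 2) ≠ 0 := by positivity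
  field_simp
  ring

theorem lap_const (c : ℝ) (x : EuclideanSpace ℝ (Fin d)) :
    lap (fun _ : EuclideanSpace ℝ (Fin d) => c) x = 0 := by
  have := lap_radial (d := d) (f := fun _ => c) (f' := fun _ => 0) (f'' := fun _ => 0)
    (fun s _ => hasDerivAt_const s c) (fun s _ => hasDerivAt_const s 0) x
  simpa using this

theorem one_add_sq_rpow_le {m C : ℝ} (hC : 0 < C) {A : EuclideanSpace ℝ (Fin d) → ℝ}
    (hA : ∀ x, C * (1 + ‖x‖) ^ m ≤ A x) {k : ℝ} (hk0 : 0 ≤ k) (hk : 2 * k ≤ m)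
    (x : EuclideanSpace ℝ (Fin d)) : C * (1 + ‖x‖ ^ 2) ^ k ≤ A x := by
  refine le_trans (mul_le_mul_of_nonneg_left ?_ hC.le) (hA x)
  have h1 : (1 + ‖x‖ ^ 2) ≤ (1 + ‖x‖) ^ (2 : ℝ) := by
    rw [Real.rpow_two]; nlinarith [norm_nonneg x]
  calc (1 + ‖x‖ ^ 2) ^ k ≤ ((1 + ‖x‖) ^ (2 : ℝ)) ^ k :=
        Real.rpow_le_rpow (by positivity) h1 hk0
    _ = (1 + ‖x‖) ^ (2 * k) := by rw [← Real.rpow_mul (by positivity)]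
    _ ≤ (1 + ‖x‖) ^ m := Real.rpow_le_rpow_of_exponent_le (le_add_of_nonneg_right (norm_nonneg x)) hk

theorem exists_euclidean_norm_eq (hd : 0 < d) (r : ℝ) (hr : 0 ≤ r) :
    ∃ x : EuclideanSpace ℝ (Fin d), ‖x‖ = r := by
  refine ⟨EuclideanSpace.single ⟨0, hd⟩ r, ?_⟩
  rw [PiLp.norm_single, Real.norm_of_nonneg hr]

theorem barrier_three (hd : 3 ≤ d) {p m C : ℝ} (hm : 2 < m) (hC : 0 < C)
    {A : EuclideanSpace ℝ (Fin d) → ℝ} (hA : ∀ x, C * (1 + ‖x‖) ^ m ≤ A x) :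
    ∃ ψ ω c D L, Barrier A ψ ω p c D L := by
  obtain ⟨δ, hδ0, hδ1, hδ2⟩ : ∃ δ : ℝ, 0 < δ ∧ δ ≤ 1 / 4 ∧ 2 * (1 + δ) ≤ m :=
    ⟨min (1 / 4) ((m - 2) / 2), lt_min (by norm_num) (by linarith), min_le_left _ _, by
      linarith [min_le_right (1 / 4 : ℝ) ((m - 2) / 2)]⟩
  set θ : EuclideanSpace ℝ (Fin d) → ℝ := fun x => (1 + ‖x‖ ^ 2) ^ (-δ) with hθ
  set P : EuclideanSpace ℝ (Fin d) → ℝ := fun x => (1 + ‖x‖ ^ 2) ^ (-δ - 1) with hP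
  have hX : ∀ x : EuclideanSpace ℝ (Fin d), 1 ≤ 1 + ‖x‖ ^ 2 := fun x => by nlinarith [norm_nonneg x]
  have hd' : (3 : ℝ) ≤ d := by exact_mod_cast hd
  have hP0 : ∀ x, 0 < P x := fun x => by positivity
  have hP1 : ∀ x, P x ≤ 1 := fun x => Real.rpow_le_one_of_one_le_of_nonpos (hX x) (by linarith)
  have hθ0 : ∀ x, 0 < θ x := fun x => by positivity
  have hθ1 : ∀ x, θ x ≤ 1 := fun x => Real.rpow_le_one_of_one_le_of_nonpos (hX x) (by linarith)
  have hlθ : ∀ x, lap θ x ≤ -(δ * P x) := fun x => by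
    rw [lap_one_add_sq_rpow]
    have : 0 ≤ 4 * (δ + 1) / (1 + ‖x‖ ^ 2) := by positivity
    have h2 : 0 ≤ δ * P x := by have := hP0 x; positivity
    nlinarith
  have hlθ' : ∀ x, -(2 * d + 5) ≤ lap θ x := fun x => by
    rw [lap_one_add_sq_rpow]
    have h1 : 4 * (δ + 1) / (1 + ‖x‖ ^ 2) ≤ 4 * (δ + 1) := div_le_self (by positivity) (hX x)
    have h2 : 0 ≤ δ * P x := by have := hP0 x; positivity
    have h3 : δ * P x ≤ 1 := by nlinarith [hP1 x, hP0 x]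
    change -(2 * d + 5) ≤ δ * P x * _
    nlinarith
  have hA1 : ∀ x, C ≤ A x := fun x => by
    have := one_add_sq_rpow_le hC hA (k := 0) le_rfl (by linarith) x
    simpa using this
  have hAP : ∀ x, 1 ≤ C⁻¹ * P x * A x := fun x => by
    have := one_add_sq_rpow_le hC hA (k := 1 + δ) (by linarith) hδ2 x
    have h2 : P x * (1 + ‖x‖ ^ 2) ^ (1 + δ) = 1 := by
      rw [hP]; simp only
      rw [← Real.rpow_add (by positivity)]; ring_nf; simp
    calc 1 = C⁻¹ * P x * (C * (1 + ‖x‖ ^ 2) ^ (1 + δ)) := by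
          field_simp; rw [h2]
      _ ≤ _ := mul_le_mul_of_nonneg_left this (by have := hP0 x; positivity)
  set c1 := (C * δ)⁻¹ with hc1
  have hc10 : 0 < c1 := by positivity
  have hθc : ContDiff ℝ 3 θ := contDiff_one_add_sq_rpow δ
  have hlω : ∀ x, lap (fun x => c1 * θ x) x = c1 * lap θ x :=
    lap_const_mul (hθc.of_le (by norm_num)) c1
  refine ⟨fun _ => 1, fun x => c1 * θ x, 0, c1 * (2 * d + 6) + C⁻¹, 0, ?_⟩
  constructor
  · exact contDiff_const
  · exact contDiff_const.mul hθc
  · exact linGrowth_const 1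
  · exact linGrowth_of_bounded (M := c1) fun x => by
      rw [abs_of_pos (mul_pos hc10 (hθ0 x))]; nlinarith [hθ1 x]
  · intro x; rw [lap_const, abs_zero]; positivity
  · intro x
    rw [hlω, abs_mul, abs_of_pos hc10, abs_of_nonpos ((hlθ x).trans (by
      have := hP0 x; simp only [neg_nonpos]; positivity))]
    have : 0 < C⁻¹ := by positivity
    nlinarith [hlθ' x]
  · intro ε _ x; rw [lap_const]; simp
  · intro x; rw [lap_const]; simp
  · intro ε hε x
    rw [hlω]
    have : lap θ x ≤ 0 := (hlθ x).trans (by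
      have := hP0 x; simp only [neg_nonpos]; positivity)
    have h2 := mul_pos hc10 (hθ0 x)
    have h3 : 0 ≤ ε * (c1 * -lap θ x) :=
      mul_nonneg hε.1 (mul_nonneg hc10.le (by linarith))
    linarith
  · intro ε hε x
    rw [hlω]
    have h0 : 0 < C⁻¹ := by positivity
    have : -lap θ x ≤ 2 * d + 5 := by linarith [hlθ' x]
    have h1 : ε * -lap θ x ≤ 2 * d + 5 := by
      have : 0 ≤ -lap θ x := by
        have := hlθ x
        have := mul_pos hδ0 (hP0 x)
        linarith
      nlinarith [hε.1, hε.2]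
    nlinarith [hθ1 x]
  · intro ε hε x b hb0 hb
    rw [hlω, lap_const]
    have hA0 := hC.trans_le (hA1 x)
    have h1 : 1 / A x ≤ C⁻¹ * P x := by
      rw [div_le_iff₀ hA0]; exact hAP x
    have h2 : c1 * lap θ x ≤ - (C⁻¹ * P x) := by
      calc c1 * lap θ x ≤ c1 * -(δ * P x) := mul_le_mul_of_nonneg_left (hlθ x) hc10.le
        _ = _ := by rw [hc1]; field_simp
    simp only [mul_zero, sub_zero, Real.one_rpow, abs_zero, add_zero, zero_mul, zero_sub]
    nlinarith
  · intro ε hε x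
    rw [lap_const]
    simp only [mul_zero, sub_zero, Real.one_rpow]
    have h1 : C⁻¹ * C ≤ C⁻¹ * A x := mul_le_mul_of_nonneg_left (hA1 x) (by positivity)
    rw [inv_mul_cancel₀ hC.ne'] at h1
    have : 0 ≤ c1 * (2 * d + 6) * A x := by
      have := hC.trans_le (hA1 x); positivity
    linarith
  · intro η hη
    have ht : Tendsto (fun r : ℝ => c1 * (1 + r ^ 2) ^ (-δ)) atTop (𝓝 (c1 * 0)) := by
      refine ((tendsto_rpow_neg_atTop hδ0).comp ?_).const_mul c1
      exact tendsto_atTop_add_const_left _ _ (tendsto_pow_atTop two_ne_zero)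
    rw [mul_zero] at ht
    obtain ⟨r, hr, hr0⟩ := ((ht.eventually_le_const hη).and (eventually_ge_atTop 0)).exists
    obtain ⟨x, hx⟩ := exists_euclidean_norm_eq (d := d) (by omega) r hr0
    refine ⟨x, ?_⟩
    simp only [hθ, hx, mul_one]
    exact hr
  · exact le_rfl
  · exact le_rfl

end Barriers

section BarrierTwo
open Filter Topology

/-- `(12 + log X)² ≤ M X^δ` for `X ≥ 1`. -/
theorem exists_log_sq_le {δ : ℝ} (hδ : 0 < δ) :
    ∃ M : ℝ, 0 < M ∧ ∀ X : ℝ, 1 ≤ X → (12 + Real.log X) ^ 2 ≤ M * X ^ δ := by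
  refine ⟨(12 + 2 / δ) ^ 2, by positivity, fun X hX => ?_⟩
  have h0 : 0 < X := by linarith
  have h1 := Real.log_le_rpow_div h0.le (half_pos hδ)
  have h2 : 1 ≤ X ^ (δ / 2) := Real.one_le_rpow hX (by positivity)
  have h3 : X ^ δ = (X ^ (δ / 2)) ^ 2 := by
    rw [← Real.rpow_natCast, ← Real.rpow_mul h0.le]; congr 1; push_cast; ring
  rw [h3, ← mul_pow]
  have h4 := Real.log_nonneg hX
  refine pow_le_pow_left₀ (by positivity) ?_ 2
  calc 12 + Real.log X ≤ 12 * X ^ (δ / 2) + X ^ (δ / 2) / (δ / 2) := by linarith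
    _ = _ := by field_simp

theorem barrier_two {p m C : ℝ} (hp2 : p ≤ 2) (hm : 2 < m) (hC : 0 < C)
    {A : EuclideanSpace ℝ (Fin 2) → ℝ} (hAc : Continuous A) (hA : ∀ x, C * (1 + ‖x‖) ^ m ≤ A x) :
    ∃ ψ ω c D L, Barrier A ψ ω p c D L := by
  obtain ⟨δ, hδ0, hδ1, hδ2⟩ : ∃ δ : ℝ, 0 < δ ∧ δ ≤ 1 / 8 ∧ 2 * (1 + 2 * δ) ≤ m :=
    ⟨min (1 / 8) ((m - 2) / 4), lt_min (by norm_num) (by linarith), min_le_left _ _, by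
      linarith [min_le_right (1 / 8 : ℝ) ((m - 2) / 4)]⟩
  set X : EuclideanSpace ℝ (Fin 2) → ℝ := fun x => 1 + ‖x‖ ^ 2 with hXdef
  set θ : EuclideanSpace ℝ (Fin 2) → ℝ := fun x => (1 + ‖x‖ ^ 2) ^ (-δ) with hθ
  set P : EuclideanSpace ℝ (Fin 2) → ℝ := fun x => (1 + ‖x‖ ^ 2) ^ (-δ - 1) with hP
  set ℓ : EuclideanSpace ℝ (Fin 2) → ℝ := fun x => Real.log (1 + ‖x‖ ^ 2) with hℓ
  have hX : ∀ x, 1 ≤ X x := fun x => by simp only [hXdef]; nlinarith [norm_nonneg x]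
  have hP0 : ∀ x, 0 < P x := fun x => by positivity
  have hP1 : ∀ x, P x ≤ 1 := fun x => Real.rpow_le_one_of_one_le_of_nonpos (hX x) (by linarith)
  have hθ0 : ∀ x, 0 < θ x := fun x => by positivity
  have hθ1 : ∀ x, θ x ≤ 1 := fun x => Real.rpow_le_one_of_one_le_of_nonpos (hX x) (by linarith)
  have hℓ0 : ∀ x, 0 ≤ ℓ x := fun x => Real.log_nonneg (hX x)
  have hlθ : ∀ x, lap θ x = 4 * δ * P x * (δ - (1 + δ) / X x) := fun x => by
    rw [lap_one_add_sq_rpow]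
    simp only [hP, hXdef]
    push_cast
    ring
  have hlℓ : ∀ x, lap ℓ x = 4 / X x ^ 2 := fun x => by
    rw [lap_log_one_add_sq]
    simp only [hXdef]
    push_cast
    ring
  have hd1 : ∀ x, 0 < (1 + δ) / X x ∧ (1 + δ) / X x ≤ 1 + δ := fun x =>
    ⟨div_pos (by linarith) (by linarith [hX x]), div_le_self (by linarith) (hX x)⟩
  have hlθ_lo : ∀ x, -(9 / 16) * P x ≤ lap θ x := fun x => by
    rw [hlθ]
    have h1 := hP0 x
    have h2 : -(9 / 8) ≤ δ - (1 + δ) / X x := by linarith [(hd1 x).2]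
    have h3 : 4 * δ * P x ≤ 1 / 2 * P x := by nlinarith
    have h4 : 0 ≤ 4 * δ * P x := by positivity
    nlinarith
  have hlθ_hi : ∀ x, lap θ x ≤ P x := fun x => by
    rw [hlθ]
    have h1 := hP0 x
    have h2 : δ - (1 + δ) / X x ≤ 1 := by linarith [(hd1 x).1]
    have h3 : 4 * δ * P x ≤ 1 / 2 * P x := by nlinarith
    have h4 : 0 ≤ 4 * δ * P x := by positivity
    nlinarith
  have hX2 : ∀ x, 1 / X x ^ 2 = P x * X x ^ (δ - 1) := fun x => by
    have h0 : 0 < X x := by linarith [hX x]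
    change _ = X x ^ (-δ - 1) * _
    rw [← Real.rpow_add h0]
    have : -δ - 1 + (δ - 1) = -(2 : ℕ) := by push_cast; ring
    rw [this, Real.rpow_neg h0.le, Real.rpow_natCast, one_div]
  have hX2P : ∀ x, 1 / X x ^ 2 ≤ P x := fun x => by
    rw [hX2]
    exact mul_le_of_le_one_right (hP0 x).le
      (Real.rpow_le_one_of_one_le_of_nonpos (hX x) (by linarith))
  obtain ⟨X0, hX01, hX0⟩ : ∃ X0 : ℝ, 1 ≤ X0 ∧ ∀ x, X0 ≤ X x →
      2 * δ ^ 2 * P x ≤ lap θ x ∧ 4 / X x ^ 2 ≤ 2 * δ ^ 2 * P x := by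
    have ht1 : Tendsto (fun r : ℝ => (1 + δ) / r) atTop (𝓝 0) := tendsto_id.const_div_atTop _
    have ht2 : Tendsto (fun r : ℝ => r ^ (-(1 - δ))) atTop (𝓝 0) :=
      tendsto_rpow_neg_atTop (by linarith)
    obtain ⟨r, hr⟩ := eventually_atTop.1 ((ht1.eventually_le_const (half_pos hδ0)).and
      (ht2.eventually_le_const (show 0 < δ ^ 2 / 2 by positivity)))
    refine ⟨max 1 r, le_max_left _ _, fun x hx => ?_⟩
    obtain ⟨h1, h2⟩ := hr (X x) ((le_max_right _ _).trans hx)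
    have h0 := hP0 x
    constructor
    · rw [hlθ]
      have h4 : 0 ≤ 4 * δ * P x := by positivity
      nlinarith
    · have h3 := hX2 x
      rw [show δ - 1 = -(1 - δ) by ring] at h3
      have : 4 / X x ^ 2 = 4 * (1 / X x ^ 2) := by ring
      rw [this, h3]
      nlinarith
  have hA0 : ∀ x, 0 < A x := fun x => lt_of_lt_of_le (by positivity) (hA x)
  obtain ⟨M0, hM0, hM⟩ : ∃ M0 : ℝ, 0 < M0 ∧ ∀ x, X x < X0 → A x ≤ M0 := by
    obtain ⟨M, hM⟩ := (isCompact_closedBall (0 : EuclideanSpace ℝ (Fin 2))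
      X0).exists_bound_of_continuousOn hAc.continuousOn
    refine ⟨max M 1, by positivity, fun x hx => ?_⟩
    refine (le_abs_self _).trans ((hM x ?_).trans (le_max_left _ _))
    rw [mem_closedBall_zero_iff]
    simp only [hXdef] at hx
    nlinarith [sq_nonneg (‖x‖ - 1), norm_nonneg x]
  obtain ⟨M1, hM1, hlog⟩ := exists_log_sq_le hδ0
  have hθc : ContDiff ℝ 3 θ := contDiff_one_add_sq_rpow δ
  have hℓc : ContDiff ℝ 3 ℓ := contDiff_log_one_add_sq
  set ψ : EuclideanSpace ℝ (Fin 2) → ℝ := fun x => (7 + ℓ x) - θ x with hψ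
  have hlψ : ∀ x, lap ψ x = 4 / X x ^ 2 - lap θ x := fun x => by
    rw [lap_sub ((contDiff_const.add hℓc).of_le (by norm_num)) (hθc.of_le (by norm_num)),
      lap_add contDiff_const (hℓc.of_le (by norm_num)), lap_const, hlℓ, zero_add]
  have hlψP : ∀ x, |lap ψ x| ≤ 5 * P x := fun x => by
    rw [hlψ]
    have h1 : 4 / X x ^ 2 = 4 * (1 / X x ^ 2) := by ring
    have h2 := hX2P x
    have h3 : 0 ≤ 1 / X x ^ 2 := by positivity
    have := hlθ_lo x
    have := hlθ_hi x
    have := hP0 x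
    rw [h1, abs_le]
    constructor <;> linarith
  have hεψ : ∀ ε ∈ Icc (0 : ℝ) 1, ∀ x, |ε * lap ψ x| ≤ 5 := fun ε hε x => by
    rw [abs_mul, abs_of_nonneg hε.1]
    have := hlψP x
    have := hP1 x
    have := abs_nonneg (lap ψ x)
    nlinarith [hε.1, hε.2]
  have hεθ : ∀ ε ∈ Icc (0 : ℝ) 1, ∀ x, -(9 / 16) ≤ ε * lap θ x ∧ ε * lap θ x ≤ 1 := fun ε hε x => by
    have h1 := hlθ_lo x
    have h2 := hlθ_hi x
    have h3 := hP1 x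
    have h4 : -(9 / 16) ≤ lap θ x := by linarith
    have h5 : lap θ x ≤ 1 := by linarith
    constructor <;> nlinarith [hε.1, hε.2]
  have hone : ∀ ε ∈ Icc (0 : ℝ) 1, ∀ x, 1 ≤ ψ x - ε * lap ψ x := fun ε hε x => by
    have := (abs_le.1 (hεψ ε hε x)).2
    simp only [hψ] at this ⊢
    linarith [hℓ0 x, hθ1 x]
  have hpow : ∀ ε ∈ Icc (0 : ℝ) 1, ∀ x, (ψ x - ε * lap ψ x) ^ p ≤ M1 * X x ^ δ := fun ε hε x => by
    have h1 := hone ε hε x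
    have h2 := (abs_le.1 (hεψ ε hε x)).1
    calc (ψ x - ε * lap ψ x) ^ p ≤ (ψ x - ε * lap ψ x) ^ (2 : ℝ) :=
          Real.rpow_le_rpow_of_exponent_le h1 hp2
      _ = (ψ x - ε * lap ψ x) ^ 2 := Real.rpow_two _
      _ ≤ (12 + Real.log (X x)) ^ 2 := by
          refine pow_le_pow_left₀ (by linarith) ?_ 2
          have h3 : ψ x ≤ 7 + Real.log (X x) := by
            simp only [hψ]; linarith [hθ0 x]
          linarith
      _ ≤ _ := hlog _ (hX x)
  have hAP : ∀ x, X x ^ δ ≤ C⁻¹ * P x * A x := fun x => by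
    have h0 : 0 < X x := by linarith [hX x]
    have := one_add_sq_rpow_le hC hA (k := 1 + 2 * δ) (by linarith) hδ2 x
    have h2 : P x * X x ^ (1 + 2 * δ) = X x ^ δ := by
      change X x ^ (-δ - 1) * _ = _
      rw [← Real.rpow_add h0]; ring_nf
    calc X x ^ δ = C⁻¹ * P x * (C * X x ^ (1 + 2 * δ)) := by
          rw [← h2]; field_simp
      _ ≤ _ := mul_le_mul_of_nonneg_left this (by have := hP0 x; positivity)
  have hpowA : ∀ ε ∈ Icc (0 : ℝ) 1, ∀ x,
      (ψ x - ε * lap ψ x) ^ p / A x ≤ M1 * C⁻¹ * P x := fun ε hε x => by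
    rw [div_le_iff₀ (hA0 x)]
    have h1 := hpow ε hε x
    have h2 := mul_le_mul_of_nonneg_left (hAP x) hM1.le
    linarith
  set c1 := (M1 * C⁻¹ + 5) / (2 * δ ^ 2) with hc1
  have hc10 : 0 < c1 := by positivity
  have hlω : ∀ x, lap (fun x => c1 * (2 - θ x)) x = -(c1 * lap θ x) := fun x => by
    rw [lap_const_mul ((contDiff_const.sub hθc).of_le (by norm_num)),
      lap_sub contDiff_const (hθc.of_le (by norm_num)), lap_const]
    ring
  have hMC : 0 < M1 * C⁻¹ := by positivity
  have hωt : ∀ ε ∈ Icc (0 : ℝ) 1, ∀ x, c1 * (2 / 5) ≤ c1 * (2 - θ x) - ε * -(c1 * lap θ x) := by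
    intro ε hε x
    have h1 := (hεθ ε hε x).1
    have : c1 * (2 / 5) ≤ c1 * (2 - θ x + ε * lap θ x) :=
      mul_le_mul_of_nonneg_left (by linarith [hθ1 x]) hc10.le
    linarith
  set L := M0 * (M1 * C⁻¹ + 5 + c1) / (c1 * (2 / 5)) with hL
  have hL0 : 0 < L := by positivity
  refine ⟨ψ, fun x => c1 * (2 - θ x), M0 * 5, 5 + 3 * c1 + M1 * C⁻¹, L, ?_⟩
  constructor
  · exact (contDiff_const.add hℓc).sub hθc
  · exact contDiff_const.mul (contDiff_const.sub hθc)
  · refine ⟨8, by norm_num, fun x => ?_⟩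
    have h1 : 0 ≤ ψ x := by
      simp only [hψ]; linarith [hℓ0 x, hθ1 x]
    rw [abs_of_nonneg h1]
    have h2 : ℓ x ≤ 2 * ‖x‖ := by
      have : 1 + ‖x‖ ^ 2 ≤ (1 + ‖x‖) ^ 2 := by nlinarith [norm_nonneg x]
      calc ℓ x ≤ Real.log ((1 + ‖x‖) ^ 2) := Real.log_le_log (by positivity) this
        _ = 2 * Real.log (1 + ‖x‖) := by rw [Real.log_pow]; push_cast; ring
        _ ≤ 2 * ‖x‖ := by
          have := Real.log_le_sub_one_of_pos (show 0 < 1 + ‖x‖ by positivity)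
          linarith
    simp only [hψ]
    linarith [hθ0 x, norm_nonneg x]
  · exact linGrowth_of_bounded (M := 2 * c1) fun x => by
      rw [abs_of_nonneg (mul_nonneg hc10.le (by linarith [hθ1 x]))]; nlinarith [hθ0 x]
  · intro x
    linarith [hlψP x, hP1 x]
  · intro x
    rw [hlω, abs_neg, abs_mul, abs_of_pos hc10]
    have : |lap θ x| ≤ 1 := by
      rw [abs_le]; constructor <;> linarith [hlθ_lo x, hlθ_hi x, hP0 x, hP1 x]
    nlinarith
  · exact hone
  · intro x
    by_cases hx : X0 ≤ X x
    · obtain ⟨h1, h2⟩ := hX0 x hx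
      have : lap ψ x ≤ 0 := by rw [hlψ]; linarith
      nlinarith [hA0 x]
    · have h1 := hM x (not_le.1 hx)
      have h2 : lap ψ x ≤ 5 := (le_abs_self _).trans (by linarith [hlψP x, hP1 x])
      nlinarith [hA0 x]
  · intro ε hε x
    rw [hlω]
    exact lt_of_lt_of_le (by positivity) (hωt ε hε x)
  · intro ε hε x
    rw [hlω]
    have h1 := (hεθ ε hε x).2
    have h2 := hθ0 x
    have : c1 * (2 - θ x + ε * lap θ x) ≤ c1 * 3 :=
      mul_le_mul_of_nonneg_left (by linarith) hc10.le
    linarith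
  · intro ε hε x b hb0 hb
    rw [hlω]
    have h1 := hpowA ε hε x
    have h2 := hlψP x
    have h3 := hωt ε hε x
    have h5 : (ψ x - ε * lap ψ x) ^ p / A x + |lap ψ x| ≤ (M1 * C⁻¹ + 5) * P x := by linarith
    by_cases hx : X0 ≤ X x
    · obtain ⟨h6, -⟩ := hX0 x hx
      have h7 : (M1 * C⁻¹ + 5) * P x ≤ c1 * lap θ x := by
        calc (M1 * C⁻¹ + 5) * P x = c1 * (2 * δ ^ 2 * P x) := by rw [hc1]; field_simp
          _ ≤ _ := mul_le_mul_of_nonneg_left h6 hc10.le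
      have h8 : 0 ≤ L * (c1 * (2 - θ x) - ε * -(c1 * lap θ x)) :=
        mul_nonneg hL0.le (le_trans (by positivity) h3)
      have h9 := mul_le_mul_of_nonneg_left (h5.trans h7) hb0
      linarith
    · have h6 := hb.trans (hM x (not_le.1 hx))
      have h7 : M0 * (M1 * C⁻¹ + 5 + c1) = L * (c1 * (2 / 5)) := by
        rw [hL]; field_simp
      have h8 := mul_le_mul_of_nonneg_left h3 hL0.le
      have h9 : (ψ x - ε * lap ψ x) ^ p / A x + |lap ψ x| - c1 * lap θ x
          ≤ M1 * C⁻¹ + 5 + c1 := by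
        have h10 : -lap θ x ≤ 1 := by linarith [hlθ_lo x, hP0 x, hP1 x]
        have h11 : (M1 * C⁻¹ + 5) * P x ≤ M1 * C⁻¹ + 5 :=
          mul_le_of_le_one_right (by positivity) (hP1 x)
        nlinarith
      have h12 : b * ((ψ x - ε * lap ψ x) ^ p / A x + |lap ψ x| - c1 * lap θ x)
          ≤ M0 * (M1 * C⁻¹ + 5 + c1) :=
        (mul_le_mul_of_nonneg_left h9 hb0).trans (mul_le_mul_of_nonneg_right h6 (by positivity))
      linarith
  · intro ε hε x
    have h1 := hpowA ε hε x
    rw [div_le_iff₀ (hA0 x)] at h1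
    refine h1.trans (mul_le_mul_of_nonneg_right ?_ (hA0 x).le)
    have : M1 * C⁻¹ * P x ≤ M1 * C⁻¹ := mul_le_of_le_one_right hMC.le (hP1 x)
    linarith
  · intro η hη
    have ht : Tendsto (fun r : ℝ => η * Real.log (1 + r ^ 2)) atTop atTop := by
      refine (Real.tendsto_log_atTop.comp ?_).const_mul_atTop hη
      exact tendsto_atTop_add_const_left _ _ (tendsto_pow_atTop two_ne_zero)
    obtain ⟨r, hr, hr0⟩ := ((ht.eventually_ge_atTop (2 * c1)).and (eventually_ge_atTop 0)).exists
    obtain ⟨x, hx⟩ := exists_euclidean_norm_eq (d := 2) (by norm_num) r hr0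
    refine ⟨x, ?_⟩
    have h1 : η * ℓ x ≤ η * ψ x := mul_le_mul_of_nonneg_left (by
      simp only [hψ]; linarith [hθ1 x]) hη.le
    have h2 : 2 * c1 ≤ η * ℓ x := by simp only [hℓ, hx]; exact hr
    have := mul_pos hc10 (hθ0 x)
    linarith
  · positivity
  · exact hL0.le

theorem exists_barrier {d : ℕ} (hd : 2 ≤ d) {p m C : ℝ} (hp2 : p ≤ 2) (hm : 2 < m)
    (hC : 0 < C) {A : EuclideanSpace ℝ (Fin d) → ℝ} (hAc : Continuous A)
    (hA : ∀ x, C * (1 + ‖x‖) ^ m ≤ A x) : ∃ ψ ω c D L, Barrier A ψ ω p c D L := by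
  rcases hd.eq_or_lt with rfl | hd
  · exact barrier_two hp2 hm hC hAc hA
  · exact barrier_three hd hm hC hA

end BarrierTwo

section Iteration
open Filter Topology

variable {d : ℕ}

/-- A discrete maximum principle with a supersolution weight. -/
theorem abs_le_of_iteration {l h B L τ : ℝ} (hl : 0 < l) (hh : 0 ≤ h) (hB : 0 ≤ B) (hL : 0 ≤ L)
    (hτ : 0 ≤ τ) {ω lω b σ : EuclideanSpace ℝ (Fin d) → ℝ} (hωc : Continuous ω)
    (hωg : LinGrowth ω) (hω : ∀ x, l * (res l ω x - ω x) = lω x) (hω0 : ∀ x, 0 ≤ ω x)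
    (hσ : ∀ x, σ x ≤ L * ω x - b x * lω x) (hσ0 : ∀ x, 0 ≤ σ x) (hb : ∀ x, 0 ≤ b x)
    {f q : ℕ → EuclideanSpace ℝ (Fin d) → ℝ} {K : ℕ} (hfc : ∀ k ≤ K, Continuous (f k))
    (hfg : ∀ k ≤ K, LinGrowth (f k))
    (hstep : ∀ k < K, ∀ x, |f (k + 1) x - ((1 - h * b x * l - h * q k x) * f k x +
      h * b x * l * res l (f k) x)| ≤ h * τ * σ x)
    (hq : ∀ k < K, ∀ x, -B ≤ q k x) (hcoef : ∀ k < K, ∀ x, 0 ≤ 1 - h * b x * l - h * q k x)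
    (h0 : ∀ x, |f 0 x| ≤ τ * ω x) :
    ∀ k ≤ K, ∀ x, |f k x| ≤ τ * (1 + (B + L) * h) ^ k * ω x := by
  intro k
  induction k with
  | zero => intro _ x; simpa using h0 x
  | succ k ih =>
    intro hk x
    have ih := ih (by omega)
    set μ := τ * (1 + (B + L) * h) ^ k with hμ
    have hr : 1 ≤ 1 + (B + L) * h := by nlinarith [mul_nonneg (add_nonneg hB hL) hh]
    have hμτ : τ ≤ μ := le_mul_of_one_le_right hτ (one_le_pow₀ hr)
    have hμ0 : 0 ≤ μ := hτ.trans hμτ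
    have hR : |res l (f k) x| ≤ μ * res l ω x := by
      rw [← res_const_mul]
      exact abs_res_le hl (hfc k (by omega)) (hfg k (by omega)) (continuous_const.mul hωc)
        (hωg.const_mul μ) ih x
    have h1 := abs_le.1 (hstep k (by omega) x)
    have h2 : |(1 - h * b x * l - h * q k x) * f k x + h * b x * l * res l (f k) x| ≤
        (1 - h * b x * l - h * q k x) * (μ * ω x) + h * b x * l * (μ * res l ω x) := by
      refine (abs_add_le _ _).trans (add_le_add ?_ ?_)
      · rw [abs_mul, abs_of_nonneg (hcoef k (by omega) x)]
        exact mul_le_mul_of_nonneg_left (ih x) (hcoef k (by omega) x)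
      · have : 0 ≤ h * b x * l := mul_nonneg (mul_nonneg hh (hb x)) hl.le
        rw [abs_mul, abs_of_nonneg this]
        exact mul_le_mul_of_nonneg_left hR this
    have h3 : h * τ * σ x ≤ h * μ * (L * ω x - b x * lω x) :=
      (mul_le_mul_of_nonneg_right (mul_le_mul_of_nonneg_left hμτ hh) (hσ0 x)).trans
        (mul_le_mul_of_nonneg_left (hσ x) (mul_nonneg hh hμ0))
    have h4 : l * res l ω x = l * ω x + lω x := by linarith [hω x]
    have h5 : h * b x * l * (μ * res l ω x) = h * b x * μ * (l * ω x + lω x) := by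
      rw [← h4]; ring
    have h6 : -(h * q k x) * (μ * ω x) ≤ h * B * (μ * ω x) := by
      have h7 : 0 ≤ h * (μ * ω x) := mul_nonneg hh (mul_nonneg hμ0 (hω0 x))
      nlinarith [hq k (by omega) x]
    have h8 : τ * (1 + (B + L) * h) ^ (k + 1) * ω x = μ * ω x + h * B * (μ * ω x) + h * L * (μ * ω x) := by
      rw [pow_succ, hμ]; ring
    have h9 := abs_le.1 h2
    rw [h8, abs_le]
    constructor <;> nlinarith

/-- The resolvent identity relating `res l` and `res 1`. -/
theorem res_eq_res_one {l : ℝ} (hl : 0 < l) {v : EuclideanSpace ℝ (Fin d) → ℝ}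
    (hv : LocHolder v) (hg : LinGrowth v) (x : EuclideanSpace ℝ (Fin d)) :
    res l v x = res 1 (fun x => res l v x - l * (res l v x - v x)) x := by
  have hw : ContDiff ℝ 2 (res l v) := res_contDiff hl hv.continuous hg (hv.locIncr hg)
  have hwg : LinGrowth (res l v) := LinGrowth.res hl hg
  have hwh : LocHolder (res l v) := locHolder_of_contDiff (hw.of_le (by norm_num))
  have he : (fun x => res l v x - (1 : ℝ)⁻¹ * lap (res l v) x) =
      fun x => res l v x - l * (res l v x - v x) := by
    funext x; rw [res_lap hl hv hg]; ring
  rw [← res_sub_lap one_pos hw hwg (by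
    rw [he]; exact hwh.sub ((hwh.sub hv).const_mul l)) (by
    rw [he]
    have := hwg.add ((hwg.add (hg.const_mul (-1))).const_mul (-l))
    convert this using 2
    ring) x, he]

end Iteration

section SchemeSection
open Filter Topology

/-- The data of the approximation scheme. -/
structure Setup (d : ℕ) where
  (A α β ψ ω : EuclideanSpace ℝ (Fin d) → ℝ)
  (S S1 S2 S3 : ℝ → ℝ)
  (p c D L B M a₀ : ℝ)
  hA : LocHolder A
  ha₀ : 0 < a₀
  hAa : ∀ x, a₀ ≤ A x
  hα : LocHolder α
  hα0 : ∀ x, 0 ≤ α x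
  hαM : ∀ x, α x ≤ M
  hβ : LocHolder β
  hβ0 : ∀ x, 0 ≤ β x
  hβB : ∀ x, β x ≤ B
  hp1 : 1 < p
  hp2 : p ≤ 2
  bar : Barrier A ψ ω p c D L
  hS : ∀ t, HasDerivAt S (S1 t) t
  hS1 : ∀ t, HasDerivAt S1 (S2 t) t
  hS2 : ∀ t, HasDerivAt S2 (S3 t) t
  S3_cont : Continuous S3
  S_zero : S 0 = 0
  S1_zero : S1 0 = 0
  S2_zero : S2 0 = 0
  S2_nonneg : ∀ t, 0 ≤ t → 0 ≤ S2 t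
  S_growth : ∀ t, 0 ≤ t → (B + c) * S t ≤ S1 t

theorem monotoneOn_of_hasDerivAt {f f' : ℝ → ℝ} (hf : ∀ t, HasDerivAt f (f' t) t)
    (h : ∀ t, 0 ≤ t → 0 ≤ f' t) : MonotoneOn f (Ici 0) :=
  monotoneOn_of_deriv_nonneg (convex_Ici 0) (fun t _ => (hf t).continuousAt.continuousWithinAt)
    (fun t _ => (hf t).differentiableAt.differentiableWithinAt) fun t ht => by
      rw [(hf t).deriv]
      rw [interior_Ici] at ht
      exact h t ht.le

namespace Setup
variable {d : ℕ} (s : Setup d)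

theorem S1_mono : MonotoneOn s.S1 (Ici 0) := monotoneOn_of_hasDerivAt s.hS1 s.S2_nonneg

theorem S1_nonneg {t : ℝ} (ht : 0 ≤ t) : 0 ≤ s.S1 t := by
  have := s.S1_mono (mem_Ici.2 le_rfl) (mem_Ici.2 ht) ht
  rwa [s.S1_zero] at this

theorem S_mono : MonotoneOn s.S (Ici 0) := monotoneOn_of_hasDerivAt s.hS fun _ => s.S1_nonneg

theorem S_nonneg {t : ℝ} (ht : 0 ≤ t) : 0 ≤ s.S t := by
  have := s.S_mono (mem_Ici.2 le_rfl) (mem_Ici.2 ht) ht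
  rwa [s.S_zero] at this

theorem S_add_le {t h : ℝ} (ht : 0 ≤ t) (hh : 0 < h) : s.S t + h * s.S1 t ≤ s.S (t + h) := by
  obtain ⟨r, hr, he⟩ := exists_hasDerivAt_eq_slope s.S s.S1 (a := t) (b := t + h) (by linarith)
    (fun r _ => (s.hS r).continuousAt.continuousWithinAt) fun r _ => s.hS r
  have h1 := s.S1_mono (mem_Ici.2 ht) (mem_Ici.2 (ht.trans hr.1.le)) hr.1.le
  rw [he, le_div_iff₀ (by linarith)] at h1
  linarith

/-- The weight `ψ - n⁻¹ Δψ`. -/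
noncomputable def pt (n : ℕ) (x : EuclideanSpace ℝ (Fin d)) : ℝ :=
  s.ψ x - (n : ℝ)⁻¹ * lap s.ψ x

/-- The weight `ω - n⁻¹ Δω`. -/
noncomputable def ot (n : ℕ) (x : EuclideanSpace ℝ (Fin d)) : ℝ :=
  s.ω x - (n : ℝ)⁻¹ * lap s.ω x

/-- The truncated diffusion coefficient. -/
noncomputable def bb (n : ℕ) (x : EuclideanSpace ℝ (Fin d)) : ℝ := min (s.A x) n

/-- The reaction term for `v = S ψ - u`. -/
noncomputable def G (n : ℕ) (t w : ℝ) (x : EuclideanSpace ℝ (Fin d)) : ℝ :=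
  (s.A x)⁻¹ * (s.S1 t * s.pt n x + s.α x * (s.S t * s.pt n x - w) ^ s.p
    - s.β x * (s.S t * s.pt n x - w)) - s.S t * lap s.ψ x

/-- One explicit Euler step. -/
noncomputable def step (n : ℕ) (h t : ℝ) (v : EuclideanSpace ℝ (Fin d) → ℝ)
    (x : EuclideanSpace ℝ (Fin d)) : ℝ :=
  v x + h * s.bb n x * (n * (res n v x - v x) + s.G n t (v x) x)

/-- The explicit Euler scheme. -/
noncomputable def sol (n : ℕ) (h : ℝ) : ℕ → EuclideanSpace ℝ (Fin d) → ℝ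
  | 0 => fun _ => 0
  | k + 1 => s.step n h (k * h) (sol n h k)

/-- The step size restriction making the scheme monotone. -/
def Adm (n : ℕ) (h : ℝ) : Prop :=
  1 ≤ n ∧ 0 < h ∧ h * (n * n + s.M * s.p * s.S n ^ (s.p - 1) * (n * s.D)) ≤ 1

variable {n : ℕ} {h : ℝ}

theorem inv_mem (hn : 1 ≤ n) : (n : ℝ)⁻¹ ∈ Icc (0 : ℝ) 1 :=
  ⟨by positivity, inv_le_one_of_one_le₀ (by exact_mod_cast hn)⟩

theorem A_pos (x : EuclideanSpace ℝ (Fin d)) : 0 < s.A x := s.ha₀.trans_le (s.hAa x)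

theorem M_nonneg : 0 ≤ s.M := (s.hα0 0).trans (s.hαM 0)

theorem B_nonneg : 0 ≤ s.B := (s.hβ0 0).trans (s.hβB 0)

theorem D_nonneg : 0 ≤ s.D := (abs_nonneg _).trans (s.bar.abs_lap_ψ 0)

theorem bb_nonneg (x : EuclideanSpace ℝ (Fin d)) : 0 ≤ s.bb n x :=
  le_min (s.A_pos x).le n.cast_nonneg

theorem bb_le (x : EuclideanSpace ℝ (Fin d)) : s.bb n x ≤ n := min_le_right _ _

theorem bb_le_A (x : EuclideanSpace ℝ (Fin d)) : s.bb n x ≤ s.A x := min_le_left _ _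

theorem bb_mul_inv_le (x : EuclideanSpace ℝ (Fin d)) : s.bb n x * (s.A x)⁻¹ ≤ 1 := by
  rw [← div_eq_mul_inv, div_le_one (s.A_pos x)]; exact s.bb_le_A x

theorem bb_mul_inv_nonneg (x : EuclideanSpace ℝ (Fin d)) : 0 ≤ s.bb n x * (s.A x)⁻¹ :=
  mul_nonneg (s.bb_nonneg x) (inv_nonneg.2 (s.A_pos x).le)

theorem one_le_pt (hn : 1 ≤ n) (x : EuclideanSpace ℝ (Fin d)) : 1 ≤ s.pt n x :=
  s.bar.one_le _ (inv_mem hn) x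

theorem pt_rpow_le (hn : 1 ≤ n) (x : EuclideanSpace ℝ (Fin d)) : s.pt n x ^ s.p ≤ s.D * s.A x :=
  s.bar.rpow_le _ (inv_mem hn) x

theorem ot_pos (hn : 1 ≤ n) (x : EuclideanSpace ℝ (Fin d)) : 0 < s.ot n x :=
  s.bar.ω_pos _ (inv_mem hn) x

theorem ot_le (hn : 1 ≤ n) (x : EuclideanSpace ℝ (Fin d)) : s.ot n x ≤ s.D :=
  s.bar.ω_le _ (inv_mem hn) x

theorem p_sub_one_pos : 0 < s.p - 1 := by linarith [s.hp1]

theorem pt_le_rpow (hn : 1 ≤ n) (x : EuclideanSpace ℝ (Fin d)) : s.pt n x ≤ s.pt n x ^ s.p := by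
  have := Real.rpow_le_rpow_of_exponent_le (s.one_le_pt hn x) s.hp1.le
  rwa [Real.rpow_one] at this

theorem pt_rpow_sub_one_mul (hn : 1 ≤ n) (x : EuclideanSpace ℝ (Fin d)) :
    s.pt n x ^ (s.p - 1) * s.pt n x = s.pt n x ^ s.p := by
  have := s.one_le_pt hn x
  rw [Real.rpow_sub_one (by positivity), div_mul_cancel₀ _ (by positivity)]

theorem pt_rpow_sub_one_le (hn : 1 ≤ n) (x : EuclideanSpace ℝ (Fin d)) :
    s.pt n x ^ (s.p - 1) ≤ s.pt n x ^ s.p :=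
  Real.rpow_le_rpow_of_exponent_le (s.one_le_pt hn x) (by linarith)

theorem bb_pt_le (hn : 1 ≤ n) (x : EuclideanSpace ℝ (Fin d)) :
    s.bb n x * (s.A x)⁻¹ * s.pt n x ^ (s.p - 1) ≤ n * s.D := by
  have h1 := (s.pt_rpow_sub_one_le hn x).trans (s.pt_rpow_le hn x)
  calc _ ≤ s.bb n x * (s.A x)⁻¹ * (s.D * s.A x) :=
        mul_le_mul_of_nonneg_left h1 (s.bb_mul_inv_nonneg x)
    _ = s.bb n x * s.D := by have := (s.A_pos x).ne'; field_simp
    _ ≤ _ := mul_le_mul_of_nonneg_right (s.bb_le x) s.D_nonneg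

theorem pt_contDiff : ContDiff ℝ 1 (s.pt n) :=
  (s.bar.contDiff_ψ.of_le (by norm_num)).sub (contDiff_const.mul (contDiff_lap s.bar.contDiff_ψ))

theorem ot_contDiff : ContDiff ℝ 1 (s.ot n) :=
  (s.bar.contDiff_ω.of_le (by norm_num)).sub (contDiff_const.mul (contDiff_lap s.bar.contDiff_ω))

theorem pt_linGrowth : LinGrowth (s.pt n) := by
  have := s.bar.linGrowth_ψ.add ((linGrowth_of_bounded s.bar.abs_lap_ψ).const_mul (-(n : ℝ)⁻¹))
  convert this using 2
  rw [pt]; ring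

theorem ot_linGrowth : LinGrowth (s.ot n) := by
  have := s.bar.linGrowth_ω.add ((linGrowth_of_bounded s.bar.abs_lap_ω).const_mul (-(n : ℝ)⁻¹))
  convert this using 2
  rw [ot]; ring

theorem res_pt (hn : 1 ≤ n) (x : EuclideanSpace ℝ (Fin d)) : res n (s.pt n) x = s.ψ x :=
  res_sub_lap (by exact_mod_cast hn) (s.bar.contDiff_ψ.of_le (by norm_num)) s.bar.linGrowth_ψ
    (locHolder_of_contDiff s.pt_contDiff) s.pt_linGrowth x

theorem res_ot (hn : 1 ≤ n) (x : EuclideanSpace ℝ (Fin d)) : res n (s.ot n) x = s.ω x :=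
  res_sub_lap (by exact_mod_cast hn) (s.bar.contDiff_ω.of_le (by norm_num)) s.bar.linGrowth_ω
    (locHolder_of_contDiff s.ot_contDiff) s.ot_linGrowth x

theorem mul_res_pt (hn : 1 ≤ n) (x : EuclideanSpace ℝ (Fin d)) :
    n * (res n (s.pt n) x - s.pt n x) = lap s.ψ x := by
  have : (n : ℝ) ≠ 0 := by positivity
  rw [s.res_pt hn, pt]; field_simp; ring

theorem mul_res_ot (hn : 1 ≤ n) (x : EuclideanSpace ℝ (Fin d)) :
    n * (res n (s.ot n) x - s.ot n x) = lap s.ω x := by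
  have : (n : ℝ) ≠ 0 := by positivity
  rw [s.res_ot hn, ot]; field_simp; ring

theorem bb_locHolder : LocHolder (s.bb n) := by
  refine s.hA.comp (S := univ) (F := fun a => min a n) (fun _ => mem_univ _)
    fun M _ => ⟨1, zero_le_one, fun a _ b _ _ _ => ?_⟩
  rw [one_mul]
  simpa using abs_min_sub_min_le_max a n b n

theorem linGrowth_of_le {v : EuclideanSpace ℝ (Fin d) → ℝ} {r : ℝ}
    (hv : ∀ x, 0 ≤ v x ∧ v x ≤ r * s.pt n x) : LinGrowth v := by
  obtain ⟨C, hC, hb⟩ := s.pt_linGrowth (n := n).const_mul r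
  exact ⟨C, hC, fun y => by
    rw [abs_of_nonneg (hv y).1]
    exact (hv y).2.trans ((le_abs_self _).trans (hb y))⟩

theorem res_locHolder {l : ℝ} (hl : 0 < l) {v : EuclideanSpace ℝ (Fin d) → ℝ} (hv : LocHolder v)
    (hg : LinGrowth v) : LocHolder (res l v) :=
  locHolder_of_contDiff ((res_contDiff hl hv.continuous hg (hv.locIncr hg)).of_le (by norm_num))

theorem G_locHolder {t : ℝ} {v : EuclideanSpace ℝ (Fin d) → ℝ} (hv : LocHolder v)
    (hu : ∀ x, v x ≤ s.S t * s.pt n x) : LocHolder (fun x => s.G n t (v x) x) := by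
  have hpt : LocHolder (s.pt n) := locHolder_of_contDiff s.pt_contDiff
  have h1 : LocHolder (fun x => s.S t * s.pt n x - v x) := (hpt.const_mul _).sub hv
  have h2 := h1.rpow s.hp1.le fun x => sub_nonneg.2 (hu x)
  exact ((s.hA.inv s.ha₀ s.hAa).mul (((hpt.const_mul _).add (s.hα.mul h2)).sub
    (s.hβ.mul h1))).sub ((locHolder_of_contDiff (contDiff_lap s.bar.contDiff_ψ)).const_mul _)

variable {s}

theorem Adm.pos (ha : s.Adm n h) : (0 : ℝ) < n := by exact_mod_cast ha.1

theorem Adm.coef {t : ℝ} (ha : s.Adm n h) (ht0 : 0 ≤ t) (ht : t ≤ n)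
    (x : EuclideanSpace ℝ (Fin d)) : 0 ≤ 1 - h * s.bb n x * n -
      h * (s.bb n x * (s.A x)⁻¹ * (s.α x * (s.p * (s.S t * s.pt n x) ^ (s.p - 1)))) := by
  obtain ⟨hn, hh, hle⟩ := ha
  have h1 : h * s.bb n x * n ≤ h * (n * n) := by
    rw [mul_assoc]
    exact mul_le_mul_of_nonneg_left (mul_le_mul_of_nonneg_right (s.bb_le x) n.cast_nonneg) hh.le
  have h2 : s.bb n x * (s.A x)⁻¹ * (s.α x * (s.p * (s.S t * s.pt n x) ^ (s.p - 1))) ≤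
      s.M * s.p * s.S n ^ (s.p - 1) * (n * s.D) := by
    have hpt := s.one_le_pt hn x
    have hp0 : 0 ≤ s.p := by linarith [s.hp1]
    rw [Real.mul_rpow (s.S_nonneg ht0) (by linarith)]
    have h3 : s.S t ^ (s.p - 1) ≤ s.S n ^ (s.p - 1) :=
      Real.rpow_le_rpow (s.S_nonneg ht0) (s.S_mono ht0 (mem_Ici.2 (ht0.trans ht)) ht)
        s.p_sub_one_pos.le
    have h4 := s.bb_pt_le hn x
    have h5 := s.bb_mul_inv_nonneg (n := n) x
    have h6 : 0 ≤ s.S t ^ (s.p - 1) := Real.rpow_nonneg (s.S_nonneg ht0) _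
    have h7 : 0 ≤ s.pt n x ^ (s.p - 1) := Real.rpow_nonneg (by linarith) _
    calc _ = s.α x * s.p * s.S t ^ (s.p - 1) *
          (s.bb n x * (s.A x)⁻¹ * s.pt n x ^ (s.p - 1)) := by ring
      _ ≤ _ := by
        have := s.hα0 x
        have := s.hαM x
        have := s.M_nonneg
        have := h6.trans h3
        gcongr
  have h8 := mul_le_mul_of_nonneg_left h2 hh.le
  linarith

theorem Adm.inv (ha : s.Adm n h) {k : ℕ} : k * h ≤ n → LocHolder (s.sol n h k) ∧
    ∀ x, 0 ≤ s.sol n h k x ∧ s.sol n h k x ≤ s.S (k * h) * s.pt n x := by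
  have hn := ha.1
  have hh := ha.2.1
  have hn0 := ha.pos
  induction k with
  | zero =>
    intro _
    refine ⟨LocHolder.const 0, fun x => ⟨le_rfl, ?_⟩⟩
    simp [sol, s.S_zero]
  | succ k ih =>
    intro hk
    push_cast at hk
    have hk' : (k : ℝ) * h ≤ n := by linarith
    obtain ⟨hH, hbd⟩ := ih hk'
    set v := s.sol n h k with hv
    set t : ℝ := k * h with ht
    have ht0 : 0 ≤ t := by positivity
    have hg : LinGrowth v := s.linGrowth_of_le hbd
    constructor
    · exact hH.add ((s.bb_locHolder.const_mul h).mul ((((res_locHolder hn0 hH hg).sub hH).const_mul _).add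
        (s.G_locHolder hH fun x => (hbd x).2)))
    · intro x
      have hstep : s.sol n h (k + 1) x =
          v x + h * s.bb n x * (n * (res n v x - v x) + s.G n t (v x) x) := rfl
      have hpt := s.one_le_pt hn x
      have hcoef := ha.coef ht0 hk' x
      have hb := s.bb_nonneg (n := n) x
      have hba := s.bb_mul_inv_nonneg (n := n) x
      have hba1 := s.bb_mul_inv_le (n := n) x
      have hA := s.A_pos x
      obtain ⟨hv0, hv1⟩ := hbd x
      have hR0 : 0 ≤ res n v x := by
        have := res_mono hn0 continuous_const (linGrowth_const 0) hH.continuous hg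
          (fun y => (hbd y).1) x
        rwa [res_const hn0] at this
      have hR1 : res n v x ≤ s.S t * s.ψ x := by
        rw [← s.res_pt hn, ← res_const_mul]
        exact res_mono hn0 hH.continuous hg (continuous_const.mul s.pt_contDiff.continuous)
          (s.pt_linGrowth.const_mul _) (fun y => (hbd y).2) x
      have hnψ : (n : ℝ) * (s.ψ x - s.pt n x) = lap s.ψ x := by
        rw [← s.res_pt hn]; exact s.mul_res_pt hn x
      set U := s.S t * s.pt n x with hU
      set a := s.bb n x * (s.A x)⁻¹ with ha'
      have hU0 : 0 ≤ U := mul_nonneg (s.S_nonneg ht0) (by linarith)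
      have hlip := abs_le.1 (abs_rpow_sub_le s.hp1.le (sub_nonneg.2 hv1) hU0 (by linarith : U - v x ≤ U) le_rfl)
      have hlip2 := abs_le.1 (abs_rpow_sub_le s.hp1.le (sub_nonneg.2 hv1) le_rfl (by linarith : U - v x ≤ U) hU0)
      rw [show U - v x - U = -v x by ring, abs_neg, abs_of_nonneg hv0] at hlip
      rw [sub_zero, abs_of_nonneg (sub_nonneg.2 hv1), Real.zero_rpow (by linarith [s.hp1]), sub_zero] at hlip2
      set Q := s.p * U ^ (s.p - 1) with hQ
      have hα := s.hα0 x
      have hβ := s.hβ0 x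
      have hGb : s.bb n x * s.G n t (v x) x = a * (s.S1 t * s.pt n x + s.α x * (U - v x) ^ s.p -
          s.β x * (U - v x)) - s.bb n x * s.S t * lap s.ψ x := by
        rw [G]; ring
      have hS0 := s.S_nonneg ht0
      constructor
      · have hG0 : 0 ≤ a * (s.S1 t * s.pt n x - s.β x * U) - s.bb n x * s.S t * lap s.ψ x := by
          have e1 : s.bb n x * s.S t * lap s.ψ x = a * (s.S t * (s.A x * lap s.ψ x)) := by
            rw [ha']; field_simp
          have e2 := mul_le_mul_of_nonneg_left (s.bar.mul_lap_le x) hS0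
          have e3 := s.S_growth t ht0
          have e4 := mul_le_mul_of_nonneg_left (s.hβB x) hU0
          have e5 : s.c * s.S t ≤ s.c * s.S t * s.pt n x :=
            le_mul_of_one_le_right (mul_nonneg s.bar.c_nonneg hS0) hpt
          have e6 := mul_le_mul_of_nonneg_right e3 (show 0 ≤ s.pt n x by linarith)
          rw [e1, ← mul_sub]
          refine mul_nonneg hba ?_
          rw [hU] at e4 ⊢
          nlinarith
        have hUp : 0 ≤ U ^ s.p := Real.rpow_nonneg hU0 _
        have hlow : -(Q * v x) ≤ (U - v x) ^ s.p := by linarith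
        have e7 := mul_le_mul_of_nonneg_left (mul_le_mul_of_nonneg_left hlow hα) hba
        have e8 : 0 ≤ a * (s.β x * v x) := mul_nonneg hba (mul_nonneg hβ hv0)
        have e9 : -(a * (s.α x * Q) * v x) ≤ s.bb n x * s.G n t (v x) x := by
          rw [hGb]; nlinarith
        have e10 := mul_le_mul_of_nonneg_left e9 hh.le
        have e11 := mul_nonneg hcoef hv0
        have e12 : 0 ≤ h * s.bb n x * n * res n v x := by positivity
        rw [hstep]
        linarith
      · have hw : 0 ≤ U - v x := sub_nonneg.2 hv1
        have e7 := mul_le_mul_of_nonneg_left (mul_le_mul_of_nonneg_left hlip2.2 hα) hba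
        have e8 : 0 ≤ a * (s.β x * (U - v x)) := mul_nonneg hba (mul_nonneg hβ hw)
        have hS1 := s.S1_nonneg ht0
        have e9 : s.bb n x * s.G n t (v x) x ≤ s.S1 t * s.pt n x + a * (s.α x * Q) * (U - v x)
            - s.bb n x * s.S t * lap s.ψ x := by
          have : a * (s.S1 t * s.pt n x) ≤ s.S1 t * s.pt n x :=
            mul_le_of_le_one_left (mul_nonneg hS1 (by linarith)) hba1
          rw [hGb]; nlinarith
        have e10 := mul_le_mul_of_nonneg_left e9 hh.le
        have e11 := mul_nonneg hcoef hw
        have e12 : h * s.bb n x * n * res n v x ≤ h * s.bb n x * n * (s.S t * s.ψ x) :=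
          mul_le_mul_of_nonneg_left hR1 (by positivity)
        have e13 : h * s.bb n x * n * (s.S t * s.ψ x) =
            h * s.bb n x * n * U + h * (s.bb n x * s.S t * lap s.ψ x) := by
          rw [← hnψ, hU]; ring
        have e14 := mul_le_mul_of_nonneg_right (s.S_add_le ht0 hh) (show 0 ≤ s.pt n x by linarith)
        have e15 : ((k + 1 : ℕ) : ℝ) * h = t + h := by push_cast; rw [ht]; ring
        rw [hstep, e15]
        linarith

end Setup
end SchemeSection

section SchemeBounds
open Filter Topology

theorem exists_lipschitz_of_hasDerivAt {f f' : ℝ → ℝ} (hf : ∀ t, HasDerivAt f (f' t) t)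
    (hc : Continuous f') (T : ℝ) : ∃ M : ℝ, 0 ≤ M ∧ ∀ r ∈ Icc 0 T, ∀ r' ∈ Icc 0 T,
      |f r - f r'| ≤ M * |r - r'| := by
  obtain ⟨M, hM⟩ := (isCompact_Icc (a := (0 : ℝ)) (b := T)).exists_bound_of_continuousOn
    hc.continuousOn
  refine ⟨|M|, abs_nonneg _, fun r hr r' hr' => ?_⟩
  exact (convex_Icc (0 : ℝ) T).norm_image_sub_le_of_norm_hasDerivWithin_le
    (fun t _ => (hf t).hasDerivWithinAt) (fun t ht => (hM t ht).trans (le_abs_self M)) hr' hr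

theorem exists_mean_value_rpow {p a b : ℝ} (hp : 1 ≤ p) (ha : 0 ≤ a) (hb : 0 ≤ b) :
    ∃ ξ, 0 ≤ ξ ∧ |ξ - a| ≤ |b - a| ∧ ξ ≤ max a b ∧ b ^ p - a ^ p = p * ξ ^ (p - 1) * (b - a) := by
  have key : ∀ a b : ℝ, 0 ≤ a → a < b →
      ∃ ξ, a < ξ ∧ ξ < b ∧ b ^ p - a ^ p = p * ξ ^ (p - 1) * (b - a) := by
    intro a b ha hab
    obtain ⟨ξ, hξ, he⟩ := exists_hasDerivAt_eq_slope (fun x : ℝ => x ^ p)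
      (fun x => p * x ^ (p - 1)) hab
      (fun x _ => (Real.hasDerivAt_rpow_const (Or.inr hp)).continuousAt.continuousWithinAt)
      fun x _ => Real.hasDerivAt_rpow_const (Or.inr hp)
    refine ⟨ξ, hξ.1, hξ.2, ?_⟩
    have he' : p * ξ ^ (p - 1) = (b ^ p - a ^ p) / (b - a) := he
    rw [he', div_mul_cancel₀ _ (sub_pos.2 hab).ne']
  rcases lt_trichotomy a b with h | h | h
  · obtain ⟨ξ, h1, h2, h3⟩ := key a b ha h
    refine ⟨ξ, ha.trans h1.le, ?_, le_max_of_le_right h2.le, h3⟩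
    rw [abs_of_pos (by linarith), abs_of_pos (by linarith)]; linarith
  · subst h
    exact ⟨a, ha, by simp, by simp, by simp⟩
  · obtain ⟨ξ, h1, h2, h3⟩ := key b a hb h
    refine ⟨ξ, hb.trans h1.le, ?_, le_max_of_le_left h2.le, by linarith⟩
    rw [abs_of_neg (by linarith), abs_of_neg (by linarith)]; linarith

open Classical in
/-- An intermediate point for the mean value theorem applied to `x ^ p`. -/
noncomputable def xi (p a b : ℝ) : ℝ :=
  if h : 1 ≤ p ∧ 0 ≤ a ∧ 0 ≤ b then (exists_mean_value_rpow h.1 h.2.1 h.2.2).choose else 0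

theorem xi_spec {p a b : ℝ} (hp : 1 ≤ p) (ha : 0 ≤ a) (hb : 0 ≤ b) :
    0 ≤ xi p a b ∧ |xi p a b - a| ≤ |b - a| ∧ xi p a b ≤ max a b ∧
      b ^ p - a ^ p = p * xi p a b ^ (p - 1) * (b - a) := by
  rw [xi, dif_pos ⟨hp, ha, hb⟩]
  exact (exists_mean_value_rpow hp ha hb).choose_spec

namespace Setup
variable {d : ℕ} (s : Setup d)

/-- The discrete time derivative of the scheme. -/
noncomputable def zz (n : ℕ) (h : ℝ) (k : ℕ) (x : EuclideanSpace ℝ (Fin d)) : ℝ :=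
  (s.sol n h (k + 1) x - s.sol n h k x) / h

/-- The approximation of the solution `u`. -/
noncomputable def uu (n : ℕ) (h : ℝ) (k : ℕ) (x : EuclideanSpace ℝ (Fin d)) : ℝ :=
  s.S (k * h) * s.pt n x - s.sol n h k x

/-- The divided difference of `u ^ p`. -/
noncomputable def cc (n : ℕ) (h : ℝ) (k : ℕ) (x : EuclideanSpace ℝ (Fin d)) : ℝ :=
  s.p * xi s.p (s.uu n h k x) (s.uu n h (k + 1) x) ^ (s.p - 1)

/-- The difference quotient of `S`. -/
noncomputable def dS (h : ℝ) (k : ℕ) : ℝ := (s.S ((k + 1 : ℕ) * h) - s.S (k * h)) / h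

/-- The difference quotient of `S'`. -/
noncomputable def dS1 (h : ℝ) (k : ℕ) : ℝ := (s.S1 ((k + 1 : ℕ) * h) - s.S1 (k * h)) / h

/-- The zeroth order coefficient in the recursion for the discrete time derivative. -/
noncomputable def qq (n : ℕ) (h : ℝ) (k : ℕ) (x : EuclideanSpace ℝ (Fin d)) : ℝ :=
  s.bb n x * (s.A x)⁻¹ * (s.α x * s.cc n h k x - s.β x)

/-- The source in the recursion for the discrete time derivative. -/
noncomputable def src (n : ℕ) (h : ℝ) (k : ℕ) (x : EuclideanSpace ℝ (Fin d)) : ℝ :=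
  s.bb n x * ((s.A x)⁻¹ * (s.dS1 h k * s.pt n x +
    (s.α x * s.cc n h k x - s.β x) * (s.dS h k * s.pt n x)) - s.dS h k * lap s.ψ x)

/-- The weight dominating all source terms. -/
noncomputable def wt (n : ℕ) (x : EuclideanSpace ℝ (Fin d)) : ℝ :=
  s.pt n x ^ s.p / s.A x + |lap s.ψ x|

variable {s} {n : ℕ} {h : ℝ}

theorem wt_nonneg (hn : 1 ≤ n) (x : EuclideanSpace ℝ (Fin d)) : 0 ≤ s.wt n x := by
  have := s.one_le_pt hn x
  have := s.A_pos x
  unfold wt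
  positivity

theorem wt_le (hn : 1 ≤ n) (x : EuclideanSpace ℝ (Fin d)) : s.wt n x ≤ 2 * s.D := by
  have h1 := s.pt_rpow_le hn x
  rw [← div_le_iff₀ (s.A_pos x)] at h1
  have := s.bar.abs_lap_ψ x
  rw [wt]; linarith

theorem abs_le_wt {X Y τ : ℝ} {x : EuclideanSpace ℝ (Fin d)}
    (hX : |X| ≤ τ * s.pt n x ^ s.p) (hY : |Y| ≤ τ) :
    |(s.A x)⁻¹ * X - Y * lap s.ψ x| ≤ τ * s.wt n x := by
  have hA := inv_pos.2 (s.A_pos x)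
  refine (abs_sub _ _).trans ?_
  rw [abs_mul, abs_mul, abs_of_pos hA, wt, mul_add]
  refine add_le_add ?_ (mul_le_mul_of_nonneg_right hY (abs_nonneg _))
  calc _ ≤ (s.A x)⁻¹ * (τ * s.pt n x ^ s.p) := mul_le_mul_of_nonneg_left hX hA.le
    _ = _ := by rw [div_eq_inv_mul]; ring

theorem abs_bb_mul_le {X τ : ℝ} {x : EuclideanSpace ℝ (Fin d)} (hX : |X| ≤ τ * s.wt n x) :
    |s.bb n x * X| ≤ τ * (s.bb n x * s.wt n x) := by
  rw [abs_mul, abs_of_nonneg (s.bb_nonneg x)]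
  have := mul_le_mul_of_nonneg_left hX (s.bb_nonneg (n := n) x)
  linarith

theorem Adm.iterate (ha : s.Adm n h) {T τ : ℝ} (hτ : 0 ≤ τ)
    {f q : ℕ → EuclideanSpace ℝ (Fin d) → ℝ} {K : ℕ} (hK : K * h ≤ T)
    (hfc : ∀ k ≤ K, LocHolder (f k)) (hfg : ∀ k ≤ K, LinGrowth (f k))
    (hstep : ∀ k < K, ∀ x, |f (k + 1) x - ((1 - h * s.bb n x * n - h * q k x) * f k x +
      h * s.bb n x * n * res n (f k) x)| ≤ h * (τ * (s.bb n x * s.wt n x)))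
    (hq : ∀ k < K, ∀ x, -s.B ≤ q k x)
    (hcoef : ∀ k < K, ∀ x, 0 ≤ 1 - h * s.bb n x * n - h * q k x)
    (h0 : ∀ x, |f 0 x| ≤ τ * s.ot n x) (x : EuclideanSpace ℝ (Fin d)) :
    |f K x| ≤ τ * Real.exp ((s.B + s.L) * T) * s.ot n x := by
  have hn := ha.1
  have h1 := abs_le_of_iteration ha.pos ha.2.1.le s.B_nonneg s.bar.L_nonneg hτ
    s.ot_contDiff.continuous s.ot_linGrowth (s.mul_res_ot hn) (fun x => (s.ot_pos hn x).le)
    (σ := fun x => s.bb n x * s.wt n x)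
    (fun x => s.bar.source_le _ (inv_mem hn) x _ (s.bb_nonneg x) (s.bb_le_A x))
    (fun x => mul_nonneg (s.bb_nonneg x) (wt_nonneg hn x)) s.bb_nonneg
    (fun k hk => (hfc k hk).continuous) hfg (fun k hk x => (hstep k hk x).trans_eq (by ring))
    hq hcoef h0 K le_rfl x
  refine h1.trans (mul_le_mul_of_nonneg_right (mul_le_mul_of_nonneg_left ?_ hτ) (s.ot_pos hn x).le)
  have hBL : 0 ≤ s.B + s.L := add_nonneg s.B_nonneg s.bar.L_nonneg
  calc (1 + (s.B + s.L) * h) ^ K ≤ Real.exp ((s.B + s.L) * h) ^ K := by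
        refine pow_le_pow_left₀ ?_ ?_ K
        · have := mul_nonneg hBL ha.2.1.le; linarith
        · linarith [Real.add_one_le_exp ((s.B + s.L) * h)]
    _ = Real.exp ((s.B + s.L) * (K * h)) := by rw [← Real.exp_nat_mul]; ring_nf
    _ ≤ _ := Real.exp_le_exp.2 (mul_le_mul_of_nonneg_left hK hBL)

theorem abs_G_le (hn : 1 ≤ n) {t T w : ℝ} (ht : 0 ≤ t) (htT : t ≤ T)
    {x : EuclideanSpace ℝ (Fin d)} (hw : 0 ≤ w) (hw' : w ≤ s.S t * s.pt n x) :
    |s.G n t w x| ≤ (s.S1 T + s.M * s.S T ^ s.p + s.B * s.S T + s.S T) * s.wt n x := by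
  have hpt := s.one_le_pt hn x
  have hptp := s.pt_le_rpow hn x
  have hT : 0 ≤ T := ht.trans htT
  have hS := s.S_nonneg ht
  have hST := s.S_mono (mem_Ici.2 ht) (mem_Ici.2 hT) htT
  have hS1 := s.S1_nonneg ht
  have hS1T := s.S1_mono (mem_Ici.2 ht) (mem_Ici.2 hT) htT
  have hM := s.M_nonneg
  have hB := s.B_nonneg
  have hpp : 0 ≤ s.S T ^ s.p := Real.rpow_nonneg (s.S_nonneg hT) _
  have hα := s.hα0 x
  have hβ := s.hβ0 x
  set u := s.S t * s.pt n x - w with hu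
  have hu0 : 0 ≤ u := sub_nonneg.2 hw'
  have hu1 : u ≤ s.S T * s.pt n x := by
    have := mul_le_mul_of_nonneg_right hST (show 0 ≤ s.pt n x by linarith)
    linarith
  have hup : u ^ s.p ≤ s.S T ^ s.p * s.pt n x ^ s.p := by
    rw [← Real.mul_rpow (s.S_nonneg hT) (by linarith)]
    exact Real.rpow_le_rpow hu0 hu1 (by linarith [s.hp1])
  have hup0 : 0 ≤ u ^ s.p := Real.rpow_nonneg hu0 _
  refine abs_le_wt ?_ ?_
  · have e1 : s.S1 t * s.pt n x ≤ s.S1 T * s.pt n x ^ s.p :=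
      mul_le_mul hS1T hptp (by linarith) (hS1.trans hS1T)
    have e2 : s.α x * u ^ s.p ≤ s.M * (s.S T ^ s.p * s.pt n x ^ s.p) :=
      mul_le_mul (s.hαM x) hup hup0 hM
    have e3 : s.β x * u ≤ s.B * (s.S T * s.pt n x ^ s.p) :=
      mul_le_mul (s.hβB x) (hu1.trans (mul_le_mul_of_nonneg_left hptp (hS.trans hST))) hu0 hB
    have e4 : 0 ≤ s.S1 t * s.pt n x := mul_nonneg hS1 (by linarith)
    have e5 := mul_nonneg hα hup0
    have e6 := mul_nonneg hβ hu0
    have e7 : 0 ≤ s.S T * s.pt n x ^ s.p := mul_nonneg (hS.trans hST) (by linarith)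
    rw [abs_le]
    constructor <;> nlinarith
  · rw [abs_of_nonneg hS]
    have := mul_nonneg hB (hS.trans hST)
    have := mul_nonneg hM hpp
    linarith

theorem Adm.sol_linGrowth (ha : s.Adm n h) {k : ℕ} (hk : k * h ≤ n) : LinGrowth (s.sol n h k) :=
  s.linGrowth_of_le (ha.inv hk).2

theorem Adm.time_nonneg (ha : s.Adm n h) (k : ℕ) : (0 : ℝ) ≤ k * h :=
  mul_nonneg k.cast_nonneg ha.2.1.le

theorem Adm.time_mono (ha : s.Adm n h) {j k : ℕ} (hjk : j ≤ k) : (j : ℝ) * h ≤ k * h :=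
  mul_le_mul_of_nonneg_right (by exact_mod_cast hjk) ha.2.1.le

theorem exists_abs_sol_le (s : Setup d) {T : ℝ} (hT : 0 ≤ T) : ∃ C : ℝ, 0 ≤ C ∧
    ∀ (n : ℕ) (h : ℝ), s.Adm n h → T ≤ n → ∀ k : ℕ, k * h ≤ T → ∀ x,
      |s.sol n h k x| ≤ C * s.ot n x := by
  set τ := s.S1 T + s.M * s.S T ^ s.p + s.B * s.S T + s.S T with hτ
  have hτ0 : 0 ≤ τ := by
    have := s.S_nonneg hT
    have := s.S1_nonneg hT
    have := s.M_nonneg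
    have := s.B_nonneg
    positivity
  refine ⟨τ * Real.exp ((s.B + s.L) * T), by positivity, fun n h ha hn k hk x => ?_⟩
  refine ha.iterate hτ0 (q := fun _ _ => 0) hk
    (fun j hj => (ha.inv (((ha.time_mono hj).trans hk).trans hn)).1)
    (fun j hj => ha.sol_linGrowth (((ha.time_mono hj).trans hk).trans hn)) (fun j hj x => ?_)
    (fun j hj x => by linarith [s.B_nonneg]) (fun j hj x => ?_) (fun x => ?_) x
  · have hjT := (ha.time_mono hj.le).trans hk
    have h1 := (ha.inv (hjT.trans hn)).2 x
    have h2 := abs_bb_mul_le (abs_G_le ha.1 (ha.time_nonneg j) hjT h1.1 h1.2)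
    have h3 := mul_le_mul_of_nonneg_left h2 ha.2.1.le
    rw [← abs_of_pos ha.2.1, ← abs_mul, abs_of_pos ha.2.1] at h3
    refine le_trans (le_of_eq ?_) h3
    congr 1
    rw [sol, step]; ring
  · have h1 := ha.coef (ha.time_nonneg j) (((ha.time_mono hj.le).trans hk).trans hn) x
    have hpt := s.one_le_pt ha.1 x
    have h2 : 0 ≤ h * (s.bb n x * (s.A x)⁻¹ * (s.α x * (s.p * (s.S (j * h) * s.pt n x) ^ (s.p - 1)))) := by
      have := ha.2.1.le
      have := s.bb_mul_inv_nonneg (n := n) x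
      have := s.hα0 x
      have := s.S_nonneg (ha.time_nonneg j)
      have : 0 ≤ s.p := by linarith [s.hp1]
      positivity
    linarith
  · simp only [sol, abs_zero]
    exact mul_nonneg hτ0 (s.ot_pos ha.1 x).le

theorem Adm.uu_mem (ha : s.Adm n h) {T : ℝ} (hT : T ≤ n) {k : ℕ} (hk : k * h ≤ T)
    (x : EuclideanSpace ℝ (Fin d)) : 0 ≤ s.uu n h k x ∧ s.uu n h k x ≤ s.S T * s.pt n x := by
  obtain ⟨h1, h2⟩ := (ha.inv (hk.trans hT)).2 x
  have h3 := s.S_mono (mem_Ici.2 (ha.time_nonneg k))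
    (mem_Ici.2 ((ha.time_nonneg k).trans hk)) hk
  have hpt := s.one_le_pt ha.1 x
  have := mul_le_mul_of_nonneg_right h3 (show 0 ≤ s.pt n x by linarith)
  rw [uu]
  constructor <;> linarith

theorem Adm.cc_mem (ha : s.Adm n h) {T : ℝ} (hT : T ≤ n) {k : ℕ} (hk : (k + 1 : ℕ) * h ≤ T)
    (x : EuclideanSpace ℝ (Fin d)) : 0 ≤ s.cc n h k x ∧
      s.cc n h k x ≤ s.p * (s.S T * s.pt n x) ^ (s.p - 1) := by
  have h1 := ha.uu_mem hT ((ha.time_mono k.le_succ).trans hk) x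
  have h2 := ha.uu_mem hT hk x
  obtain ⟨h3, -, h4, -⟩ := xi_spec s.hp1.le h1.1 h2.1
  have hp0 : 0 ≤ s.p := by linarith [s.hp1]
  refine ⟨mul_nonneg hp0 (Real.rpow_nonneg h3 _), mul_le_mul_of_nonneg_left ?_ hp0⟩
  exact Real.rpow_le_rpow h3 (h4.trans (max_le h1.2 h2.2)) s.p_sub_one_pos.le

theorem Adm.zz_locHolder (ha : s.Adm n h) {k : ℕ} (hk : (k + 1 : ℕ) * h ≤ n) :
    LocHolder (s.zz n h k) := by
  have := ((ha.inv hk).1.sub (ha.inv ((ha.time_mono k.le_succ).trans hk)).1).const_mul h⁻¹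
  convert this using 2
  rw [zz, div_eq_inv_mul]

theorem Adm.zz_linGrowth (ha : s.Adm n h) {k : ℕ} (hk : (k + 1 : ℕ) * h ≤ n) :
    LinGrowth (s.zz n h k) := by
  have := ((ha.sol_linGrowth hk).add ((ha.sol_linGrowth
    ((ha.time_mono k.le_succ).trans hk)).const_mul (-1))).const_mul h⁻¹
  convert this using 2
  rw [zz, div_eq_inv_mul]; ring

theorem Adm.zz_succ (ha : s.Adm n h) {k : ℕ} (hk : (k + 1 : ℕ) * h ≤ n)
    (x : EuclideanSpace ℝ (Fin d)) : s.zz n h (k + 1) x =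
      (1 - h * s.bb n x * n - h * s.qq n h k x) * s.zz n h k x +
        h * s.bb n x * n * res n (s.zz n h k) x + h * s.src n h k x := by
  have hk' := (ha.time_mono k.le_succ).trans hk
  have hh := ha.2.1.ne'
  have hR : h * res n (s.zz n h k) x = res n (s.sol n h (k + 1)) x - res n (s.sol n h k) x := by
    rw [← res_sub ha.pos (ha.inv hk).1.continuous (ha.sol_linGrowth hk)
      (ha.inv hk').1.continuous (ha.sol_linGrowth hk'), ← res_const_mul]
    congr 1
    funext y
    rw [zz]; field_simp
  have hu1 := (ha.uu_mem le_rfl hk x).1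
  have hu0 := (ha.uu_mem le_rfl hk' x).1
  obtain ⟨-, -, -, hξ⟩ := xi_spec s.hp1.le hu0 hu1
  have hz : s.sol n h (k + 1) x = s.sol n h k x + h * s.zz n h k x := by
    rw [zz]; field_simp; ring
  have hdS : s.S ((k + 1 : ℕ) * h) = s.S (k * h) + h * s.dS h k := by
    rw [dS]; field_simp; ring
  have hdS1 : s.S1 ((k + 1 : ℕ) * h) = s.S1 (k * h) + h * s.dS1 h k := by
    rw [dS1]; field_simp; ring
  have hu : s.uu n h (k + 1) x - s.uu n h k x = h * (s.dS h k * s.pt n x - s.zz n h k x) := by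
    rw [uu, uu, hz, hdS]; ring
  change _ = s.cc n h k x * _ at hξ
  rw [hu] at hξ
  have hG : s.G n ((k + 1 : ℕ) * h) (s.sol n h (k + 1) x) x - s.G n (k * h) (s.sol n h k x) x =
      h * ((s.A x)⁻¹ * (s.dS1 h k * s.pt n x + (s.α x * s.cc n h k x - s.β x) *
        (s.dS h k * s.pt n x - s.zz n h k x)) - s.dS h k * lap s.ψ x) := by
    have e1 : s.G n ((k + 1 : ℕ) * h) (s.sol n h (k + 1) x) x = (s.A x)⁻¹ * (s.S1 ((k + 1 : ℕ) * h) *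
      s.pt n x + s.α x * s.uu n h (k + 1) x ^ s.p - s.β x * s.uu n h (k + 1) x)
        - s.S ((k + 1 : ℕ) * h) * lap s.ψ x := rfl
    have e2 : s.G n (k * h) (s.sol n h k x) x = (s.A x)⁻¹ * (s.S1 (k * h) *
      s.pt n x + s.α x * s.uu n h k x ^ s.p - s.β x * s.uu n h k x)
        - s.S (k * h) * lap s.ψ x := rfl
    rw [e1, e2, hdS, hdS1, eq_add_of_sub_eq hξ, eq_add_of_sub_eq hu]
    ring
  have hs1 : s.sol n h (k + 1) x = s.sol n h k x + h * s.bb n x *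
    (n * (res n (s.sol n h k) x - s.sol n h k x) + s.G n (k * h) (s.sol n h k x) x) := rfl
  have hs2 : s.sol n h (k + 1 + 1) x = s.sol n h (k + 1) x + h * s.bb n x *
    (n * (res n (s.sol n h (k + 1)) x - s.sol n h (k + 1) x) +
      s.G n ((k + 1 : ℕ) * h) (s.sol n h (k + 1) x) x) := rfl
  have hmain : h * s.zz n h (k + 1) x = h * s.zz n h k x + h * s.bb n x *
      (n * (h * res n (s.zz n h k) x - h * s.zz n h k x) +
      h * ((s.A x)⁻¹ * (s.dS1 h k * s.pt n x + (s.α x * s.cc n h k x - s.β x) *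
        (s.dS h k * s.pt n x - s.zz n h k x)) - s.dS h k * lap s.ψ x)) := by
    rw [← hG, hR]
    have e3 : h * s.zz n h (k + 1) x = s.sol n h (k + 1 + 1) x - s.sol n h (k + 1) x := by
      rw [zz]; field_simp
    have e4 : h * s.zz n h k x = s.sol n h (k + 1) x - s.sol n h k x := by linarith
    rw [e3, e4]
    linear_combination hs2 - hs1
  have : h * s.zz n h (k + 1) x = h * ((1 - h * s.bb n x * n - h * s.qq n h k x) * s.zz n h k x +
        h * s.bb n x * n * res n (s.zz n h k) x + h * s.src n h k x) := by
    rw [hmain, qq, src]; ring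
  exact mul_left_cancel₀ hh this

end Setup
end SchemeBounds

section SchemeTime
open Filter Topology

theorem abs_rpow_sub_rpow_le {a b γ : ℝ} (ha : 0 ≤ a) (hb : 0 ≤ b) (hγ : 0 ≤ γ) (hγ1 : γ ≤ 1) :
    |a ^ γ - b ^ γ| ≤ |a - b| ^ γ := by
  have key : ∀ a b : ℝ, 0 ≤ a → a ≤ b → b ^ γ - a ^ γ ≤ (b - a) ^ γ := by
    intro a b ha hab
    have h1 : (a + (b - a)) ^ γ ≤ a ^ γ + (b - a) ^ γ := by
      exact_mod_cast NNReal.rpow_add_le_add_rpow ⟨a, ha⟩ ⟨b - a, sub_nonneg.2 hab⟩ hγ hγ1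
    rw [add_sub_cancel] at h1
    linarith
  rcases le_total a b with h | h
  · rw [abs_sub_comm, abs_of_nonneg (sub_nonneg.2 (Real.rpow_le_rpow ha h hγ)), abs_sub_comm,
      abs_of_nonneg (sub_nonneg.2 h)]
    exact key a b ha h
  · rw [abs_of_nonneg (sub_nonneg.2 (Real.rpow_le_rpow hb h hγ)), abs_of_nonneg (sub_nonneg.2 h)]
    exact key b a hb h

theorem slope_bounds {f f' : ℝ → ℝ} {M T : ℝ} (hf : ∀ t, HasDerivAt f (f' t) t)
    (hM : ∀ r ∈ Icc 0 T, ∀ r' ∈ Icc 0 T, |f' r - f' r'| ≤ M * |r - r'|) (h0 : f' 0 = 0)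
    (hM0 : 0 ≤ M) {a h : ℝ} (ha : 0 ≤ a) (hh : 0 < h) :
    (a + h ≤ T → |(f (a + h) - f a) / h| ≤ M * (a + h)) ∧
    ∀ e, 0 ≤ e → a + e + h ≤ T →
      |(f (a + e + h) - f (a + e)) / h - (f (a + h) - f a) / h| ≤ M * e := by
  constructor
  · intro haT
    obtain ⟨r, hr, he⟩ := exists_hasDerivAt_eq_slope f f' (a := a) (b := a + h) (by linarith)
      (fun r _ => (hf r).continuousAt.continuousWithinAt) fun r _ => hf r
    rw [add_sub_cancel_left] at he
    have hr0 : 0 ≤ r := ha.trans hr.1.le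
    have h1 := hM r ⟨hr0, hr.2.le.trans haT⟩ 0 ⟨le_rfl, by linarith⟩
    rw [← he]
    rw [h0, sub_zero, sub_zero, abs_of_nonneg hr0] at h1
    exact h1.trans (mul_le_mul_of_nonneg_left hr.2.le hM0)
  · intro e he0 heT
    obtain ⟨r, hr, he⟩ := exists_hasDerivAt_eq_slope (fun r => f (r + e) - f r)
      (fun r => f' (r + e) - f' r) (a := a) (b := a + h) (by linarith)
      (fun r _ => (((hf (r + e)).comp_add_const r e).sub (hf r)).continuousAt.continuousWithinAt)
      fun r _ => ((hf (r + e)).comp_add_const r e).sub (hf r)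
    have hr0 : 0 ≤ r := ha.trans hr.1.le
    have h1 := hM (r + e) ⟨by linarith, by linarith [hr.2]⟩ r ⟨hr0, by linarith [hr.2]⟩
    rw [show r + e - r = e by ring, abs_of_nonneg he0] at h1
    have h2 : (f (a + e + h) - f (a + e)) / h - (f (a + h) - f a) / h = f' (r + e) - f' r := by
      have he' : f' (r + e) - f' r = ((f (a + h + e) - f (a + h)) - (f (a + e) - f a)) /
        (a + h - a) := he
      rw [he', add_sub_cancel_left, ← sub_div, show a + h + e = a + e + h by ring]
      congr 1; ring
    rw [h2]; exact h1

namespace Setup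
variable {d : ℕ} {s : Setup d} {n : ℕ} {h : ℝ}

theorem exists_dS_bounds (s : Setup d) (T : ℝ) : ∃ M : ℝ, 0 ≤ M ∧ ∀ h : ℝ, 0 < h → ∀ k : ℕ,
    ((k + 1 : ℕ) * h ≤ T → |s.dS h k| ≤ M * ((k + 1 : ℕ) * h) ∧
      |s.dS1 h k| ≤ M * ((k + 1 : ℕ) * h)) ∧
    ∀ j : ℕ, ((k + j + 1 : ℕ)) * h ≤ T → |s.dS h (k + j) - s.dS h k| ≤ M * (j * h) ∧
      |s.dS1 h (k + j) - s.dS1 h k| ≤ M * (j * h) := by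
  obtain ⟨M₁, h1, h1'⟩ := exists_lipschitz_of_hasDerivAt s.hS1
    (continuous_iff_continuousAt.2 fun t => (s.hS2 t).continuousAt) T
  obtain ⟨M₂, h2, h2'⟩ := exists_lipschitz_of_hasDerivAt s.hS2 s.S3_cont T
  refine ⟨max M₁ M₂, le_max_of_le_left h1, fun h hh k => ?_⟩
  have hk : (0 : ℝ) ≤ k * h := mul_nonneg k.cast_nonneg hh.le
  have b1 := slope_bounds s.hS h1' s.S1_zero h1 hk hh
  have b2 := slope_bounds s.hS1 h2' s.S2_zero h2 hk hh
  have e1 : ((k + 1 : ℕ) : ℝ) * h = k * h + h := by push_cast; ring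
  have e2 : ∀ j : ℕ, ((k + j + 1 : ℕ) : ℝ) * h = k * h + j * h + h := by intro j; push_cast; ring
  have e3 : ∀ j : ℕ, ((k + j : ℕ) : ℝ) * h = k * h + j * h := by intro j; push_cast; ring
  refine ⟨fun hT => ?_, fun j hT => ?_⟩
  · have h0 : 0 ≤ k * h + h := by linarith
    rw [dS, dS1, e1]
    rw [e1] at hT
    exact ⟨(b1.1 hT).trans (mul_le_mul_of_nonneg_right (le_max_left _ _) h0),
      (b2.1 hT).trans (mul_le_mul_of_nonneg_right (le_max_right _ _) h0)⟩
  · have h0 : (0 : ℝ) ≤ j * h := mul_nonneg j.cast_nonneg hh.le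
    rw [dS, dS1, dS, dS1, e2, e3, e1]
    rw [e2] at hT
    exact ⟨(b1.2 _ h0 hT).trans (mul_le_mul_of_nonneg_right (le_max_left _ _) h0),
      (b2.2 _ h0 hT).trans (mul_le_mul_of_nonneg_right (le_max_right _ _) h0)⟩

theorem Adm.neg_B_le_qq (ha : s.Adm n h) {T : ℝ} (hT : T ≤ n) {k : ℕ} (hk : (k + 1 : ℕ) * h ≤ T)
    (x : EuclideanSpace ℝ (Fin d)) : -s.B ≤ s.qq n h k x := by
  have h1 := s.bb_mul_inv_nonneg (n := n) x
  have h2 := s.bb_mul_inv_le (n := n) x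
  have h3 := mul_nonneg (s.hα0 x) (ha.cc_mem hT hk x).1
  have h4 := mul_nonneg h1 h3
  have h5 : s.bb n x * (s.A x)⁻¹ * s.β x ≤ 1 * s.B :=
    mul_le_mul h2 (s.hβB x) (s.hβ0 x) zero_le_one
  rw [qq, mul_sub]; linarith

theorem Adm.coef_qq (ha : s.Adm n h) {T : ℝ} (hT : T ≤ n) {k : ℕ} (hk : (k + 1 : ℕ) * h ≤ T)
    (x : EuclideanSpace ℝ (Fin d)) : 0 ≤ 1 - h * s.bb n x * n - h * s.qq n h k x := by
  have hT0 := (ha.time_nonneg _).trans hk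
  have h0 := ha.coef hT0 hT x
  have h1 := s.bb_mul_inv_nonneg (n := n) x
  have h2 := mul_le_mul_of_nonneg_left (ha.cc_mem hT hk x).2 (s.hα0 x)
  have h3 : s.qq n h k x ≤ s.bb n x * (s.A x)⁻¹ *
      (s.α x * (s.p * (s.S T * s.pt n x) ^ (s.p - 1))) :=
    mul_le_mul_of_nonneg_left (by linarith [s.hβ0 x]) h1
  have h4 := mul_le_mul_of_nonneg_left h3 ha.2.1.le
  linarith

theorem Adm.abs_reaction_le (ha : s.Adm n h) {T : ℝ} (hT : T ≤ n) {k : ℕ}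
    (hk : (k + 1 : ℕ) * h ≤ T) (x : EuclideanSpace ℝ (Fin d)) :
    |(s.α x * s.cc n h k x - s.β x) * s.pt n x| ≤
      (s.M * s.p * s.S T ^ (s.p - 1) + s.B) * s.pt n x ^ s.p := by
  have hT0 := (ha.time_nonneg _).trans hk
  have hpt := s.one_le_pt ha.1 x
  have hptp := s.pt_le_rpow ha.1 x
  obtain ⟨h1, h2⟩ := ha.cc_mem hT hk x
  rw [Real.mul_rpow (s.S_nonneg hT0) (by linarith)] at h2
  have hg : 0 ≤ s.S T ^ (s.p - 1) := Real.rpow_nonneg (s.S_nonneg hT0) _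
  have hp : 0 ≤ s.p := by linarith [s.hp1]
  have e1 : s.α x * s.cc n h k x ≤ s.M * (s.p * (s.S T ^ (s.p - 1) * s.pt n x ^ (s.p - 1))) :=
    mul_le_mul (s.hαM x) h2 h1 s.M_nonneg
  have e2 := mul_le_mul_of_nonneg_right e1 (show 0 ≤ s.pt n x by linarith)
  have e3 : s.β x * s.pt n x ≤ s.B * s.pt n x ^ s.p :=
    mul_le_mul (s.hβB x) hptp (by linarith) s.B_nonneg
  have e4 : 0 ≤ s.α x * s.cc n h k x * s.pt n x :=
    mul_nonneg (mul_nonneg (s.hα0 x) h1) (by linarith)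
  have e5 : 0 ≤ s.β x * s.pt n x := mul_nonneg (s.hβ0 x) (by linarith)
  have e6 : s.M * (s.p * (s.S T ^ (s.p - 1) * s.pt n x ^ (s.p - 1))) * s.pt n x =
      s.M * s.p * s.S T ^ (s.p - 1) * s.pt n x ^ s.p := by
    rw [← s.pt_rpow_sub_one_mul ha.1 x]; ring
  have e7 : 0 ≤ s.B * s.pt n x ^ s.p := e5.trans e3
  have e8 : 0 ≤ s.M * s.p * s.S T ^ (s.p - 1) * s.pt n x ^ s.p := e6 ▸ e4.trans e2
  rw [abs_le]
  constructor <;> linarith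

theorem Adm.abs_src_le (ha : s.Adm n h) {T a : ℝ} (hT : T ≤ n) {k : ℕ}
    (hk : (k + 1 : ℕ) * h ≤ T) (hdS : |s.dS h k| ≤ a) (hdS1 : |s.dS1 h k| ≤ a)
    (x : EuclideanSpace ℝ (Fin d)) : |s.src n h k x| ≤
      (a * (1 + (s.M * s.p * s.S T ^ (s.p - 1) + s.B))) * (s.bb n x * s.wt n x) := by
  have hT0 := (ha.time_nonneg _).trans hk
  have ha0 : 0 ≤ a := (abs_nonneg _).trans hdS
  have hptp := s.pt_le_rpow ha.1 x
  have hpt := s.one_le_pt ha.1 x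
  have hr := ha.abs_reaction_le hT hk x
  refine abs_bb_mul_le (abs_le_wt ?_ ?_)
  · rw [show s.dS1 h k * s.pt n x + (s.α x * s.cc n h k x - s.β x) * (s.dS h k * s.pt n x) =
      s.dS1 h k * s.pt n x + s.dS h k * ((s.α x * s.cc n h k x - s.β x) * s.pt n x) by ring]
    refine (abs_add_le _ _).trans ?_
    rw [abs_mul, abs_mul, abs_of_nonneg (show 0 ≤ s.pt n x by linarith)]
    have e1 := mul_le_mul hdS1 hptp (by linarith) ha0
    have e2 := mul_le_mul hdS hr (abs_nonneg _) ha0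
    linarith
  · have : 0 ≤ s.M * s.p * s.S T ^ (s.p - 1) + s.B :=
      add_nonneg (mul_nonneg (mul_nonneg s.M_nonneg (by linarith [s.hp1]))
        (Real.rpow_nonneg (s.S_nonneg hT0) _)) s.B_nonneg
    nlinarith [mul_nonneg ha0 this]

theorem Adm.zz_zero (ha : s.Adm n h) (x : EuclideanSpace ℝ (Fin d)) : s.zz n h 0 x = 0 := by
  have hp : s.p ≠ 0 := by linarith [s.hp1]
  have h0 : res n (fun _ : EuclideanSpace ℝ (Fin d) => (0 : ℝ)) x = 0 := res_const ha.pos 0 x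
  simp [zz, sol, step, G, s.S_zero, s.S1_zero, h0, Real.zero_rpow hp]

theorem exists_abs_zz_le (s : Setup d) {T : ℝ} (hT : 0 ≤ T) : ∃ C : ℝ, 0 ≤ C ∧
    ∀ (n : ℕ) (h : ℝ), s.Adm n h → T ≤ n → ∀ k : ℕ, (k + 1 : ℕ) * h ≤ T → ∀ x,
      |s.zz n h k x| ≤ C * (k * h) * s.ot n x := by
  obtain ⟨Ms, hMs, hb⟩ := s.exists_dS_bounds T
  set R := s.M * s.p * s.S T ^ (s.p - 1) + s.B with hR
  have hR0 : 0 ≤ R :=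
    add_nonneg (mul_nonneg (mul_nonneg s.M_nonneg (by linarith [s.hp1]))
        (Real.rpow_nonneg (s.S_nonneg hT) _)) s.B_nonneg
  refine ⟨Ms * (1 + R) * Real.exp ((s.B + s.L) * T), by positivity, fun n h ha hn k hk x => ?_⟩
  have hkT : ∀ j ≤ k, ((j + 1 : ℕ) : ℝ) * h ≤ T := fun j hj =>
    (ha.time_mono (Nat.succ_le_succ hj)).trans hk
  have hkh := ha.time_nonneg k
  have := ha.iterate (T := T) (τ := Ms * (k * h) * (1 + R)) (by positivity)
    (f := s.zz n h) (q := s.qq n h) (K := k) ((ha.time_mono k.le_succ).trans hk)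
    (fun j hj => ha.zz_locHolder ((hkT j hj).trans hn))
    (fun j hj => ha.zz_linGrowth ((hkT j hj).trans hn))
    (fun j hj y => by
      have h1 := hkT j hj.le
      have h2 : Ms * ((j + 1 : ℕ) * h) ≤ Ms * (k * h) :=
        mul_le_mul_of_nonneg_left (ha.time_mono hj) hMs
      have h3 := ((hb h ha.2.1 j).1 h1)
      have h4 := ha.abs_src_le hn h1 (h3.1.trans h2) (h3.2.trans h2) y
      rw [ha.zz_succ (h1.trans hn), add_sub_cancel_left, abs_mul, abs_of_pos ha.2.1]
      exact mul_le_mul_of_nonneg_left h4 ha.2.1.le)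
    (fun j hj y => ha.neg_B_le_qq hn (hkT j hj.le) y)
    (fun j hj y => ha.coef_qq hn (hkT j hj.le) y)
    (fun y => by
      rw [ha.zz_zero, abs_zero]
      have := s.ot_pos ha.1 y
      positivity) x
  refine this.trans (le_of_eq ?_)
  ring

theorem Adm.uu_succ (ha : s.Adm n h) (k : ℕ) (x : EuclideanSpace ℝ (Fin d)) :
    s.uu n h (k + 1) x - s.uu n h k x = h * (s.dS h k * s.pt n x - s.zz n h k x) := by
  have hh := ha.2.1.ne'
  rw [uu, uu, dS, zz]; field_simp; ring

theorem Adm.abs_uu_sub_le (ha : s.Adm n h) {Y : ℝ} {x : EuclideanSpace ℝ (Fin d)} {k j : ℕ}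
    (hY : ∀ i < k + j, |s.dS h i * s.pt n x - s.zz n h i x| ≤ Y) :
    |s.uu n h (k + j) x - s.uu n h k x| ≤ j * h * Y := by
  induction j with
  | zero => simp
  | succ j ih =>
    have h1 := ih fun i hi => hY i (by omega)
    have h2 := mul_le_mul_of_nonneg_left (hY (k + j) (by omega)) ha.2.1.le
    have h3 := ha.uu_succ (k + j) x
    rw [← abs_of_pos ha.2.1, ← abs_mul, abs_of_pos ha.2.1, ← h3] at h2
    have h4 := abs_sub_le (s.uu n h (k + j + 1) x) (s.uu n h (k + j) x) (s.uu n h k x)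
    rw [← add_assoc]
    push_cast
    linarith

theorem Adm.abs_cc_sub_le (ha : s.Adm n h) {T Y : ℝ} (hT : T ≤ n) {x : EuclideanSpace ℝ (Fin d)}
    {k j : ℕ} (hk : (k + j + 1 : ℕ) * h ≤ T)
    (hY : ∀ i ≤ k + j, |s.dS h i * s.pt n x - s.zz n h i x| ≤ Y) :
    |s.cc n h (k + j) x - s.cc n h k x| ≤ s.p * (3 * (j * h) * Y) ^ (s.p - 1) := by
  have hp : 0 ≤ s.p := by linarith [s.hp1]
  have hY0 : 0 ≤ Y := (abs_nonneg _).trans (hY 0 (Nat.zero_le _))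
  rcases Nat.eq_zero_or_pos j with rfl | hj
  · simp [s.p_sub_one_pos.ne']
  have hu : ∀ i ≤ k + j + 1, 0 ≤ s.uu n h i x := fun i hi =>
    (ha.uu_mem hT ((ha.time_mono hi).trans hk) x).1
  obtain ⟨a1, a2, -, -⟩ := xi_spec s.hp1.le (hu k (by omega)) (hu (k + 1) (by omega))
  obtain ⟨b1, b2, -, -⟩ := xi_spec s.hp1.le (hu (k + j) (by omega)) (hu (k + j + 1) (by omega))
  have c1 := ha.abs_uu_sub_le (k := k) (j := 1) (Y := Y) (x := x) fun i hi => hY i (by omega)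
  have c2 := ha.abs_uu_sub_le (k := k + j) (j := 1) (Y := Y) (x := x) fun i hi => hY i (by omega)
  have c3 := ha.abs_uu_sub_le (k := k) (j := j) (Y := Y) (x := x) fun i hi => hY i (by omega)
  rw [cc, cc, ← mul_sub, abs_mul, abs_of_nonneg hp]
  refine mul_le_mul_of_nonneg_left ?_ hp
  refine (abs_rpow_sub_rpow_le b1 a1 s.p_sub_one_pos.le (by linarith [s.hp2])).trans ?_
  refine Real.rpow_le_rpow (abs_nonneg _) ?_ s.p_sub_one_pos.le
  have hj1 : h * Y ≤ j * h * Y := by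
    have : (1 : ℝ) ≤ j := by exact_mod_cast hj
    have := mul_le_mul_of_nonneg_right this (mul_nonneg ha.2.1.le hY0)
    linarith
  rw [Nat.cast_one, one_mul] at c1 c2
  replace a2 := a2.trans c1
  replace b2 := b2.trans c2
  rw [abs_le] at *
  constructor <;> linarith

theorem exists_abs_zz_sub_le (s : Setup d) {T : ℝ} (hT : 0 ≤ T) : ∃ C : ℝ, 0 ≤ C ∧
    ∀ (n : ℕ) (h : ℝ), s.Adm n h → T ≤ n → ∀ k j : ℕ, (k + j + 1 : ℕ) * h ≤ T → ∀ x,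
      |s.zz n h (k + j) x - s.zz n h k x| ≤ C * (j * h) ^ (s.p - 1) * s.ot n x := by
  obtain ⟨Ms, hMs, hb⟩ := s.exists_dS_bounds T
  obtain ⟨Cz, hCz, hz⟩ := s.exists_abs_zz_le hT
  set R := s.M * s.p * s.S T ^ (s.p - 1) + s.B with hR
  set γ := s.p - 1 with hγ
  have hγ0 : 0 < γ := s.p_sub_one_pos
  have hγ1 : γ ≤ 1 := by linarith [s.hp2]
  have hp : 0 ≤ s.p := by linarith [s.hp1]
  have hM := s.M_nonneg
  have hD := s.D_nonneg
  have hR0 : 0 ≤ R :=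
    add_nonneg (mul_nonneg (mul_nonneg s.M_nonneg hp)
        (Real.rpow_nonneg (s.S_nonneg hT) _)) s.B_nonneg
  set Cu := Ms * T + Cz * T * s.D with hCu
  have hCu0 : 0 ≤ Cu := by positivity
  set N := (1 + T) * Ms * (1 + R) + s.M * (s.p * (3 * Cu) ^ γ * Cu) + Cz * (1 + T) with hN
  have hN0 : 0 ≤ N := by positivity
  refine ⟨N * Real.exp ((s.B + s.L) * T), by positivity, fun n h ha hn k j hk x => ?_⟩
  have hkT : ∀ i ≤ k, ((i + j + 1 : ℕ) : ℝ) * h ≤ T := fun i hi =>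
    (ha.time_mono (by omega)).trans hk
  have hkT' : ∀ i ≤ k + j, ((i + 1 : ℕ) : ℝ) * h ≤ T := fun i hi =>
    (ha.time_mono (by omega)).trans hk
  have hjh := ha.time_nonneg j
  have hjT : (j : ℝ) * h ≤ T := (ha.time_mono (by omega)).trans hk
  set e := ((j : ℝ) * h) ^ γ with he
  have he0 : 0 ≤ e := Real.rpow_nonneg hjh _
  have hje : (j : ℝ) * h ≤ (1 + T) * e := by
    have := rpow_le_of_exponent hjh hjT hγ0 hγ1 le_rfl
    rwa [Real.rpow_one] at this
  have hY : ∀ i ≤ k + j, ∀ y, |s.dS h i * s.pt n y - s.zz n h i y| ≤ Cu * s.pt n y := by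
    intro i hi y
    have hpt := s.one_le_pt ha.1 y
    have h1 : |s.dS h i| ≤ Ms * T := ((hb h ha.2.1 i).1 (hkT' i hi)).1.trans
      (mul_le_mul_of_nonneg_left (hkT' i hi) hMs)
    have h2 := hz n h ha hn i (hkT' i hi) y
    have h3 : (i : ℝ) * h ≤ T := (ha.time_mono i.le_succ).trans (hkT' i hi)
    have h4 : Cz * (i * h) * s.ot n y ≤ Cz * T * s.D :=
      mul_le_mul (mul_le_mul_of_nonneg_left h3 hCz) (s.ot_le ha.1 y) (s.ot_pos ha.1 y).le
        (by positivity)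
    have h5 : |s.dS h i * s.pt n y| ≤ Ms * T * s.pt n y := by
      rw [abs_mul, abs_of_nonneg (show 0 ≤ s.pt n y by linarith)]
      exact mul_le_mul_of_nonneg_right h1 (by linarith)
    have h6 : Cz * T * s.D ≤ Cz * T * s.D * s.pt n y := le_mul_of_one_le_right (by positivity) hpt
    refine (abs_sub _ _).trans ?_
    rw [hCu]; linarith
  have := ha.iterate (T := T) (τ := N * e) (by positivity)
    (f := fun i y => s.zz n h (i + j) y - s.zz n h i y) (q := fun i => s.qq n h (i + j)) (K := k)
    ((ha.time_mono (by omega)).trans hk)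
    (fun i hi => (ha.zz_locHolder ((hkT i hi).trans hn)).sub
      (ha.zz_locHolder ((hkT' i (by omega)).trans hn)))
    (fun i hi => by
      have := (ha.zz_linGrowth ((hkT i hi).trans hn)).add
        ((ha.zz_linGrowth ((hkT' i (by omega)).trans hn)).const_mul (-1))
      convert this using 2
      ring)
    (fun i hi y => ?_)
    (fun i hi y => ha.neg_B_le_qq hn (hkT i hi.le) y)
    (fun i hi y => ha.coef_qq hn (hkT i hi.le) y)
    (fun y => ?_) x
  · refine this.trans (le_of_eq ?_)
    ring
  · have h1 := hkT i hi.le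
    have hpt := s.one_le_pt ha.1 y
    have hptp := s.pt_le_rpow ha.1 y
    have hB := (hb h ha.2.1 i).2 j h1
    have hsub : res n (fun y => s.zz n h (i + j) y - s.zz n h i y) y =
        res n (s.zz n h (i + j)) y - res n (s.zz n h i) y :=
      res_sub ha.pos (ha.zz_locHolder ((hkT i hi.le).trans hn)).continuous
        (ha.zz_linGrowth ((hkT i hi.le).trans hn))
        (ha.zz_locHolder ((hkT' i (by omega)).trans hn)).continuous
        (ha.zz_linGrowth ((hkT' i (by omega)).trans hn)) y
    have hX : s.zz n h (i + 1 + j) y - s.zz n h (i + 1) y -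
        ((1 - h * s.bb n y * n - h * s.qq n h (i + j) y) * (s.zz n h (i + j) y - s.zz n h i y) +
          h * s.bb n y * n * res n (fun y => s.zz n h (i + j) y - s.zz n h i y) y) =
        h * (s.bb n y * ((s.A y)⁻¹ * ((s.dS1 h (i + j) - s.dS1 h i) * s.pt n y +
          (s.dS h (i + j) - s.dS h i) * ((s.α y * s.cc n h (i + j) y - s.β y) * s.pt n y) +
          s.α y * ((s.cc n h (i + j) y - s.cc n h i y) * (s.dS h i * s.pt n y - s.zz n h i y))) -
          (s.dS h (i + j) - s.dS h i) * lap s.ψ y)) := by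
      rw [show i + 1 + j = i + j + 1 by omega, ha.zz_succ (h1.trans hn),
        ha.zz_succ ((hkT' i (by omega)).trans hn), hsub, qq, qq, src, src]
      ring
    refine (congrArg abs hX).trans_le ?_
    rw [abs_mul, abs_of_pos ha.2.1]
    have hMe : Ms * (j * h) ≤ Ms * (1 + T) * e := by
      have := mul_le_mul_of_nonneg_left hje hMs
      linarith
    refine mul_le_mul_of_nonneg_left (abs_bb_mul_le (abs_le_wt ?_ ?_)) ha.2.1.le
    · have k1 : |(s.dS1 h (i + j) - s.dS1 h i) * s.pt n y| ≤
          Ms * (1 + T) * e * s.pt n y ^ s.p := by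
        rw [abs_mul, abs_of_nonneg (show 0 ≤ s.pt n y by linarith)]
        exact mul_le_mul (hB.2.trans hMe) hptp (by linarith) (by positivity)
      have k2 : |(s.dS h (i + j) - s.dS h i) *
          ((s.α y * s.cc n h (i + j) y - s.β y) * s.pt n y)| ≤
          Ms * (1 + T) * e * (R * s.pt n y ^ s.p) := by
        rw [abs_mul]
        exact mul_le_mul (hB.1.trans hMe) (ha.abs_reaction_le hn h1 y) (abs_nonneg _)
          (by positivity)
      have k3 : |s.cc n h (i + j) y - s.cc n h i y| ≤
          s.p * ((3 * Cu) ^ γ * e * s.pt n y ^ γ) := by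
        refine (ha.abs_cc_sub_le hn h1 fun l hl => hY l (by omega) y).trans (le_of_eq ?_)
        rw [he, ← Real.mul_rpow (by positivity) hjh, ← Real.mul_rpow (by positivity) (by linarith)]
        congr 2; ring
      have k4 : |s.α y * ((s.cc n h (i + j) y - s.cc n h i y) *
          (s.dS h i * s.pt n y - s.zz n h i y))| ≤
          s.M * (s.p * ((3 * Cu) ^ γ * e * s.pt n y ^ γ) * (Cu * s.pt n y)) := by
        have hc0 : 0 ≤ s.p * ((3 * Cu) ^ γ * e * s.pt n y ^ γ) := (abs_nonneg _).trans k3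
        rw [abs_mul, abs_mul, abs_of_nonneg (s.hα0 y)]
        exact mul_le_mul (s.hαM y) (mul_le_mul k3 (hY i (by omega) y) (abs_nonneg _) hc0)
          (by positivity) hM
      have k5 : s.M * (s.p * ((3 * Cu) ^ γ * e * s.pt n y ^ γ) * (Cu * s.pt n y)) =
          s.M * (s.p * (3 * Cu) ^ γ * Cu) * e * s.pt n y ^ s.p := by
        rw [← s.pt_rpow_sub_one_mul ha.1 y]; ring
      have k6 : 0 ≤ Cz * (1 + T) * e * s.pt n y ^ s.p := by
        have : 0 ≤ s.pt n y ^ s.p := by linarith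
        positivity
      refine (abs_add_three _ _ _).trans ?_
      rw [k5] at k4
      rw [hN]
      linarith
    · refine hB.1.trans (hMe.trans ?_)
      have q1 : 0 ≤ (1 + T) * Ms * R * e := by positivity
      have q2 : 0 ≤ s.M * (s.p * (3 * Cu) ^ γ * Cu) * e := by positivity
      have q3 : 0 ≤ Cz * (1 + T) * e := by positivity
      rw [hN]
      linarith
  · have hot := s.ot_pos ha.1 y
    simp only [zero_add]
    rw [ha.zz_zero, sub_zero]
    refine (hz n h ha hn j (hkT' j (by omega)) y).trans
      (mul_le_mul_of_nonneg_right ?_ hot.le)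
    have q1 : 0 ≤ (1 + T) * Ms * (1 + R) * e := by positivity
    have q2 : 0 ≤ s.M * (s.p * (3 * Cu) ^ γ * Cu) * e := by positivity
    have := mul_le_mul_of_nonneg_left hje hCz
    rw [hN]
    linarith

end Setup
end SchemeTime

section Compactness
open Filter Topology

theorem exists_subseq_tendsto {ι : Type*} [Countable ι] (W : ℕ → ι → ℝ)
    (hW : ∀ i, ∃ C, ∀ᶠ n in atTop, |W n i| ≤ C) :
    ∃ φ : ℕ → ℕ, StrictMono φ ∧ ∀ i, ∃ a, Tendsto (fun k => W (φ k) i) atTop (𝓝 a) := by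
  choose C hC using hW
  have hK : IsCompact (Set.pi univ fun i => Icc (-|C i|) |C i|) :=
    isCompact_univ_pi fun i => isCompact_Icc
  obtain ⟨a, -, φ, hφ, hlim⟩ := hK.tendsto_subseq
    (x := fun n i => max (-|C i|) (min |C i| (W n i))) fun n i _ =>
      ⟨le_max_left _ _, max_le (by linarith [abs_nonneg (C i)]) (min_le_left _ _)⟩
  refine ⟨φ, hφ, fun i => ⟨a i, ?_⟩⟩
  refine (tendsto_pi_nhds.1 hlim i).congr' ?_
  filter_upwards [hφ.tendsto_atTop.eventually (hC i)] with n hn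
  have h1 := abs_le.1 (hn.trans (le_abs_self _))
  simp only [Function.comp]
  rw [min_eq_right h1.2, max_eq_right h1.1]

theorem exists_tendsto_of_approx {a : ℕ → ℝ} (h : ∀ ε > 0, ∃ b : ℕ → ℝ,
    (∃ l, Tendsto b atTop (𝓝 l)) ∧ ∀ᶠ n in atTop, |a n - b n| ≤ ε) :
    ∃ l, Tendsto a atTop (𝓝 l) := by
  refine cauchySeq_tendsto_of_complete (Metric.cauchySeq_iff'.2 fun ε hε => ?_)
  obtain ⟨b, ⟨l, hl⟩, hb⟩ := h (ε / 5) (by positivity)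
  have h1 := Metric.tendsto_nhds.1 hl (ε / 5) (by positivity)
  obtain ⟨N, hN⟩ := eventually_atTop.1 (hb.and h1)
  refine ⟨N, fun n hn => ?_⟩
  obtain ⟨a1, a2⟩ := hN n hn
  obtain ⟨b1, b2⟩ := hN N le_rfl
  rw [Real.dist_eq] at *
  rw [abs_lt] at *
  rw [abs_le] at *
  constructor <;> linarith

/-- A family of functions of time and space that is equicontinuous up to errors `e n → 0`,
together with approximate time derivatives. -/
structure ApproxEquicont {E : Type*} [NormedAddCommGroup E] (V Z : ℕ → ℝ → E → ℝ) (e : ℕ → ℝ)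
    (γ : ℝ) : Prop where
  γ_pos : 0 < γ
  e_nonneg : ∀ n, 0 ≤ e n
  e_tendsto : Tendsto e atTop (𝓝 0)
  bound : ∀ T : ℝ, 0 ≤ T → ∃ C : ℝ, 0 ≤ C ∧ ∀ᶠ n in atTop, ∀ s t : ℝ, 0 ≤ s → s ≤ t → t ≤ T →
    ∀ x y, |V n t x| ≤ C ∧ |Z n t x| ≤ C ∧ |V n t x - V n t y| ≤ C * (‖x - y‖ + e n) ∧
      |V n t x - V n s x| ≤ C * (t - s + e n) ∧
      |Z n t x - Z n s x| ≤ C * (t - s + e n) ^ γ ∧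
      |V n t x - V n s x - (t - s) * Z n s x| ≤
        C * ((t - s + e n) * (t - s + e n) ^ γ + e n)

variable {E : Type*} [NormedAddCommGroup E] {V Z : ℕ → ℝ → E → ℝ} {e : ℕ → ℝ} {γ : ℝ}

theorem ApproxEquicont.exists_lim [TopologicalSpace.SeparableSpace E]
    (hV : ApproxEquicont V Z e γ) : ∃ φ : ℕ → ℕ, StrictMono φ ∧ ∀ t x, 0 ≤ t →
      (∃ l, Tendsto (fun n => V (φ n) t x) atTop (𝓝 l)) ∧
      ∃ l, Tendsto (fun n => Z (φ n) t x) atTop (𝓝 l) := by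
  obtain ⟨φ, hφ, hlim⟩ := exists_subseq_tendsto
    (fun n (i : ℕ × ℕ) => V n |TopologicalSpace.denseSeq ℝ i.1| (TopologicalSpace.denseSeq E i.2))
    fun i => by
      obtain ⟨C, -, hC⟩ := hV.bound |TopologicalSpace.denseSeq ℝ i.1| (abs_nonneg _)
      exact ⟨C, hC.mono fun n hn => (hn _ _ (abs_nonneg _) le_rfl le_rfl _ 0).1⟩
  have he := hV.e_tendsto.comp hφ.tendsto_atTop
  have h1 : ∀ t x, 0 ≤ t → ∃ l, Tendsto (fun n => V (φ n) t x) atTop (𝓝 l) := by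
    intro t x ht
    obtain ⟨C, hC0, hC⟩ := hV.bound (t + 1) (by linarith)
    refine exists_tendsto_of_approx fun ε hε => ?_
    set δ := ε / (4 * (C + 1)) with hδ
    have hδ0 : 0 < δ := by positivity
    obtain ⟨i, hi⟩ := (TopologicalSpace.denseRange_denseSeq ℝ).exists_mem_open
      (isOpen_Ioo (a := t) (b := t + min δ 1)) (nonempty_Ioo.2 (by
        have : 0 < min δ 1 := lt_min hδ0 one_pos
        linarith))
    obtain ⟨j, hj⟩ := (TopologicalSpace.denseRange_denseSeq E).exists_dist_lt x hδ0
    set r := TopologicalSpace.denseSeq ℝ i with hr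
    set y := TopologicalSpace.denseSeq E j with hy
    have hr0 : 0 ≤ r := ht.trans hi.1.le
    have h1 : |r| = r := abs_of_nonneg hr0
    have h2 := hlim (i, j)
    simp only [← hr, ← hy, h1] at h2
    refine ⟨_, h2, ?_⟩
    filter_upwards [hφ.tendsto_atTop.eventually hC, he.eventually (gt_mem_nhds hδ0)] with n hn hen
    have c1 := (hn t r ht hi.1.le (by linarith [hi.2, min_le_right δ 1]) x y)
    have c2 := c1.2.2.2.1
    have c3 := c1.2.2.1
    rw [dist_eq_norm] at hj
    have hen' : e (φ n) < δ := hen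
    have hi2 := hi.2
    have hm := min_le_left δ 1
    have c4 : C * (r - t + e (φ n)) ≤ C * (2 * δ) := mul_le_mul_of_nonneg_left (by linarith) hC0
    have c5 : C * (‖x - y‖ + e (φ n)) ≤ C * (2 * δ) :=
      mul_le_mul_of_nonneg_left (by linarith) hC0
    have c6 : (C + 1) * (4 * δ) = ε := by rw [hδ]; field_simp
    have := (abs_le.1 c2)
    have := (abs_le.1 c3)
    rw [abs_le]
    constructor <;> linarith
  refine ⟨φ, hφ, fun t x ht => ⟨h1 t x ht, ?_⟩⟩
  obtain ⟨C, hC0, hC⟩ := hV.bound (t + 1) (by linarith)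
  refine exists_tendsto_of_approx fun ε hε => ?_
  set δ := ε / (3 * (C + 1)) with hδ
  have hδ0 : 0 < δ := by positivity
  have hγ := hV.γ_pos
  obtain ⟨τ, hτ, hτ0, hτ1⟩ : ∃ τ : ℝ, (2 * τ) ^ γ < δ ∧ 0 < τ ∧ τ < 1 := by
    have hc : Tendsto (fun τ : ℝ => (2 * τ) ^ γ) (𝓝[>] 0) (𝓝 0) := by
      have h : ContinuousAt (fun τ : ℝ => (2 * τ) ^ γ) 0 :=
        ContinuousAt.rpow_const (by fun_prop) (Or.inr hγ.le)
      have := h.tendsto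
      simp only [mul_zero, Real.zero_rpow hγ.ne'] at this
      exact this.mono_left nhdsWithin_le_nhds
    obtain ⟨τ, h2, h3⟩ := ((hc.eventually (gt_mem_nhds hδ0)).and
      (Ioo_mem_nhdsGT (zero_lt_one' ℝ))).exists
    exact ⟨τ, h2, h3.1, h3.2⟩
  obtain ⟨l1, hl1⟩ := h1 t x ht
  obtain ⟨l2, hl2⟩ := h1 (t + τ) x (by linarith)
  refine ⟨fun n => (V (φ n) (t + τ) x - V (φ n) t x) / τ, ⟨_, (hl2.sub hl1).div_const τ⟩, ?_⟩
  filter_upwards [hφ.tendsto_atTop.eventually hC,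
    he.eventually (gt_mem_nhds (show 0 < τ * min 1 δ by positivity))] with n hn hen
  replace hen : e (φ n) < τ * min 1 δ := hen
  have he0 := hV.e_nonneg (φ n)
  have e1 : e (φ n) ≤ τ :=
    hen.le.trans (mul_le_of_le_one_right hτ0.le (min_le_left _ _))
  have e2 : e (φ n) ≤ τ * δ := hen.le.trans (mul_le_mul_of_nonneg_left (min_le_right _ _) hτ0.le)
  have c1 := (hn t (t + τ) ht (by linarith) (by linarith) x x).2.2.2.2.2
  rw [add_sub_cancel_left] at c1
  have c2 : (τ + e (φ n)) * (τ + e (φ n)) ^ γ + e (φ n) ≤ 3 * τ * δ := by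
    have q1 : (τ + e (φ n)) ^ γ ≤ (2 * τ) ^ γ :=
      Real.rpow_le_rpow (by linarith) (by linarith) hγ.le
    have q2 : (τ + e (φ n)) * (τ + e (φ n)) ^ γ ≤ (2 * τ) * δ :=
      mul_le_mul (by linarith) (q1.trans hτ.le) (Real.rpow_nonneg (by linarith) _) (by linarith)
    linarith
  have c3 := c1.trans (mul_le_mul_of_nonneg_left c2 hC0)
  have c4 : Z (φ n) t x - (V (φ n) (t + τ) x - V (φ n) t x) / τ =
      -(V (φ n) (t + τ) x - V (φ n) t x - τ * Z (φ n) t x) / τ := by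
    field_simp; ring
  rw [c4, abs_div, abs_neg, abs_of_pos hτ0, div_le_iff₀ hτ0]
  refine c3.trans ?_
  have c5 : C * (3 * δ) ≤ ε := by
    have : (C + 1) * (3 * δ) = ε := by rw [hδ]; field_simp
    linarith
  have := mul_le_mul_of_nonneg_right c5 hτ0.le
  linarith

theorem ApproxEquicont.lim_bound (hV : ApproxEquicont V Z e γ) {φ : ℕ → ℕ} (hφ : StrictMono φ)
    {v z : ℝ → E → ℝ} (hv : ∀ t x, 0 ≤ t → Tendsto (fun n => V (φ n) t x) atTop (𝓝 (v t x)))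
    (hz : ∀ t x, 0 ≤ t → Tendsto (fun n => Z (φ n) t x) atTop (𝓝 (z t x))) {T : ℝ} (hT : 0 ≤ T) :
    ∃ C : ℝ, 0 ≤ C ∧ ∀ s t : ℝ, 0 ≤ s → s ≤ t → t ≤ T →
    ∀ x y, |v t x| ≤ C ∧ |z t x| ≤ C ∧ |v t x - v t y| ≤ C * ‖x - y‖ ∧
      |v t x - v s x| ≤ C * (t - s) ∧ |z t x - z s x| ≤ C * (t - s) ^ γ ∧
      |v t x - v s x - (t - s) * z s x| ≤ C * ((t - s) * (t - s) ^ γ) := by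
  obtain ⟨C, hC0, hC⟩ := hV.bound T hT
  have he : Tendsto (fun n => e (φ n)) atTop (𝓝 0) := hV.e_tendsto.comp hφ.tendsto_atTop
  refine ⟨C, hC0, fun s t hs hst htT x y => ?_⟩
  have ht := hs.trans hst
  have hev := (hφ.tendsto_atTop.eventually hC).mono fun n hn => hn s t hs hst htT x y
  have hadd : ∀ a : ℝ, Tendsto (fun n => a + e (φ n)) atTop (𝓝 a) := fun a => by
    simpa using he.const_add a
  have hpow : Tendsto (fun n => (t - s + e (φ n)) ^ γ) atTop (𝓝 ((t - s) ^ γ)) :=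
    (hadd _).rpow_const (Or.inr hV.γ_pos.le)
  have h5 : Tendsto (fun n => C * ((t - s + e (φ n)) * (t - s + e (φ n)) ^ γ + e (φ n))) atTop
      (𝓝 (C * ((t - s) * (t - s) ^ γ))) := by
    simpa using ((((hadd _).mul hpow).add he).const_mul C)
  exact ⟨le_of_tendsto (hv t x ht).abs (hev.mono fun n h => h.1),
    le_of_tendsto (hz t x ht).abs (hev.mono fun n h => h.2.1),
    le_of_tendsto_of_tendsto ((hv t x ht).sub (hv t y ht)).abs ((hadd _).const_mul C)
      (hev.mono fun n h => h.2.2.1),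
    le_of_tendsto_of_tendsto ((hv t x ht).sub (hv s x hs)).abs ((hadd _).const_mul C)
      (hev.mono fun n h => h.2.2.2.1),
    le_of_tendsto_of_tendsto ((hz t x ht).sub (hz s x hs)).abs (hpow.const_mul C)
      (hev.mono fun n h => h.2.2.2.2.1),
    le_of_tendsto_of_tendsto
      (((hv t x ht).sub (hv s x hs)).sub ((hz s x hs).const_mul (t - s))).abs h5
      (hev.mono fun n h => h.2.2.2.2.2)⟩

end Compactness

section TimeRegularity
open Filter Topology

/-- Locally uniform bounds in time: `v` is Lipschitz in space and time, and `z` is its time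
derivative, Hölder continuous in time with exponent `γ`. -/
def TimeRegular {E : Type*} [NormedAddCommGroup E] (v z : ℝ → E → ℝ) (γ : ℝ) : Prop :=
  ∀ T : ℝ, 0 ≤ T → ∃ C : ℝ, 0 ≤ C ∧ ∀ s t : ℝ, 0 ≤ s → s ≤ t → t ≤ T →
    ∀ x y, |v t x| ≤ C ∧ |z t x| ≤ C ∧ |v t x - v t y| ≤ C * ‖x - y‖ ∧
      |v t x - v s x| ≤ C * (t - s) ∧ |z t x - z s x| ≤ C * (t - s) ^ γ ∧
      |v t x - v s x - (t - s) * z s x| ≤ C * ((t - s) * (t - s) ^ γ)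

variable {E : Type*} [NormedAddCommGroup E] {v z : ℝ → E → ℝ} {γ : ℝ}

theorem TimeRegular.symm_bound (h : TimeRegular v z γ) {T : ℝ} (hT : 0 ≤ T) :
    ∃ C : ℝ, 0 ≤ C ∧ ∀ s t : ℝ, 0 ≤ s → s ≤ T → 0 ≤ t → t ≤ T → ∀ x,
      |v t x - v s x| ≤ C * |t - s| ∧ |z t x - z s x| ≤ C * |t - s| ^ γ ∧
      |v t x - v s x - (t - s) * z s x| ≤ C * (|t - s| * |t - s| ^ γ) := by
  obtain ⟨C, hC0, hC⟩ := h T hT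
  refine ⟨2 * C, by positivity, fun s t hs hsT ht htT x => ?_⟩
  have hp : 0 ≤ C * |t - s| ^ γ := by positivity
  have hp1 : 0 ≤ C * |t - s| := by positivity
  have hp2 : 0 ≤ C * (|t - s| * |t - s| ^ γ) := by positivity
  rcases le_total s t with hst | hst
  · obtain ⟨-, -, -, h1, h2, h3⟩ := hC s t hs hst htT x x
    rw [abs_of_nonneg (sub_nonneg.2 hst)] at *
    exact ⟨by linarith, by linarith, by linarith⟩
  · obtain ⟨-, -, -, h1, h2, h3⟩ := hC t s ht hst hsT x x
    rw [abs_sub_comm t s, abs_of_nonneg (sub_nonneg.2 hst)] at *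
    rw [abs_sub_comm] at h1 h2
    refine ⟨by linarith, by linarith, ?_⟩
    have h4 : |(s - t) * (z t x - z s x)| ≤ (s - t) * (C * (s - t) ^ γ) := by
      rw [abs_mul, abs_of_nonneg (sub_nonneg.2 hst)]
      exact mul_le_mul_of_nonneg_left h2 (sub_nonneg.2 hst)
    have h5 : v t x - v s x - (t - s) * z s x =
      -(v s x - v t x - (s - t) * z t x) - (s - t) * (z t x - z s x) := by ring
    rw [h5]
    refine (abs_sub _ _).trans ?_
    rw [abs_neg]
    linarith

theorem tendsto_abs_sub_rpow (hγ : 0 < γ) (t : ℝ) :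
    Tendsto (fun r : ℝ => |r - t| ^ γ) (𝓝 t) (𝓝 0) := by
  have h : ContinuousAt (fun r : ℝ => |r - t| ^ γ) t :=
    ContinuousAt.rpow_const (by fun_prop) (Or.inr hγ.le)
  have := h.tendsto
  rwa [sub_self, abs_zero, Real.zero_rpow hγ.ne'] at this

theorem TimeRegular.hasDerivAt (h : TimeRegular v z γ) (hγ : 0 < γ) {t : ℝ} (ht : 0 < t) (x : E) :
    HasDerivAt (fun r => v r x) (z t x) t := by
  obtain ⟨C, hC0, hC⟩ := h.symm_bound (T := t + 1) (by linarith)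
  rw [hasDerivAt_iff_isLittleO, Asymptotics.isLittleO_iff]
  intro c hc
  have h1 := (tendsto_abs_sub_rpow hγ t).const_mul C
  rw [mul_zero] at h1
  filter_upwards [h1.eventually (gt_mem_nhds hc), Ioo_mem_nhds ht (lt_add_one t)] with r hr hr'
  have h2 := (hC t r ht.le (by linarith) hr'.1.le hr'.2.le x).2.2
  rw [Real.norm_eq_abs, Real.norm_eq_abs, smul_eq_mul]
  refine h2.trans ?_
  have := mul_le_mul_of_nonneg_right hr.le (abs_nonneg (r - t))
  linarith

theorem TimeRegular.continuousOn_deriv (h : TimeRegular v z γ) (hγ : 0 < γ) (x : E) :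
    ContinuousOn (fun r => z r x) (Ioi 0) := by
  intro t ht
  have ht0 : 0 < t := ht
  obtain ⟨C, hC0, hC⟩ := h.symm_bound (T := t + 1) (by linarith)
  refine ContinuousAt.continuousWithinAt (tendsto_iff_norm_sub_tendsto_zero.2 ?_)
  have h1 := (tendsto_abs_sub_rpow hγ t).const_mul C
  rw [mul_zero] at h1
  refine squeeze_zero' (Eventually.of_forall fun r => norm_nonneg _) ?_ h1
  filter_upwards [Ioo_mem_nhds ht0 (lt_add_one t)] with r hr'
  exact (hC t r ht0.le (by linarith) hr'.1.le hr'.2.le x).2.1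

theorem TimeRegular.continuousOn (h : TimeRegular v z γ) :
    ContinuousOn (fun q : E × ℝ => v q.2 q.1) (univ ×ˢ Ici (0 : ℝ)) := by
  rintro ⟨x, t⟩ ⟨-, ht⟩
  have ht0 : 0 ≤ t := ht
  obtain ⟨C, hC0, hC⟩ := h.symm_bound (T := t + 1) (by linarith)
  obtain ⟨C', hC0', hC'⟩ := h (t + 1) (by linarith)
  refine tendsto_iff_norm_sub_tendsto_zero.2 ?_
  have hc : Continuous fun q : E × ℝ => C * |q.2 - t| + C' * ‖q.1 - x‖ := by fun_prop
  have h1 : Tendsto (fun q : E × ℝ => C * |q.2 - t| + C' * ‖q.1 - x‖) (𝓝 (x, t)) (𝓝 0) := by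
    have := hc.tendsto (x, t)
    simpa using this
  refine squeeze_zero' (Eventually.of_forall fun r => norm_nonneg _) ?_
    (h1.mono_left nhdsWithin_le_nhds)
  have h2 : ∀ᶠ q : E × ℝ in 𝓝 (x, t), q.2 < t + 1 :=
    continuousAt_snd.eventually (gt_mem_nhds (lt_add_one t))
  filter_upwards [nhdsWithin_le_nhds h2, self_mem_nhdsWithin] with q hq hq'
  have hq0 : 0 ≤ q.2 := hq'.2
  have c1 := (hC t q.2 ht0 (by linarith) hq0 hq.le q.1).1
  have c2 := (hC' t t ht0 le_rfl (by linarith) q.1 x).2.2.1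
  exact (abs_sub_le _ (v t q.1) _).trans (add_le_add c1 c2)

theorem TimeRegular.holder (h : TimeRegular v z γ) (hγ : 0 < γ) {t : ℝ} (ht : 0 ≤ t) :
    ∃ C : ℝ, 0 ≤ C ∧ ∀ x y, |z t x - z t y| ≤ C * ‖x - y‖ ^ (γ / (1 + γ)) := by
  obtain ⟨C, hC0, hC⟩ := h (t + 1) (by linarith)
  refine ⟨4 * C, by positivity, fun x y => ?_⟩
  set r := ‖x - y‖ with hr
  have hr0 : 0 ≤ r := norm_nonneg _
  rcases hr0.eq_or_lt with h0 | h0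
  · rw [← h0]
    rw [← h0, eq_comm, norm_eq_zero, sub_eq_zero] at hr
    rw [hr, sub_self, abs_zero]
    have : (0 : ℝ) ≤ 0 ^ (γ / (1 + γ)) := Real.rpow_nonneg le_rfl _
    positivity
  rcases le_total r 1 with h1 | h1
  · set τ := r ^ (1 / (1 + γ)) with hτ
    have hτ0 : 0 < τ := Real.rpow_pos_of_pos h0 _
    have hτ1 : τ ≤ 1 := Real.rpow_le_one hr0 h1 (by positivity)
    have e1 : τ ^ γ = r ^ (γ / (1 + γ)) := by
      rw [hτ, ← Real.rpow_mul hr0]; congr 1; ring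
    have e2 : r = τ * τ ^ γ := by
      rw [e1, hτ, ← Real.rpow_add h0, ← add_div, div_self (by positivity), Real.rpow_one]
    have c := hC t (t + τ) ht (by linarith) (by linarith)
    have c0 := (hC t t ht le_rfl (by linarith) x y).2.2.1
    have c1 := (c x y).2.2.1
    have c2 := (c x y).2.2.2.2.2
    have c3 := (c y x).2.2.2.2.2
    rw [add_sub_cancel_left] at c2 c3
    rw [← hr] at c0 c1
    rw [← e1]
    have key : |τ * (z t x - z t y)| ≤ τ * (4 * C * τ ^ γ) := by
      have e3 : C * r = C * (τ * τ ^ γ) := by rw [← e2]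
      rw [e3] at c0 c1
      rw [abs_le] at *
      constructor <;> linarith
    rw [abs_mul, abs_of_pos hτ0] at key
    exact le_of_mul_le_mul_left key hτ0
  · have c0 := hC t t ht le_rfl (by linarith)
    have c1 := (c0 x y).2.1
    have c2 := (c0 y x).2.1
    have c3 : (1 : ℝ) ≤ r ^ (γ / (1 + γ)) := Real.one_le_rpow h1 (by positivity)
    have c4 := mul_le_mul_of_nonneg_left c3 hC0
    refine (abs_sub _ _).trans ?_
    linarith

theorem TimeRegular.locHolder {d : ℕ} {v z : ℝ → EuclideanSpace ℝ (Fin d) → ℝ}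
    (h : TimeRegular v z γ) (hγ : 0 < γ) {t : ℝ} (ht : 0 ≤ t) :
    LocHolder (v t) ∧ LocHolder (z t) := by
  constructor
  · obtain ⟨C, hC0, hC⟩ := h t ht
    refine fun K _ => ⟨1, C, one_pos, le_rfl, hC0, fun x _ y _ => ?_⟩
    rw [Real.rpow_one]
    exact (hC t t ht le_rfl le_rfl x y).2.2.1
  · obtain ⟨C, hC0, hC⟩ := h.holder hγ ht
    exact fun K _ => ⟨_, C, by positivity, by rw [div_le_one (by positivity)]; linarith, hC0,
      fun x _ y _ => hC x y⟩

end TimeRegularity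

section SchemeLimit
open Filter Topology

namespace Setup
variable {d : ℕ} {s : Setup d} {n : ℕ} {h : ℝ}

/-- The discrete Laplacian of the scheme. -/
noncomputable def gg (s : Setup d) (n : ℕ) (h : ℝ) (k : ℕ) (x : EuclideanSpace ℝ (Fin d)) : ℝ :=
  n * (res n (s.sol n h k) x - s.sol n h k x)

theorem bb_pos (s : Setup d) (hn : 1 ≤ n) (x : EuclideanSpace ℝ (Fin d)) : 0 < s.bb n x :=
  lt_min (s.A_pos x) (by exact_mod_cast hn)

theorem Adm.gg_eq (ha : s.Adm n h) (k : ℕ) (x : EuclideanSpace ℝ (Fin d)) :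
    s.gg n h k x = s.zz n h k x / s.bb n x - s.G n (k * h) (s.sol n h k x) x := by
  have h1 := (s.bb_pos ha.1 x).ne'
  have h2 := ha.2.1.ne'
  have h3 : s.sol n h (k + 1) x = s.sol n h k x + h * s.bb n x *
    (s.gg n h k x + s.G n (k * h) (s.sol n h k x) x) := rfl
  rw [zz, h3]
  field_simp
  ring

theorem exists_abs_gg_le (s : Setup d) {T : ℝ} (hT : 0 ≤ T) : ∃ C : ℝ, 0 ≤ C ∧
    ∀ (n : ℕ) (h : ℝ), s.Adm n h → T ≤ n → ∀ k : ℕ, (k + 1 : ℕ) * h ≤ T → ∀ x,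
      |s.gg n h k x| ≤ C := by
  obtain ⟨C, hC, hz⟩ := s.exists_abs_zz_le hT
  set K := s.S1 T + s.M * s.S T ^ s.p + s.B * s.S T + s.S T with hK
  have hK0 : 0 ≤ K := by
    have := s.S_nonneg hT
    have := s.S1_nonneg hT
    have := s.M_nonneg
    have := s.B_nonneg
    positivity
  have hD := s.D_nonneg
  have hm : 0 < min s.a₀ 1 := lt_min s.ha₀ one_pos
  refine ⟨C * T * s.D / min s.a₀ 1 + K * (2 * s.D), by positivity, fun n h ha hn k hk x => ?_⟩
  have hkT := (ha.time_mono k.le_succ).trans hk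
  have h1 := (ha.inv (hkT.trans hn)).2 x
  have h2 := (abs_G_le ha.1 (ha.time_nonneg k) hkT h1.1 h1.2).trans
    (mul_le_mul_of_nonneg_left (wt_le ha.1 x) hK0)
  have h3 : |s.zz n h k x| ≤ C * T * s.D := (hz n h ha hn k hk x).trans
    (mul_le_mul (mul_le_mul_of_nonneg_left hkT hC) (s.ot_le ha.1 x) (s.ot_pos ha.1 x).le
      (by positivity))
  have h4 : min s.a₀ 1 ≤ s.bb n x := le_min ((min_le_left _ _).trans (s.hAa x))
    ((min_le_right _ _).trans (by exact_mod_cast ha.1))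
  rw [ha.gg_eq]
  refine (abs_sub _ _).trans (add_le_add ?_ h2)
  rw [abs_div, abs_of_pos (s.bb_pos ha.1 x)]
  exact div_le_div₀ (by positivity) h3 hm h4

theorem Adm.res_sol_eq (ha : s.Adm n h) {k : ℕ} (hk : k * h ≤ n) (x : EuclideanSpace ℝ (Fin d)) :
    res n (s.sol n h k) x = res 1 (fun y => res n (s.sol n h k) y - s.gg n h k y) x :=
  res_eq_res_one ha.pos (ha.inv hk).1 (ha.sol_linGrowth hk) x

theorem Adm.continuous_res_sub_gg (ha : s.Adm n h) {k : ℕ} (hk : k * h ≤ n) :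
    Continuous (fun y => res n (s.sol n h k) y - s.gg n h k y) := by
  have h1 := (res_locHolder ha.pos (ha.inv hk).1 (ha.sol_linGrowth hk)).continuous
  have h2 := (ha.inv hk).1.continuous
  exact h1.sub (continuous_const.mul (h1.sub h2))

theorem exists_abs_res_sub_gg_le (s : Setup d) {T : ℝ} (hT : 0 ≤ T) : ∃ C : ℝ, 0 ≤ C ∧
    ∀ (n : ℕ) (h : ℝ), s.Adm n h → T ≤ n → ∀ k : ℕ, (k + 1 : ℕ) * h ≤ T → ∀ x,
      |res n (s.sol n h k) x - s.gg n h k x| ≤ C := by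
  obtain ⟨C₁, h1, hC₁⟩ := s.exists_abs_gg_le hT
  obtain ⟨C₂, h2, hC₂⟩ := s.exists_abs_sol_le hT
  have hD := s.D_nonneg
  refine ⟨C₂ * s.D + C₁, by positivity, fun n h ha hn k hk x => ?_⟩
  have hkT := (ha.time_mono k.le_succ).trans hk
  refine (abs_sub _ _).trans (add_le_add ?_ (hC₁ n h ha hn k hk x))
  exact abs_res_le_const ha.pos (ha.inv (hkT.trans hn)).1.continuous (fun y =>
    (hC₂ n h ha hn k hkT y).trans (mul_le_mul_of_nonneg_left (s.ot_le ha.1 y) h2)) x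

theorem Adm.sol_eq (ha : s.Adm n h) (k : ℕ) (x : EuclideanSpace ℝ (Fin d)) :
    s.sol n h k x = res n (s.sol n h k) x - (n : ℝ)⁻¹ * s.gg n h k x := by
  have := ha.pos.ne'
  rw [gg]; field_simp; ring

theorem exists_abs_sol_sub_le (s : Setup d) {T : ℝ} (hT : 0 ≤ T) : ∃ C : ℝ, 0 ≤ C ∧
    ∀ (n : ℕ) (h : ℝ), s.Adm n h → T ≤ n → ∀ k : ℕ, (k + 1 : ℕ) * h ≤ T → ∀ x y,
      |s.sol n h k x - s.sol n h k y| ≤ C * (‖x - y‖ + (n : ℝ)⁻¹) := by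
  obtain ⟨C₁, h1, hC₁⟩ := s.exists_abs_gg_le hT
  obtain ⟨C₂, h2, hC₂⟩ := s.exists_abs_res_sub_gg_le hT
  obtain ⟨L, hL, hres⟩ := res_lipschitz (E := EuclideanSpace ℝ (Fin d)) one_pos
  refine ⟨L * C₂ + 2 * C₁, by positivity, fun n h ha hn k hk x y => ?_⟩
  have hkT := (ha.time_mono k.le_succ).trans hk
  have e1 := hres _ C₂ (ha.continuous_res_sub_gg (hkT.trans hn)) (hC₂ n h ha hn k hk) x y
  rw [← ha.res_sol_eq (hkT.trans hn), ← ha.res_sol_eq (hkT.trans hn)] at e1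
  have hn0 : (0 : ℝ) ≤ (n : ℝ)⁻¹ := inv_nonneg.2 ha.pos.le
  have e2 : ∀ y, |(n : ℝ)⁻¹ * s.gg n h k y| ≤ (n : ℝ)⁻¹ * C₁ := fun y => by
    rw [abs_mul, abs_of_nonneg hn0]
    exact mul_le_mul_of_nonneg_left (hC₁ n h ha hn k hk y) hn0
  have e3 := e2 x
  have e4 := e2 y
  rw [ha.sol_eq k x, ha.sol_eq k y]
  have e5 : 0 ≤ L * C₂ * (n : ℝ)⁻¹ := by positivity
  have e6 : 0 ≤ C₁ * ‖x - y‖ := by positivity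
  rw [abs_le] at *
  constructor <;> linarith

theorem Adm.abs_sol_sub_le (ha : s.Adm n h) {X Y : ℝ} {x : EuclideanSpace ℝ (Fin d)} {k j : ℕ}
    (hY : ∀ i < j, |s.zz n h (k + i) x - X| ≤ Y) :
    |s.sol n h (k + j) x - s.sol n h k x - j * h * X| ≤ j * h * Y := by
  induction j with
  | zero => simp
  | succ j ih =>
    have h1 := ih fun i hi => hY i (by omega)
    have h2 := mul_le_mul_of_nonneg_left (hY j (by omega)) ha.2.1.le
    have h3 : s.sol n h (k + j + 1) x = s.sol n h (k + j) x + h * s.zz n h (k + j) x := by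
      have := ha.2.1.ne'
      rw [zz]; field_simp; ring
    rw [← abs_of_pos ha.2.1, ← abs_mul, abs_of_pos ha.2.1] at h2
    rw [← add_assoc, h3]
    push_cast
    rw [abs_le] at *
    constructor <;> linarith

/-- An admissible step size. -/
noncomputable def hs (s : Setup d) (n : ℕ) : ℝ :=
  (n * n + s.M * s.p * s.S n ^ (s.p - 1) * (n * s.D) + n + 1)⁻¹

theorem hs_aux (s : Setup d) (n : ℕ) :
    0 ≤ n * n + s.M * s.p * s.S n ^ (s.p - 1) * (n * s.D) := by
  have := s.M_nonneg
  have := s.D_nonneg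
  have : 0 ≤ s.S n := s.S_nonneg n.cast_nonneg
  have : 0 ≤ s.p := by linarith [s.hp1]
  positivity

theorem hs_pos (s : Setup d) (n : ℕ) : 0 < s.hs n := by
  have := s.hs_aux n
  rw [hs]
  positivity

theorem adm_hs (s : Setup d) (hn : 1 ≤ n) : s.Adm n (s.hs n) := by
  have := s.hs_aux n
  refine ⟨hn, s.hs_pos n, ?_⟩
  rw [hs, inv_mul_le_one₀ (by positivity)]
  have : (0 : ℝ) ≤ n := n.cast_nonneg
  linarith

theorem hs_le (s : Setup d) (hn : 1 ≤ n) : s.hs n ≤ (n : ℝ)⁻¹ := by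
  have := s.hs_aux n
  have h0 : (0 : ℝ) < n := by exact_mod_cast hn
  exact inv_anti₀ h0 (by linarith)

/-- The index of the last time step before `t`. -/
noncomputable def ix (s : Setup d) (n : ℕ) (t : ℝ) : ℕ := ⌊t / s.hs n⌋₊

theorem ix_mul_le (s : Setup d) (n : ℕ) {t : ℝ} (ht : 0 ≤ t) : s.ix n t * s.hs n ≤ t := by
  rw [← le_div_iff₀ (s.hs_pos n)]
  exact Nat.floor_le (div_nonneg ht (s.hs_pos n).le)

theorem lt_ix_mul (s : Setup d) (n : ℕ) (t : ℝ) : t < (s.ix n t + 1 : ℕ) * s.hs n := by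
  rw [← div_lt_iff₀ (s.hs_pos n)]
  exact_mod_cast Nat.lt_floor_add_one (t / s.hs n)

theorem ix_mono (s : Setup d) (n : ℕ) {r t : ℝ} (h : r ≤ t) : s.ix n r ≤ s.ix n t :=
  Nat.floor_mono (div_le_div_of_nonneg_right h (s.hs_pos n).le)

theorem ix_add_one_le (s : Setup d) (hn : 1 ≤ n) {t : ℝ} (ht : 0 ≤ t) :
    (s.ix n t + 1 : ℕ) * s.hs n ≤ t + 1 := by
  have h1 := s.ix_mul_le n ht
  have h2 : (n : ℝ)⁻¹ ≤ 1 := (inv_mem hn).2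
  have h3 := s.hs_le hn
  push_cast
  linarith

theorem tendsto_ix_mul (s : Setup d) {t : ℝ} (ht : 0 ≤ t) :
    Tendsto (fun n => s.ix n t * s.hs n) atTop (𝓝 t) := by
  have h1 : Tendsto (fun n : ℕ => t - (n : ℝ)⁻¹) atTop (𝓝 t) := by
    simpa using (tendsto_inv_atTop_nhds_zero_nat (𝕜 := ℝ)).const_sub t
  refine tendsto_of_tendsto_of_tendsto_of_le_of_le' h1 tendsto_const_nhds ?_
    (Eventually.of_forall fun n => s.ix_mul_le n ht)
  filter_upwards [eventually_ge_atTop 1] with n hn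
  have h2 := s.lt_ix_mul n t
  have h3 := s.hs_le hn
  push_cast at h2
  linarith

theorem approxEquicont (s : Setup d) : ApproxEquicont
    (fun n t => s.sol n (s.hs n) (s.ix n t)) (fun n t => s.zz n (s.hs n) (s.ix n t))
    (fun n => (n : ℝ)⁻¹) (s.p - 1) where
  γ_pos := s.p_sub_one_pos
  e_nonneg n := inv_nonneg.2 n.cast_nonneg
  e_tendsto := tendsto_inv_atTop_nhds_zero_nat
  bound T hT := by
    have hT1 : 0 ≤ T + 1 := by linarith
    obtain ⟨C₁, h1, hC₁⟩ := s.exists_abs_sol_le hT1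
    obtain ⟨C₂, h2, hC₂⟩ := s.exists_abs_zz_le hT1
    obtain ⟨C₃, h3, hC₃⟩ := s.exists_abs_zz_sub_le hT1
    obtain ⟨C₄, h4, hC₄⟩ := s.exists_abs_sol_sub_le hT1
    have hD := s.D_nonneg
    have hγ := s.p_sub_one_pos
    set K₂ := C₂ * (T + 1) * s.D with hK₂
    have hK₂0 : 0 ≤ K₂ := by positivity
    set C := C₁ * s.D + K₂ + C₃ * s.D + C₄ with hC
    have hC0 : 0 ≤ C := by positivity
    have l1 : C₁ * s.D ≤ C := by have : 0 ≤ C₃ * s.D := by positivity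
                                 linarith [mul_nonneg h1 hD]
    have l2 : K₂ ≤ C := by linarith [mul_nonneg h1 hD, mul_nonneg h3 hD]
    have l3 : C₃ * s.D ≤ C := by linarith [mul_nonneg h1 hD, mul_nonneg h3 hD]
    have l23 : K₂ + C₃ * s.D ≤ C := by linarith [mul_nonneg h1 hD, mul_nonneg h3 hD]
    have l4 : C₄ ≤ C := by linarith [mul_nonneg h1 hD, mul_nonneg h3 hD]
    refine ⟨C, hC0, ?_⟩
    filter_upwards [eventually_ge_atTop (⌈T + 1⌉₊ + 1)] with n hn r t hr hrt htT x y
    have hn1 : 1 ≤ n := by omega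
    have hnT : T + 1 ≤ n := (Nat.le_ceil _).trans (by exact_mod_cast (by omega : ⌈T + 1⌉₊ ≤ n))
    have ha := s.adm_hs hn1
    have ht := hr.trans hrt
    have hk : ∀ k ≤ s.ix n t, ((k + 1 : ℕ) : ℝ) * s.hs n ≤ T + 1 := fun k hk =>
      (ha.time_mono (Nat.succ_le_succ hk)).trans ((s.ix_add_one_le hn1 ht).trans (by linarith))
    have hk' : ∀ k ≤ s.ix n t, (k : ℝ) * s.hs n ≤ T + 1 := fun k hkt =>
      (ha.time_mono k.le_succ).trans (hk k hkt)
    have hz : ∀ k ≤ s.ix n t, |s.zz n (s.hs n) k x| ≤ K₂ := fun k hkt =>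
      (hC₂ n _ ha hnT k (hk k hkt) x).trans (mul_le_mul
        (mul_le_mul_of_nonneg_left (hk' k hkt) h2) (s.ot_le hn1 x) (s.ot_pos hn1 x).le
        (by positivity))
    obtain ⟨j, hj⟩ := Nat.exists_eq_add_of_le (s.ix_mono n hrt)
    set i := s.ix n r with hi
    set e := (n : ℝ)⁻¹ with he
    have he0 : 0 ≤ e := inv_nonneg.2 n.cast_nonneg
    have hle : s.hs n ≤ e := s.hs_le hn1
    have hjh := ha.time_nonneg j
    have b1 := s.ix_mul_le n ht
    have b2 := s.lt_ix_mul n t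
    have b3 := s.ix_mul_le n hr
    have b4 := s.lt_ix_mul n r
    rw [← hi] at b3 b4
    rw [hj] at b1 b2
    push_cast at b1 b2 b4
    have hj1 : j * s.hs n ≤ t - r + e := by linarith
    have hj2 : |j * s.hs n - (t - r)| ≤ e := by
      rw [abs_le]; constructor <;> linarith
    have hpow : (j * s.hs n) ^ (s.p - 1) ≤ (t - r + e) ^ (s.p - 1) :=
      Real.rpow_le_rpow hjh hj1 hγ.le
    have hw0 : 0 ≤ t - r + e := by linarith
    have hp0 : 0 ≤ (t - r + e) ^ (s.p - 1) := Real.rpow_nonneg hw0 _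
    have hzd : ∀ l ≤ j, |s.zz n (s.hs n) (i + l) x - s.zz n (s.hs n) i x| ≤
        C₃ * s.D * (t - r + e) ^ (s.p - 1) := by
      intro l hl
      refine (hC₃ n _ ha hnT i l (hk (i + l) (by omega)) x).trans ?_
      have q1 : ((l : ℝ) * s.hs n) ^ (s.p - 1) ≤ (t - r + e) ^ (s.p - 1) :=
        Real.rpow_le_rpow (ha.time_nonneg l) ((ha.time_mono hl).trans hj1) hγ.le
      have q2 : C₃ * ((l : ℝ) * s.hs n) ^ (s.p - 1) * s.ot n x ≤
          C₃ * (t - r + e) ^ (s.p - 1) * s.D :=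
        mul_le_mul (mul_le_mul_of_nonneg_left q1 h3) (s.ot_le hn1 x) (s.ot_pos hn1 x).le
          (by positivity)
      linarith
    have hd1 := ha.abs_sol_sub_le (X := 0) (Y := K₂) (x := x) (k := i) (j := j)
      fun l hl => by rw [sub_zero]; exact hz _ (by omega)
    have hd2 := ha.abs_sol_sub_le (X := s.zz n (s.hs n) i x)
      (Y := C₃ * s.D * (t - r + e) ^ (s.p - 1)) (x := x) (k := i) (j := j)
      fun l hl => hzd l hl.le
    rw [mul_zero, sub_zero] at hd1
    refine ⟨?_, (hz _ le_rfl).trans l2, ?_, ?_, ?_, ?_⟩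
    · exact ((hC₁ n _ ha hnT _ (hk' _ le_rfl) x).trans
        (mul_le_mul_of_nonneg_left (s.ot_le hn1 x) h1)).trans l1
    · exact (hC₄ n _ ha hnT _ (hk _ le_rfl) x y).trans
        (mul_le_mul_of_nonneg_right l4 (by positivity))
    · rw [hj]
      refine hd1.trans ?_
      rw [mul_comm]
      exact mul_le_mul l2 hj1 hjh hC0
    · rw [hj]
      exact (hzd j le_rfl).trans (mul_le_mul_of_nonneg_right l3 hp0)
    · rw [hj]
      have q1 : |(j * s.hs n - (t - r)) * s.zz n (s.hs n) i x| ≤ e * K₂ := by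
        rw [abs_mul]
        exact mul_le_mul hj2 (hz i (by omega)) (abs_nonneg _) he0
      have q2 : s.sol n (s.hs n) (i + j) x - s.sol n (s.hs n) i x -
          (t - r) * s.zz n (s.hs n) i x = (s.sol n (s.hs n) (i + j) x - s.sol n (s.hs n) i x -
          j * s.hs n * s.zz n (s.hs n) i x) +
          (j * s.hs n - (t - r)) * s.zz n (s.hs n) i x := by ring
      rw [q2]
      refine (abs_add_le _ _).trans ((add_le_add hd2 q1).trans ?_)
      have q3 : j * s.hs n * (C₃ * s.D * (t - r + e) ^ (s.p - 1)) ≤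
          (t - r + e) * (C * (t - r + e) ^ (s.p - 1)) :=
        mul_le_mul hj1 (mul_le_mul_of_nonneg_right l3 hp0) (by positivity) hw0
      have q4 := mul_le_mul_of_nonneg_left l2 he0
      linarith

end Setup
end SchemeLimit

section SchemeSolution
open Filter Topology

namespace Setup
variable {d : ℕ} (s : Setup d) {φ : ℕ → ℕ}

theorem pt_zero (x : EuclideanSpace ℝ (Fin d)) : s.pt 0 x = s.ψ x := by simp [pt]

theorem tendsto_pt (x : EuclideanSpace ℝ (Fin d)) (hφ : Tendsto φ atTop atTop) :
    Tendsto (fun n => s.pt (φ n) x) atTop (𝓝 (s.ψ x)) := by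
  have := (((tendsto_inv_atTop_nhds_zero_nat (𝕜 := ℝ)).comp hφ).mul_const
    (lap s.ψ x)).const_sub (s.ψ x)
  simpa [pt] using this

theorem tendsto_ot (x : EuclideanSpace ℝ (Fin d)) (hφ : Tendsto φ atTop atTop) :
    Tendsto (fun n => s.ot (φ n) x) atTop (𝓝 (s.ω x)) := by
  have := (((tendsto_inv_atTop_nhds_zero_nat (𝕜 := ℝ)).comp hφ).mul_const
    (lap s.ω x)).const_sub (s.ω x)
  simpa [ot] using this

theorem tendsto_bb (x : EuclideanSpace ℝ (Fin d)) (hφ : Tendsto φ atTop atTop) :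
    Tendsto (fun n => s.bb (φ n) x) atTop (𝓝 (s.A x)) := by
  refine tendsto_const_nhds.congr' ?_
  filter_upwards [hφ.eventually_ge_atTop ⌈s.A x⌉₊] with n hn
  exact (min_eq_left ((Nat.le_ceil _).trans (by exact_mod_cast hn))).symm

theorem tendsto_G {r w : ℕ → ℝ} {t l : ℝ} (x : EuclideanSpace ℝ (Fin d))
    (hφ : Tendsto φ atTop atTop) (hr : Tendsto r atTop (𝓝 t)) (hw : Tendsto w atTop (𝓝 l)) :
    Tendsto (fun n => s.G (φ n) (r n) (w n) x) atTop (𝓝 (s.G 0 t l x)) := by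
  have h1 := (s.hS t).continuousAt.tendsto.comp hr
  have h2 := (s.hS1 t).continuousAt.tendsto.comp hr
  have h3 := s.tendsto_pt x hφ
  have h4 := (h1.mul h3).sub hw
  have hp : 0 ≤ s.p := by linarith [s.hp1]
  have h5 := h4.rpow_const (Or.inr hp)
  have := (((h2.mul h3).add (h5.const_mul (s.α x))).sub (h4.const_mul (s.β x))).const_mul
    (s.A x)⁻¹ |>.sub (h1.mul_const (lap s.ψ x))
  simpa only [G, pt_zero, Function.comp_def] using this

theorem exists_limit : ∃ v z : ℝ → EuclideanSpace ℝ (Fin d) → ℝ, TimeRegular v z (s.p - 1) ∧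
    (∀ t, 0 ≤ t → ∀ x, 0 ≤ v t x ∧ v t x ≤ s.S t * s.ψ x) ∧
    (∀ t, 0 ≤ t → ∃ C, 0 ≤ C ∧ ∀ x, v t x ≤ C * s.ω x) ∧
    ∀ t, 0 ≤ t → (∃ C, ∀ x, |v t x - (z t x / s.A x - s.G 0 t (v t x) x)| ≤ C) ∧
      ∀ x, v t x = res 1 (fun y => v t y - (z t y / s.A y - s.G 0 t (v t y) y)) x := by
  obtain ⟨φ, hφ, hlim⟩ := s.approxEquicont.exists_lim
  have hex : ∀ t x, ∃ a b : ℝ, 0 ≤ t →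
      Tendsto (fun n => s.sol (φ n) (s.hs (φ n)) (s.ix (φ n) t) x) atTop (𝓝 a) ∧
      Tendsto (fun n => s.zz (φ n) (s.hs (φ n)) (s.ix (φ n) t) x) atTop (𝓝 b) := by
    intro t x
    by_cases ht : 0 ≤ t
    · obtain ⟨⟨a, ha⟩, b, hb⟩ := hlim t x ht
      exact ⟨a, b, fun _ => ⟨ha, hb⟩⟩
    · exact ⟨0, 0, fun h => absurd h ht⟩
  choose v z hvz using hex
  have hφt := hφ.tendsto_atTop
  have hadm : ∀ T : ℝ, ∀ᶠ n in atTop, s.Adm (φ n) (s.hs (φ n)) ∧ T ≤ φ n := fun T => by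
    filter_upwards [hφt.eventually_ge_atTop (max 1 ⌈T⌉₊)] with n hn
    exact ⟨s.adm_hs ((le_max_left _ _).trans hn),
      (Nat.le_ceil _).trans (by exact_mod_cast (le_max_right _ _).trans hn)⟩
  have htime : ∀ t, 0 ≤ t →
      Tendsto (fun n => s.ix (φ n) t * s.hs (φ n)) atTop (𝓝 t) := fun t ht =>
    (s.tendsto_ix_mul ht).comp hφt
  refine ⟨v, z, fun T hT => s.approxEquicont.lim_bound hφ (fun t x ht => (hvz t x ht).1)
    (fun t x ht => (hvz t x ht).2) hT, fun t ht x => ?_, fun t ht => ?_, fun t ht => ?_⟩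
  · have hb : ∀ᶠ n in atTop, 0 ≤ s.sol (φ n) (s.hs (φ n)) (s.ix (φ n) t) x ∧
        s.sol (φ n) (s.hs (φ n)) (s.ix (φ n) t) x ≤
          s.S (s.ix (φ n) t * s.hs (φ n)) * s.pt (φ n) x := by
      filter_upwards [hadm t] with n hn
      exact (hn.1.inv ((s.ix_mul_le _ ht).trans hn.2)).2 x
    refine ⟨ge_of_tendsto (hvz t x ht).1 (hb.mono fun n hn => hn.1), ?_⟩
    exact le_of_tendsto_of_tendsto (hvz t x ht).1
      (((s.hS t).continuousAt.tendsto.comp (htime t ht)).mul (s.tendsto_pt x hφt))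
      (hb.mono fun n hn => hn.2)
  · obtain ⟨C, hC, hb⟩ := s.exists_abs_sol_le ht
    refine ⟨C, hC, fun x => le_of_tendsto_of_tendsto (hvz t x ht).1
      ((s.tendsto_ot x hφt).const_mul C) ?_⟩
    filter_upwards [hadm t] with n hn
    exact (le_abs_self _).trans (hb _ _ hn.1 hn.2 _ (s.ix_mul_le _ ht) x)
  · have hT : 0 ≤ t + 1 := by linarith
    obtain ⟨C, hC, hb⟩ := s.exists_abs_res_sub_gg_le hT
    obtain ⟨C', hC', hb'⟩ := s.exists_abs_gg_le hT
    obtain ⟨N, hN⟩ := eventually_atTop.1 (hadm (t + 1))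
    have hshift := tendsto_add_atTop_nat N
    have hφN := hφt.comp hshift
    have hN' : ∀ n, s.Adm (φ (n + N)) (s.hs (φ (n + N))) ∧ t + 1 ≤ φ (n + N) :=
      fun n => hN _ (Nat.le_add_left _ _)
    have hk : ∀ n, ((s.ix (φ (n + N)) t + 1 : ℕ) : ℝ) * s.hs (φ (n + N)) ≤ t + 1 :=
      fun n => s.ix_add_one_le (hN' n).1.1 ht
    have hk' : ∀ n, (s.ix (φ (n + N)) t : ℝ) * s.hs (φ (n + N)) ≤ φ (n + N) :=
      fun n => (s.ix_mul_le _ ht).trans (by linarith [(hN' n).2])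
    have hsol : ∀ x, Tendsto (fun n => s.sol (φ (n + N)) (s.hs (φ (n + N)))
        (s.ix (φ (n + N)) t) x) atTop (𝓝 (v t x)) := fun x => (hvz t x ht).1.comp hshift
    have hgg : ∀ x, Tendsto (fun n => s.gg (φ (n + N)) (s.hs (φ (n + N)))
        (s.ix (φ (n + N)) t) x) atTop (𝓝 (z t x / s.A x - s.G 0 t (v t x) x)) := by
      intro x
      have h1 := ((hvz t x ht).2.comp hshift).div (s.tendsto_bb x hφN) (s.A_pos x).ne'
      have h2 := s.tendsto_G x hφN ((htime t ht).comp hshift) (hsol x)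
      refine (h1.sub h2).congr fun n => ?_
      exact ((hN' n).1.gg_eq _ x).symm
    have hres : ∀ x, Tendsto (fun n => res (φ (n + N)) (s.sol (φ (n + N)) (s.hs (φ (n + N)))
        (s.ix (φ (n + N)) t)) x) atTop (𝓝 (v t x)) := by
      intro x
      have h1 := ((tendsto_inv_atTop_nhds_zero_nat (𝕜 := ℝ)).comp hφN).mul (hgg x)
      rw [zero_mul] at h1
      have h2 := (hsol x).add h1
      rw [add_zero] at h2
      refine h2.congr fun n => ?_
      rw [(hN' n).1.sol_eq]
      simp
    have hdiff : ∀ x, Tendsto (fun n => res (φ (n + N)) (s.sol (φ (n + N)) (s.hs (φ (n + N)))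
        (s.ix (φ (n + N)) t)) x - s.gg (φ (n + N)) (s.hs (φ (n + N)))
        (s.ix (φ (n + N)) t) x) atTop (𝓝 (v t x - (z t x / s.A x - s.G 0 t (v t x) x))) :=
      fun x => (hres x).sub (hgg x)
    have hbd := fun n x => hb _ _ (hN' n).1 (hN' n).2 _ (hk n) x
    refine ⟨⟨C, fun x => le_of_tendsto (hdiff x).abs (Eventually.of_forall fun n => hbd n x)⟩,
      fun x => ?_⟩
    refine tendsto_nhds_unique (hres x) ?_
    refine (res_tendsto one_pos (fun n => (hN' n).1.continuous_res_sub_gg (hk' n)) hbd hdiff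
      x).congr fun n => ?_
    exact ((hN' n).1.res_sol_eq (hk' n) x).symm

end Setup
end SchemeSolution

section Conclusion
open Filter Topology

theorem hasDerivAt_pow_mul_exp (n : ℕ) (a t : ℝ) :
    HasDerivAt (fun t => t ^ (n + 1) * Real.exp (a * t))
      ((n + 1) * (t ^ n * Real.exp (a * t)) + a * (t ^ (n + 1) * Real.exp (a * t))) t := by
  have h1 : HasDerivAt (fun t => Real.exp (a * t)) (Real.exp (a * t) * a) t :=
    ((hasDerivAt_id t).const_mul a |>.congr_deriv (mul_one a)).exp
  refine ((hasDerivAt_pow (n + 1) t).mul h1).congr_deriv ?_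
  push_cast
  ring

/-- A function vanishing to third order at `0` and growing at rate at least `a`. -/
theorem exists_growth {a : ℝ} (ha : 0 ≤ a) : ∃ S S1 S2 S3 : ℝ → ℝ,
    (∀ t, HasDerivAt S (S1 t) t) ∧ (∀ t, HasDerivAt S1 (S2 t) t) ∧
    (∀ t, HasDerivAt S2 (S3 t) t) ∧ Continuous S3 ∧ S 0 = 0 ∧ S1 0 = 0 ∧ S2 0 = 0 ∧
    (∀ t, 0 ≤ t → 0 ≤ S2 t) ∧ (∀ t, 0 ≤ t → a * S t ≤ S1 t) ∧ 0 < S 1 := by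
  set e : ℕ → ℝ → ℝ := fun n t => t ^ n * Real.exp (a * t) with he
  have h0 : ∀ t, HasDerivAt (e 0) (a * e 0 t) t := fun t => by
    have h1 : HasDerivAt (fun t => Real.exp (a * t)) (Real.exp (a * t) * a) t :=
      ((hasDerivAt_id t).const_mul a |>.congr_deriv (mul_one a)).exp
    simpa [he, mul_comm] using h1
  have hs : ∀ (n : ℕ) t, HasDerivAt (e (n + 1)) ((n + 1) * e n t + a * e (n + 1) t) t :=
    fun n t => hasDerivAt_pow_mul_exp n a t
  have hc : ∀ n, Continuous (e n) := fun n => by simp only [he]; fun_prop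
  have hp : ∀ n t, 0 ≤ t → 0 ≤ e n t := fun n t ht => by simp only [he]; positivity
  have hz : ∀ n, e (n + 1) 0 = 0 := fun n => by simp [he]
  refine ⟨e 3, fun t => 3 * e 2 t + a * e 3 t,
    fun t => 6 * e 1 t + 6 * a * e 2 t + a ^ 2 * e 3 t,
    fun t => 6 * e 0 t + 18 * a * e 1 t + 9 * a ^ 2 * e 2 t + a ^ 3 * e 3 t,
    fun t => (hs 2 t).congr_deriv (by norm_num), fun t => ?_, fun t => ?_, ?_, hz 2, ?_, ?_,
    fun t ht => ?_, fun t ht => ?_, ?_⟩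
  · refine (((hs 1 t).const_mul 3).add ((hs 2 t).const_mul a)).congr_deriv ?_
    push_cast; ring
  · refine ((((hs 0 t).const_mul 6).add ((hs 1 t).const_mul (6 * a))).add
      ((hs 2 t).const_mul (a ^ 2))).congr_deriv ?_
    push_cast; ring
  · have := hc 0; have := hc 1; have := hc 2; have := hc 3
    fun_prop
  · simp [hz]
  · simp [hz]
  · have := hp 1 t ht; have := hp 2 t ht; have := hp 3 t ht
    positivity
  · have := hp 2 t ht
    linarith
  · simp only [he]; positivity

namespace Setup
variable {d : ℕ} (s : Setup d)

/-- Along the scheme limit, `Δv` is recovered from the resolvent identity. -/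
theorem lap_of_res_eq {v z : ℝ → EuclideanSpace ℝ (Fin d) → ℝ} (h : TimeRegular v z (s.p - 1))
    {t C : ℝ} (ht : 0 ≤ t) (hv : ∀ x, v t x ≤ s.S t * s.ψ x)
    (hb : ∀ x, |v t x - (z t x / s.A x - s.G 0 t (v t x) x)| ≤ C)
    (hr : ∀ x, v t x = res 1 (fun y => v t y - (z t y / s.A y - s.G 0 t (v t y) y)) x) :
    ContDiff ℝ 2 (v t) ∧ ∀ x, lap (v t) x = z t x / s.A x - s.G 0 t (v t x) x := by
  obtain ⟨h1, h2⟩ := h.locHolder s.p_sub_one_pos ht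
  have h3 := s.G_locHolder (n := 0) (t := t) h1 fun x => by rw [s.pt_zero]; exact hv x
  have h4 : LocHolder (fun y => v t y - (z t y / s.A y - s.G 0 t (v t y) y)) := by
    simp only [div_eq_mul_inv]
    exact h1.sub ((h2.mul (s.hA.inv s.ha₀ s.hAa)).sub h3)
  have h5 := linGrowth_of_bounded hb
  have hr' := funext hr
  refine ⟨?_, fun x => ?_⟩
  · rw [hr']
    exact res_contDiff one_pos h4.continuous h5 (h4.locIncr h5)
  · have h6 := res_lap one_pos h4 h5 x
    rw [← hr'] at h6
    rw [h6]
    ring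

theorem exists_solution (hS : 0 < s.S 1) : ∃ u : EuclideanSpace ℝ (Fin d) → ℝ → ℝ,
    ContinuousOn (fun q : EuclideanSpace ℝ (Fin d) × ℝ => u q.1 q.2) (univ ×ˢ Ici (0 : ℝ)) ∧
    (∀ x t, 0 ≤ t → 0 ≤ u x t) ∧
    (∀ t : ℝ, 0 < t → ContDiff ℝ 2 (fun x => u x t)) ∧
    (∀ x, ContDiffOn ℝ 1 (fun s => u x s) (Ioi (0 : ℝ))) ∧
    (∀ x t, 0 < t → deriv (fun s => u x s) t =
      s.A x * lap (fun y => u y t) x + s.β x * u x t - s.α x * u x t ^ s.p) ∧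
    (∀ x, u x 0 = 0) ∧ (∃ x t, 0 ≤ t ∧ u x t ≠ 0) := by
  obtain ⟨v, z, hreg, hv, hω, hres⟩ := s.exists_limit
  have hγ := s.p_sub_one_pos
  have hψ : ContDiff ℝ 2 s.ψ := s.bar.contDiff_ψ.of_le (by norm_num)
  have hlap : ∀ t, 0 ≤ t → ContDiff ℝ 2 (v t) ∧
      ∀ x, lap (v t) x = z t x / s.A x - s.G 0 t (v t x) x := fun t ht => by
    obtain ⟨⟨C, hC⟩, hr⟩ := hres t ht
    exact s.lap_of_res_eq hreg ht (fun x => (hv t ht x).2) hC hr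
  have hder : ∀ x t, 0 < t → HasDerivAt (fun r => s.S r * s.ψ x - v r x)
      (s.S1 t * s.ψ x - z t x) t := fun x t ht =>
    ((s.hS t).mul_const _).sub (hreg.hasDerivAt hγ ht x)
  have hSc : Continuous s.S := continuous_iff_continuousAt.2 fun t => (s.hS t).continuousAt
  have hS1c : Continuous s.S1 := continuous_iff_continuousAt.2 fun t => (s.hS1 t).continuousAt
  refine ⟨fun x t => s.S t * s.ψ x - v t x, ?_, fun x t ht => sub_nonneg.2 (hv t ht x).2,
    fun t ht => (contDiff_const.mul hψ).sub (hlap t ht.le).1, fun x => ?_, fun x t ht => ?_,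
    fun x => ?_, ?_⟩
  · exact (((hSc.comp continuous_snd).mul
      (hψ.continuous.comp continuous_fst)).continuousOn).sub hreg.continuousOn
  · rw [show (1 : WithTop ℕ∞) = 0 + 1 by norm_num,
      contDiffOn_succ_iff_deriv_of_isOpen isOpen_Ioi]
    refine ⟨fun t ht => (hder x t ht).differentiableAt.differentiableWithinAt, by simp, ?_⟩
    rw [contDiffOn_zero]
    exact (((hS1c.mul continuous_const).continuousOn).sub (hreg.continuousOn_deriv hγ x)).congr
      fun t ht => (hder x t ht).deriv
  · have h1 := (s.A_pos x).ne'
    rw [(hder x t ht).deriv, lap_sub (contDiff_const.mul hψ) (hlap t ht.le).1,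
      lap_const_mul hψ, (hlap t ht.le).2, G, pt_zero]
    field_simp
    ring
  · have := hv 0 le_rfl x
    rw [s.S_zero, zero_mul] at this
    simp only [s.S_zero, zero_mul, zero_sub, neg_eq_zero]
    exact le_antisymm this.2 this.1
  · obtain ⟨C, hC, hCω⟩ := hω 1 zero_le_one
    have hη : 0 < s.S 1 / (2 * (C + 1)) := by positivity
    obtain ⟨x, hx⟩ := s.bar.small _ hη
    refine ⟨x, 1, zero_le_one, (sub_pos.2 ?_).ne'⟩
    have hψ1 : 1 ≤ s.ψ x := by
      have := s.bar.one_le 0 (by simp) x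
      simpa using this
    have h1 := mul_le_mul_of_nonneg_left hx hC
    have h2 : C * (s.S 1 / (2 * (C + 1)) * s.ψ x) < s.S 1 * s.ψ x := by
      have h3 : C * (s.S 1 / (2 * (C + 1))) < s.S 1 := by
        rw [← mul_div_assoc, div_lt_iff₀ (by positivity)]
        nlinarith
      rw [← mul_assoc]
      exact mul_lt_mul_of_pos_right h3 (by linarith)
    exact (hCω x).trans_lt (h1.trans_lt h2)

end Setup
end Conclusion

/-- Theorem EP3, part (1): `d ≥ 2`, `L = A(x)Δ` with
`A(x) ≥ C(1+|x|)^m`, `m > 2`, `α` bounded, `β ≥ 0`: there is a nontrivial nonnegative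
classical solution of `u_t = AΔu + βu − αu^p` with zero initial data. -/
theorem stmt_4 {d : ℕ} (hd : 2 ≤ d) (p : ℝ) (hp1 : 1 < p) (hp2 : p ≤ 2)
    (m : ℝ) (hm : 2 < m)
    (A : EuclideanSpace ℝ (Fin d) → ℝ) (hA_holder : LocHolder A)
    (hA_pos : ∀ x, 0 < A x)
    (C : ℝ) (hC : 0 < C)
    (hA_lower : ∀ x, C * (1 + ‖x‖) ^ m ≤ A x)
    (α β : EuclideanSpace ℝ (Fin d) → ℝ)
    (hα_holder : LocHolder α) (hβ_holder : LocHolder β)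
    (hα_pos : ∀ x, 0 < α x)
    (hα_bdd : ∃ M : ℝ, ∀ x, α x ≤ M)
    (hβ_nonneg : ∀ x, 0 ≤ β x)
    (hβ_bdd : ∃ M : ℝ, ∀ x, β x ≤ M) :
    ∃ u : EuclideanSpace ℝ (Fin d) → ℝ → ℝ,
      ContinuousOn (fun q : EuclideanSpace ℝ (Fin d) × ℝ => u q.1 q.2)
        (univ ×ˢ Ici (0 : ℝ)) ∧
      (∀ x t, 0 ≤ t → 0 ≤ u x t) ∧
      (∀ t : ℝ, 0 < t → ContDiff ℝ 2 (fun x => u x t)) ∧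
      (∀ x, ContDiffOn ℝ 1 (fun s => u x s) (Ioi (0 : ℝ))) ∧
      (∀ x t, 0 < t →
        deriv (fun s => u x s) t =
          A x * (∑ i, pd i (pd i (fun y => u y t)) x)
            + β x * u x t - α x * u x t ^ p) ∧
      (∀ x, u x 0 = 0) ∧
      (∃ x t, 0 ≤ t ∧ u x t ≠ 0) := by
  obtain ⟨M, hM⟩ := hα_bdd
  obtain ⟨B, hB⟩ := hβ_bdd
  obtain ⟨ψ, ω, c, D, L, bar⟩ := exists_barrier (p := p) hd hp2 hm hC hA_holder.continuous hA_lower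
  obtain ⟨S, S1, S2, S3, hS, hS1, hS2, hS3, h0, h1, h2, hnn, hg, hpos⟩ :=
    exists_growth (a := B + c) (add_nonneg ((hβ_nonneg 0).trans (hB 0)) bar.c_nonneg)
  have hCA : ∀ x, C ≤ A x := fun x =>
    (le_mul_of_one_le_right hC.le (Real.one_le_rpow (by linarith [norm_nonneg x])
      (by linarith))).trans (hA_lower x)
  let s : Setup d :=
    { A := A, α := α, β := β, ψ := ψ, ω := ω, S := S, S1 := S1, S2 := S2, S3 := S3, p := p, c := c
      D := D, L := L, B := B, M := M, a₀ := C, hA := hA_holder, ha₀ := hC, hAa := hCA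
      hα := hα_holder, hα0 := fun x => (hα_pos x).le, hαM := hM, hβ := hβ_holder
      hβ0 := hβ_nonneg, hβB := hB, hp1 := hp1, hp2 := hp2, bar := bar, hS := hS, hS1 := hS1
      hS2 := hS2, S3_cont := hS3, S_zero := h0, S1_zero := h1, S2_zero := h2
      S2_nonneg := hnn, S_growth := hg }
  exact s.exists_solution hpos
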